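/- (Prime ends under change of ambient surface: monotone surjection, plane case.) Let U ⊆ ℝ² be an open simply connected set such that ℝ²∖U has more than one point, and let S₀ ⊆ ℝ² be an open connected set with U ⊊ S₀. Then the inclusion i : U → c_E(U,S₀) extends to a continuous surjection i_* : c_E(U,ℝ²) → c_E(U,S₀) with i_*(u) = u for all u ∈ U, which is monotone: the preimage under i_* of every point is connected. -/

import Mathlib

open Set Topology Filter

noncomputable section

universe u

variable {X : Type u} [TopologicalSpace X]

/-- A homeomorphism is *orientation preserving* if it is isotopic to the identity. -/
def IsOrientationPreserving (f : X ≃ₜ X) : Prop :=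
  ∃ H : unitInterval × X → X,
    Continuous H ∧ (∀ x, H (0, x) = x) ∧ (∀ x, H (1, x) = f x) ∧
      ∀ t : unitInterval, IsHomeomorph fun x => H (t, x)

/-- `D` is a connected component of `A`. -/
def IsCompOf (A D : Set X) : Prop := ∃ x ∈ A, D = connectedComponentIn A x

/-- `A` has exactly two connected components, the distinct sets `D₁` and `D₂`. -/
def HasTwoComps (A D₁ D₂ : Set X) : Prop :=
  IsCompOf A D₁ ∧ IsCompOf A D₂ ∧ D₁ ≠ D₂ ∧
    ∀ x ∈ A, connectedComponentIn A x = D₁ ∨ connectedComponentIn A x = D₂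

/-- A *cross-cut* of the open set `U`: the image of an arc `g` on `(0,1)`, where `g` is
continuous and injective on `[0,1]`'s interior, runs inside `U`, has endpoints on `∂U`, and
separates `U` into exactly two components, each with a boundary point on `∂U` away from the
closed arc. -/
def IsCrossCut (U γ : Set X) : Prop :=
  ∃ g : ℝ → X,
    ContinuousOn g (Icc 0 1) ∧ InjOn g (Ioo 0 1) ∧ (∀ t ∈ Ioo (0:ℝ) 1, g t ∈ U) ∧
      g 0 ∈ frontier U ∧ g 1 ∈ frontier U ∧ γ = g '' Ioo 0 1 ∧
      ∃ D₁ D₂ : Set X, HasTwoComps (U \ γ) D₁ D₂ ∧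
        (frontier D₁ ∩ (frontier U \ g '' Icc 0 1)).Nonempty ∧
        (frontier D₂ ∩ (frontier U \ g '' Icc 0 1)).Nonempty

/-- A *cross-section* of `U`: a connected component of `U ∖ γ` for a cross-cut `γ`. -/
def IsCrossSection (U D : Set X) : Prop := ∃ γ : Set X, IsCrossCut U γ ∧ IsCompOf (U \ γ) D

/-- The image of a set under the `k`-th integer iterate of a homeomorphism. -/
def iterZ (f : X ≃ₜ X) (k : ℤ) (A : Set X) : Set X := ⇑(f.toEquiv ^ k) '' A

/-- A cross-section of `U` which is wandering for `f^n`. -/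
def IsWanderingSection (f : X ≃ₜ X) (U : Set X) (n : ℕ) (D : Set X) : Prop :=
  IsCrossSection U D ∧ ∀ k : ℤ, k ≠ 0 → iterZ f ((n : ℤ) * k) D ∩ D = ∅

/-- `f` is ∂-nonwandering in `U`. -/
def BdNonwandering (f : X ≃ₜ X) (U : Set X) : Prop :=
  ∀ n : ℕ, 1 ≤ n → ∃ K : Set X, IsCompact K ∧ K ⊆ U ∧
    ∀ D : Set X, IsWanderingSection f U n D →
      (∃ k : ℤ, 0 < k ∧ (iterZ f ((n : ℤ) * k) D ∩ K).Nonempty) ∧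
      (∃ k : ℤ, k < 0 ∧ (iterZ f ((n : ℤ) * k) D ∩ K).Nonempty)

/-- The boundary of `D` inside `U` (for `D` open in `U`). -/
def bdIn (U D : Set X) : Set X := (closure D \ D) ∩ U

/-- A chain of cross-sections of `U`. -/
def IsPEChain (U : Set X) (D : ℕ → Set X) : Prop :=
  (∀ i, IsCrossSection U (D i)) ∧ (∀ i j : ℕ, j ≤ i → D i ⊆ D j) ∧
    ∀ i j : ℕ, i ≠ j → closure (bdIn U (D i)) ∩ closure (bdIn U (D j)) = ∅

/-- The chain `D` divides the cross-section `E`. -/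
def ChainDividesSection (D : ℕ → Set X) (E : Set X) : Prop := ∃ N : ℕ, ∀ i, N ≤ i → D i ⊆ E

/-- The chain `D` divides the chain `D'`. -/
def ChainDivides (D D' : ℕ → Set X) : Prop := ∀ n : ℕ, ∃ m : ℕ, D m ⊆ D' n

/-- A prime chain: a chain dividing every chain that divides it. -/
def IsPrimeChain (U : Set X) (D : ℕ → Set X) : Prop :=
  IsPEChain U D ∧ ∀ D' : ℕ → Set X, IsPEChain U D' → ChainDivides D' D → ChainDivides D D'

/-- The type of prime chains of `U`. -/
def PrimeChain (U : Set X) : Type u := {D : ℕ → Set X // IsPrimeChain U D}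

/-- A prime end of `U`: an equivalence class of prime chains. -/
def PrimeEnd (U : Set X) : Type u :=
  Quot fun C C' : PrimeChain U => ChainDivides C.1 C'.1 ∧ ChainDivides C'.1 C.1

/-- The prime end `p` divides the cross-section `E`. -/
def PrimeEndDivides {U : Set X} (p : PrimeEnd U) (E : Set X) : Prop :=
  ∃ C : PrimeChain U, Quot.mk _ C = p ∧ ChainDividesSection C.1 E

/-- The prime ends compactification of `U` (as a set: `U ⊔ (prime ends)`). -/
def PrimeEndComp (U : Set X) : Type u := ↥U ⊕ PrimeEnd U

/-- A point of `U`, as an element of the prime ends compactification. -/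
def pePt (U : Set X) (x : ↥U) : PrimeEndComp U := Sum.inl x

/-- A prime end, as an element of the prime ends compactification. -/
def peEnd (U : Set X) (p : PrimeEnd U) : PrimeEndComp U := Sum.inr p

/-- The copy of a subset `V ⊆ U` inside the prime ends compactification. -/
def peOpen (U V : Set X) : Set (PrimeEndComp U) := {z | ∃ x : ↥U, z = pePt U x ∧ (x : X) ∈ V}

/-- The basic set `E ∪ i_E(E)` of the prime ends compactification, for a cross-section `E`. -/
def peSection (U E : Set X) : Set (PrimeEndComp U) :=
  peOpen U E ∪ {z | ∃ p : PrimeEnd U, z = peEnd U p ∧ PrimeEndDivides p E}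

/-- The topology of the prime ends compactification. -/
instance primeEndCompTopology (U : Set X) : TopologicalSpace (PrimeEndComp U) :=
  TopologicalSpace.generateFrom
    ({s | ∃ V : Set X, IsOpen V ∧ V ⊆ U ∧ s = peOpen U V} ∪
      {s | ∃ E : Set X, IsCrossSection U E ∧ s = peSection U E})

/-- The circle of prime ends, as a subset of the prime ends compactification. -/
def PrimeEndCircle (U : Set X) : Set (PrimeEndComp U) := Set.range (peEnd U)

/-- `F` is an extension of `f|_U` to the prime ends compactification of `U`. -/
def IsPEExtension (f : X ≃ₜ X) (U : Set X) (F : PrimeEndComp U ≃ₜ PrimeEndComp U) : Prop :=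
  ∀ (x : X) (hx : x ∈ U) (hfx : f x ∈ U), F (pePt U ⟨x, hx⟩) = pePt U ⟨f x, hfx⟩

/-- An end-cut of `U`: an injective arc in `U` defined on `[0,1)` converging in the ambient
space as `t → 1⁻`. -/
def IsEndCut (U : Set X) (γ : ℝ → X) : Prop :=
  ContinuousOn γ (Ico 0 1) ∧ InjOn γ (Ico 0 1) ∧ (∀ t ∈ Ico (0:ℝ) 1, γ t ∈ U) ∧
    ∃ z : X, Tendsto γ (𝓝[<] (1:ℝ)) (𝓝 z)

/-- `z` is an accessible point of `∂U`. -/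
def IsAccessiblePoint (U : Set X) (z : X) : Prop :=
  ∃ γ : ℝ → X, IsEndCut U γ ∧ Tendsto γ (𝓝[<] (1:ℝ)) (𝓝 z)

/-- `p` is an accessible prime end of `U`. -/
def IsAccessiblePrimeEnd (U : Set X) (p : PrimeEnd U) : Prop :=
  ∃ (γ : ℝ → X) (hγ : ∀ t ∈ Ico (0:ℝ) 1, γ t ∈ U), IsEndCut U γ ∧
    Tendsto (fun t : ↥(Ico (0:ℝ) 1) => pePt U ⟨γ ↑t, hγ ↑t t.2⟩)
      (comap Subtype.val (𝓝[<] (1:ℝ))) (𝓝 (peEnd U p))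

/-- A translation arc for `f` based at `x`: a simple arc from `x` to `f x` meeting its image
only as allowed. -/
def IsTranslationArc (f : X ≃ₜ X) (γ : Set X) (x : X) : Prop :=
  f x ≠ x ∧
    ∃ g : ℝ → X, ContinuousOn g (Icc 0 1) ∧ InjOn g (Icc 0 1) ∧
      g 0 = x ∧ g 1 = f x ∧ γ = g '' Icc 0 1 ∧
      ((⇑f '' γ) ∩ γ = {f x} ∨ ((⇑f '' γ) ∩ γ = {x, f x} ∧ f (f x) = x))

/-- An `N`-translation arc for `f` based at `x` (for `N = 1` this is just a translation arc). -/
def IsNTranslationArc (f : X ≃ₜ X) (N : ℕ) (γ : Set X) (x : X) : Prop :=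
  IsTranslationArc f γ x ∧
    (2 ≤ N →
      (∀ k : ℕ, 2 ≤ k → k ≤ N - 1 → (⇑f)^[k] '' γ ∩ γ = ∅) ∧
        ((⇑f)^[N] '' γ ∩ γ = ∅ ∨ ((⇑f)^[N] '' γ ∩ γ = {x} ∧ (⇑f)^[N + 1] x = x)))

/-- An ∞-translation arc: an `N`-translation arc for every `N ≥ 1`. -/
def IsInfTranslationArc (f : X ≃ₜ X) (γ : Set X) (x : X) : Prop :=
  ∀ N : ℕ, 1 ≤ N → IsNTranslationArc f N γ x

/-- A nonwandering homeomorphism. -/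
def IsNonwanderingMap (f : X → X) : Prop :=
  ∀ V : Set X, IsOpen V → V.Nonempty → ∃ n : ℕ, 1 ≤ n ∧ (f^[n] '' V ∩ V).Nonempty

/-- A loop contained in `A` which is not null-homotopic in `V`. -/
def IsEssentialLoopIn (V A : Set X) : Prop :=
  ∃ (z : ↥V) (δ : Path z z), (∀ t : unitInterval, (↑(δ t) : X) ∈ A) ∧
    ¬ δ.Homotopic (Path.refl z)

/-- An annular continuum: a continuum with an open annular neighborhood `V` such that `V ∖ K`
has exactly two components, each essential in `V`. -/
def IsAnnularContinuum (K : Set X) : Prop :=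
  IsCompact K ∧ IsConnected K ∧ K.Nontrivial ∧
    ∃ V : Set X, IsOpen V ∧ K ⊆ V ∧
      Nonempty (↥V ≃ₜ AddCircle (1 : ℝ) × ↥(Ioo (0 : ℝ) 1)) ∧
      ∃ D₁ D₂ : Set X, HasTwoComps (V \ K) D₁ D₂ ∧
        IsEssentialLoopIn V D₁ ∧ IsEssentialLoopIn V D₂

/-- A set contractible in the ambient surface: it has an open neighborhood homeomorphic to the
plane. -/
def ContractibleInSurface (K : Set X) : Prop :=
  ∃ W : Set X, IsOpen W ∧ K ⊆ W ∧ Nonempty (↥W ≃ₜ (ℝ × ℝ))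

/-- `α ∈ ℝ/ℤ` is rational. -/
def IsRationalAC (α : AddCircle (1 : ℝ)) : Prop := ∃ r : ℚ, α = ((r : ℝ) : AddCircle (1 : ℝ))

/-- The constant `q(α,g)`: the smallest positive integer `q` with `‖qα‖ = 0` if `α` is
rational, and `(2g+1)‖qα‖ < ‖α‖` if `α` is irrational. -/
def qConst (α : AddCircle (1 : ℝ)) (g : ℕ) : ℕ :=
  sInf {q : ℕ | 0 < q ∧
    ((IsRationalAC α ∧ ‖q • α‖ = 0) ∨
      (¬IsRationalAC α ∧ ((2 * g + 1 : ℕ) : ℝ) * ‖q • α‖ < ‖α‖))}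


namespace PlanePE

theorem isSimplyConnected_univ (A : Type*) [TopologicalSpace A] [SimplyConnectedSpace A] :
    IsSimplyConnected (univ : Set A) :=
  (Homeomorph.Set.univ A).toHomotopyEquiv.simplyConnectedSpace

/-- A continuous function on a preconnected set taking integer values is constant. -/
theorem eq_of_int_valued {A : Type*} [TopologicalSpace A] {S : Set A} (hS : IsPreconnected S)
    {f : A → ℝ} (hf : ContinuousOn f S) (hfint : ∀ x ∈ S, ∃ n : ℤ, f x = n) {x y : A}
    (hx : x ∈ S) (hy : y ∈ S) : f x = f y := by
  refine hS.constant_of_mapsTo (T := range ((↑) : ℤ → ℝ))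
    Int.isClosedEmbedding_coe_real.isEmbedding.isInducing.isDiscrete_range hf (fun z hz => ?_) hx hy
  obtain ⟨n, hn⟩ := hfint z hz
  exact ⟨n, hn.symm⟩

/-- Two continuous logarithms of the same function differ by a constant on preconnected sets. -/
theorem log_sub_eq {A : Type*} [TopologicalSpace A] {S : Set A} (hS : IsPreconnected S)
    {f g : A → ℂ} (hf : ContinuousOn f S) (hg : ContinuousOn g S)
    (h : ∀ x ∈ S, Complex.exp (f x) = Complex.exp (g x)) {x y : A}
    (hx : x ∈ S) (hy : y ∈ S) : f x - g x = f y - g y := by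
  have key : ∀ z ∈ S, ∃ n : ℤ, f z = g z + n * (2 * Real.pi * Complex.I) := fun z hz =>
    Complex.exp_eq_exp_iff_exists_int.1 (h z hz)
  have h2 : ∀ z ∈ S, ∀ n : ℤ, f z = g z + n * (2 * Real.pi * Complex.I) →
      (f z - g z).im / (2 * Real.pi) = n := by
    intro z _ n hn
    rw [hn]
    have := Real.pi_ne_zero
    simp
  have h3 := eq_of_int_valued (f := fun z => (f z - g z).im / (2 * Real.pi)) hS
    ((Complex.continuous_im.comp_continuousOn (hf.sub hg)).div_const _)
    (fun z hz => by
      obtain ⟨n, hn⟩ := key z hz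
      exact ⟨n, h2 z hz n hn⟩) hx hy
  obtain ⟨n, hn⟩ := key x hx
  obtain ⟨m, hm⟩ := key y hy
  have h4 : (n : ℝ) = m := by rw [← h2 x hx n hn, ← h2 y hy m hm]; exact h3
  have h5 : n = m := by exact_mod_cast h4
  rw [hn, hm, h5]; ring

theorem isPreconnected_inter_of_simplyConnected {A : Type*} [TopologicalSpace A]
    [SimplyConnectedSpace A] [LocallyPathConnectedSpace A] [NormalSpace A] {F G : Set A}
    (hF : IsClosed F) (hG : IsClosed G) (hFc : IsPreconnected F) (hGc : IsPreconnected G)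
    (hFG : F ∪ G = univ) : IsPreconnected (F ∩ G) := by
  classical
  rw [isPreconnected_closed_iff]
  intro t t' ht ht' hcov hP hQ
  by_contra hne
  rw [not_nonempty_iff_eq_empty] at hne
  obtain ⟨p, hpFG, hpt⟩ := hP
  obtain ⟨q, hqFG, hqt⟩ := hQ
  obtain ⟨h, h0, h1, -⟩ := exists_continuous_zero_one_of_isClosed
    ((hF.inter hG).inter ht) ((hF.inter hG).inter ht') (by
      rw [Set.disjoint_iff_inter_eq_empty, ← hne]; ext x; simp only [mem_inter_iff]; tauto)
  let e : A → ℂ := fun x => Real.pi * Complex.I * (h x : ℝ)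
  have he : Continuous e := by fun_prop
  let f : A → ℂ := fun x => if x ∈ F then Complex.exp (e x) else Complex.exp (-e x)
  have hfF : EqOn f (fun x => Complex.exp (e x)) F := fun x hx => if_pos hx
  have hfG : EqOn f (fun x => Complex.exp (-e x)) G := by
    intro x hx
    by_cases hxF : x ∈ F
    · rcases hcov ⟨hxF, hx⟩ with hxt | hxt
      · have : h x = 0 := h0 ⟨⟨hxF, hx⟩, hxt⟩
        simp [f, e, this]
      · have : h x = 1 := h1 ⟨⟨hxF, hx⟩, hxt⟩
        simp [f, e, this, Complex.exp_neg]
    · exact if_neg hxF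
  have hf : ContinuousOn f univ := by
    rw [← hFG]
    refine ContinuousOn.union_of_isClosed ?_ ?_ hF hG
    · exact (by fun_prop : Continuous fun x => Complex.exp (e x)).continuousOn.congr hfF
    · exact (by fun_prop : Continuous fun x => Complex.exp (-e x)).continuousOn.congr hfG
  obtain ⟨φ, hφc, hφ⟩ := Complex.exists_continuousOn_eqOn_exp_comp
    (U := (univ : Set A)) (isSimplyConnected_univ A) isOpen_univ hf (by
      rintro ⟨x, -, hx⟩
      by_cases hxF : x ∈ F
      · rw [hfF hxF] at hx; exact Complex.exp_ne_zero _ hx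
      · rw [show f x = _ from if_neg hxF] at hx; exact Complex.exp_ne_zero _ hx)
  have e1 := log_sub_eq hFc (hφc.mono (subset_univ _)) he.continuousOn
    (fun x hx => (hφ (mem_univ x)).trans (hfF hx)) hpFG.1 hqFG.1
  have e2 := log_sub_eq hGc (hφc.mono (subset_univ _)) he.neg.continuousOn
    (fun x hx => (hφ (mem_univ x)).trans (hfG hx)) hpFG.2 hqFG.2
  have hp0 : h p = 0 := h0 ⟨hpFG, hpt⟩
  have hq1 : h q = 1 := h1 ⟨hqFG, hqt⟩
  have h3 : (2 : ℂ) * (Real.pi * Complex.I) = 0 := by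
    have := congrArg₂ (· - ·) e1 e2
    simp [e, hp0, hq1] at this
    linear_combination this
  simp [Real.pi_ne_zero] at h3

/-- The property that a relatively closed connected decomposition of `U` has connected overlap. -/
def Unicoh (U : Set (ℝ × ℝ)) : Prop :=
  ∀ D, IsOpen D → D ⊆ U → IsPreconnected D → IsPreconnected (U \ D) → IsPreconnected (bdIn U D)

theorem unicoh_of_simplyConnected {U : Set (ℝ × ℝ)} (hU : IsOpen U)
    (hsc : SimplyConnectedSpace U) : Unicoh U := by
  intro D hD hDU hDc hUD
  have := hU.locallyPathConnectedSpace
  have e : bdIn U D = Subtype.val '' (((↑) : U → ℝ × ℝ) ⁻¹' closure D ∩ (↑) ⁻¹' (U \ D)) := by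
    ext x; simp [bdIn]; tauto
  rw [e]
  refine IsPreconnected.image ?_ _ continuous_subtype_val.continuousOn
  refine isPreconnected_inter_of_simplyConnected (isClosed_closure.preimage continuous_subtype_val)
    ?_ ?_ ?_ ?_
  · have : ((↑) : U → ℝ × ℝ) ⁻¹' (U \ D) = ((↑) ⁻¹' D)ᶜ := by ext x; simp
    rw [this]; exact (hD.preimage continuous_subtype_val).isClosed_compl
  · rw [← Topology.IsInducing.subtypeVal.isPreconnected_image, Subtype.image_preimage_coe]
    exact hDc.subset_closure (subset_inter hDU subset_closure) inter_subset_right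
  · rw [← Topology.IsInducing.subtypeVal.isPreconnected_image, Subtype.image_preimage_coe,
      inter_eq_self_of_subset_right sdiff_subset]
    exact hUD
  · ext x
    simp only [mem_union, mem_preimage, mem_univ, iff_true, Set.mem_sdiff, x.2, true_and]
    by_cases hx : (x : ℝ × ℝ) ∈ D
    · exact Or.inl (subset_closure hx)
    · exact Or.inr hx

theorem unicoh_univ : Unicoh univ :=
  unicoh_of_simplyConnected isOpen_univ
    ((isSimplyConnected_univ _ : IsSimplyConnected
      (univ : Set (ℝ × ℝ))).simplyConnectedSpace)

/-- A simply connected plane domain contains the bounded domains whose frontier it contains. -/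
theorem no_compact_hole {U I : Set (ℝ × ℝ)} (hU : IsOpen U) (hsc : SimplyConnectedSpace U)
    (hI : IsOpen I) (hIb : Bornology.IsBounded I) (hfr : frontier I ⊆ U) : I ⊆ U := by
  classical
  intro m hmI
  by_contra hmU
  let e : ℝ × ℝ → ℂ := fun z => ((z.1 - m.1 : ℝ) : ℂ) + ((z.2 - m.2 : ℝ) : ℂ) * Complex.I
  have he : Continuous e := by fun_prop
  have he0 : ∀ z, e z = 0 → z = m := by
    intro z hz
    have h1 := congrArg Complex.re hz
    have h2 := congrArg Complex.im hz
    simp [e] at h1 h2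
    exact Prod.ext (by linarith) (by linarith)
  have hsc' : IsSimplyConnected U := hsc
  obtain ⟨φ, hφc, hφ⟩ := Complex.exists_continuousOn_eqOn_exp_comp hsc' hU
    he.continuousOn (by rintro ⟨x, hx, hx0⟩; rw [he0 x hx0] at hx; exact hmU hx)
  obtain ⟨Φ, hΦ⟩ := ContinuousMap.exists_restrict_eq (s := frontier I) isClosed_frontier
    ⟨fun z => φ z, (continuousOn_iff_continuous_domRestrict.1 (hφc.mono hfr))⟩
  have hΦ' : ∀ z ∈ frontier I, Φ z = φ z := fun z hz => DFunLike.congr_fun hΦ ⟨z, hz⟩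
  let H : ℝ × ℝ → ℂ := fun z => if z ∈ closure I then Complex.exp (Φ z) else e z
  have hH1 : EqOn H (fun z => Complex.exp (Φ z)) (closure I) := fun z hz => if_pos hz
  have hH2 : EqOn H e Iᶜ := by
    intro z hz
    by_cases hzc : z ∈ closure I
    · have hzf : z ∈ frontier I := by rw [hI.frontier_eq]; exact ⟨hzc, hz⟩
      rw [hH1 hzc]
      simp only [hΦ' z hzf]
      exact hφ (hfr hzf)
    · exact if_neg hzc
  have hH : ContinuousOn H univ := by
    have : closure I ∪ Iᶜ = univ := by
      ext z; simp; by_cases hz : z ∈ I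
      · exact Or.inl (subset_closure hz)
      · exact Or.inr hz
    rw [← this]
    refine ContinuousOn.union_of_isClosed ?_ ?_ isClosed_closure hI.isClosed_compl
    · exact (by fun_prop : Continuous fun z => Complex.exp (Φ z)).continuousOn.congr hH1
    · exact he.continuousOn.congr hH2
  obtain ⟨ψ, hψc, hψ⟩ := Complex.exists_continuousOn_eqOn_exp_comp
    (U := (univ : Set (ℝ × ℝ))) (isSimplyConnected_univ _) isOpen_univ hH (by
      rintro ⟨x, -, hx⟩
      by_cases hxF : x ∈ closure I
      · rw [hH1 hxF] at hx; exact Complex.exp_ne_zero _ hx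
      · rw [show H x = _ from if_neg hxF] at hx
        exact hxF (subset_closure (he0 x hx ▸ hmI)))
  obtain ⟨R, hR⟩ := hIb.subset_ball m
  have hRpos : 0 < R := by
    have := hR hmI
    simpa using this
  let c : ℝ → ℝ × ℝ := fun θ => (m.1 + 2 * R * Real.cos θ, m.2 + 2 * R * Real.sin θ)
  have hc : Continuous c := by fun_prop
  have hcI : ∀ θ, c θ ∈ Iᶜ := by
    intro θ hθ
    have := hR hθ
    rw [Metric.mem_ball, Prod.dist_eq, max_lt_iff, Real.dist_eq, Real.dist_eq, abs_lt, abs_lt] at this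
    simp only [c] at this
    have h1 := Real.sin_sq_add_cos_sq θ
    have h2 : (2 * R * Real.cos θ) ^ 2 < R ^ 2 := by
      apply sq_lt_sq'; linarith [this.1.1]; linarith [this.1.2]
    have h3 : (2 * R * Real.sin θ) ^ 2 < R ^ 2 := by
      apply sq_lt_sq'; linarith [this.2.1]; linarith [this.2.2]
    nlinarith
  have h2R : (0 : ℝ) < 2 * R := by linarith
  have hexp : ∀ θ ∈ (univ : Set ℝ), Complex.exp (ψ (c θ)) =
      Complex.exp ((Real.log (2 * R) : ℝ) + θ * Complex.I) := by
    intro θ _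
    have h1 : Complex.exp (ψ (c θ)) = H (c θ) := hψ (mem_univ _)
    rw [h1, hH2 (hcI θ), Complex.exp_add, ← Complex.ofReal_exp, Real.exp_log h2R,
      Complex.exp_mul_I]
    simp [e, c]
    ring
  have hψc' : Continuous ψ := continuousOn_univ.1 hψc
  have key := log_sub_eq (isPreconnected_univ (α := ℝ)) (hψc'.comp hc).continuousOn
    (by fun_prop : Continuous fun θ : ℝ => ((Real.log (2 * R) : ℝ) + θ * Complex.I : ℂ)).continuousOn
    hexp (mem_univ 0) (mem_univ (2 * Real.pi))
  have hc2 : c (2 * Real.pi) = c 0 := by simp [c]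
  simp only [Function.comp, hc2] at key
  have h5 := congrArg Complex.im key
  simp at h5
  linarith [Real.pi_pos]

section General

variable {A : Type*} [TopologicalSpace A]

theorem closure_connectedComponentIn_inter {O : Set A} (x : A) :
    closure (connectedComponentIn O x) ∩ O ⊆ connectedComponentIn O x := by
  rintro f ⟨hf, hfO⟩
  by_cases hx : x ∈ O
  · have h1 : IsPreconnected (insert f (connectedComponentIn O x)) :=
      isPreconnected_connectedComponentIn.subset_closure (subset_insert _ _)
        (insert_subset hf subset_closure)
    exact h1.subset_connectedComponentIn (mem_insert_of_mem _ (mem_connectedComponentIn hx))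
      (insert_subset hfO (connectedComponentIn_subset _ _)) (mem_insert _ _)
  · rw [connectedComponentIn_eq_empty hx] at hf
    simp at hf

theorem isClosed_connectedComponentIn' {O : Set A} (hO : IsClosed O) (x : A) :
    IsClosed (connectedComponentIn O x) := by
  refine isClosed_of_closure_subset fun f hf => closure_connectedComponentIn_inter x ⟨hf, ?_⟩
  exact closure_minimal (connectedComponentIn_subset _ _) hO hf

theorem subset_of_inter_bd_empty {T B : Set A} (hT : IsPreconnected T) (hB : IsOpen B)
    (hne : (T ∩ B).Nonempty) (hbd : ∀ x ∈ T, x ∈ closure B → x ∈ B) : T ⊆ B := by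
  rcases isPreconnected_iff_subset_of_disjoint.1 hT B (closure B)ᶜ hB isClosed_closure.isOpen_compl
    (fun x hx => by
      by_cases h : x ∈ closure B
      · exact Or.inl (hbd x hx h)
      · exact Or.inr h)
    (by
      ext x; simp only [mem_inter_iff, mem_compl_iff, mem_empty_iff_false, iff_false]
      rintro ⟨-, h1, h2⟩; exact h2 (subset_closure h1)) with h | h
  · exact h
  · obtain ⟨x, hx, hxB⟩ := hne
    exact absurd (subset_closure hxB) (h hx)

theorem subset_of_avoid_bdIn {U T B : Set A} (hT : IsPreconnected T) (hTU : T ⊆ U) (hB : IsOpen B)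
    (hne : (T ∩ B).Nonempty) (hbd : T ∩ bdIn U B = ∅) : T ⊆ B := by
  refine subset_of_inter_bd_empty hT hB hne fun x hx hc => ?_
  by_contra hxB
  exact (Set.eq_empty_iff_forall_notMem.1 hbd) x ⟨hx, ⟨hc, hxB⟩, hTU hx⟩

theorem inter_eq_empty_of_avoid_bdIn {U T B : Set A} (hT : IsPreconnected T) (hTU : T ⊆ U)
    (hB : IsOpen B) {t : A} (ht : t ∈ T) (htB : t ∉ B) (hbd : T ∩ bdIn U B = ∅) :
    T ∩ closure B = ∅ := by
  by_contra hne
  obtain ⟨x, hx, hxB⟩ := nonempty_iff_ne_empty.2 hne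
  have hxB' : x ∈ B := by
    by_contra h
    exact (Set.eq_empty_iff_forall_notMem.1 hbd) x ⟨hx, ⟨hxB, h⟩, hTU hx⟩
  exact htB (subset_of_avoid_bdIn hT hTU hB ⟨x, hx, hxB'⟩ hbd ht)

theorem connectedComponentIn_eq_of_open_union {M B C : Set A} (hB : IsOpen B) (hC : IsOpen C)
    (hBc : IsPreconnected B) (hd : Disjoint B C) (hM : M = B ∪ C) {x : A} (hx : x ∈ B) :
    connectedComponentIn M x = B := by
  apply Subset.antisymm
  · have hsub : connectedComponentIn M x ⊆ B ∪ C := hM ▸ connectedComponentIn_subset M x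
    rcases isPreconnected_iff_subset_of_disjoint.1 isPreconnected_connectedComponentIn B C hB hC
      hsub (by rw [hd.inter_eq, inter_empty]) with h | h
    · exact h
    · exact absurd (h (mem_connectedComponentIn (hM ▸ Or.inl hx)))
        (Set.disjoint_left.1 hd hx)
  · exact hBc.subset_connectedComponentIn hx (hM ▸ subset_union_left)

theorem hasTwoComps_of_open_union {M B C : Set A} (hB : IsOpen B) (hC : IsOpen C)
    (hBc : IsConnected B) (hCc : IsConnected C) (hd : Disjoint B C) (hM : M = B ∪ C) :
    HasTwoComps M B C := by
  obtain ⟨b, hb⟩ := hBc.nonempty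
  obtain ⟨c, hc⟩ := hCc.nonempty
  have hM' : M = C ∪ B := by rw [hM, union_comm]
  refine ⟨⟨b, hM ▸ Or.inl hb,
    (connectedComponentIn_eq_of_open_union hB hC hBc.isPreconnected hd hM hb).symm⟩,
    ⟨c, hM ▸ Or.inr hc,
    (connectedComponentIn_eq_of_open_union hC hB hCc.isPreconnected hd.symm hM' hc).symm⟩,
    ?_, ?_⟩
  · rintro rfl
    exact Set.disjoint_left.1 hd hb hb
  · intro x hx
    rw [hM] at hx
    rcases hx with hx | hx
    · exact Or.inl (connectedComponentIn_eq_of_open_union hB hC hBc.isPreconnected hd hM hx)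
    · exact Or.inr (connectedComponentIn_eq_of_open_union hC hB hCc.isPreconnected hd.symm hM' hx)

end General

/-- A domain `A ⊆ U` with connected complement and connected boundary in `U`, not containing
the base point `u`. -/
structure IsCut (U : Set (ℝ × ℝ)) (u : ℝ × ℝ) (A : Set (ℝ × ℝ)) : Prop where
  isOpen : IsOpen A
  sub : A ⊆ U
  conn : IsConnected A
  compl_conn : IsPreconnected (U \ A)
  bd_conn : IsConnected (bdIn U A)
  base_mem : u ∈ U
  base : u ∉ A

theorem IsCut.union_bd_subset {U : Set (ℝ × ℝ)} {u : ℝ × ℝ} {A B : Set (ℝ × ℝ)}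
    (hA : IsCut U u A) (hB : IsCut U u B) (h : bdIn U A ⊆ B) : A ∪ bdIn U A ⊆ B := by
  refine union_subset ?_ h
  obtain ⟨z, hz⟩ := hA.bd_conn.nonempty
  have hAB : (A ∩ B).Nonempty := by
    have := mem_closure_iff.1 hz.1.1 B hB.isOpen (h hz)
    rwa [inter_comm] at this
  have hdisj : bdIn U B ∩ bdIn U A = ∅ := by
    ext x; simp only [mem_inter_iff, mem_empty_iff_false, iff_false]
    rintro ⟨h1, h2⟩; exact h1.1.2 (h h2)
  by_cases hne : (bdIn U B ∩ A).Nonempty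
  · have h1 : bdIn U B ⊆ A := subset_of_avoid_bdIn hB.bd_conn.isPreconnected inter_subset_right
      hA.isOpen hne hdisj
    have h2 : U \ A ⊆ B := by
      refine subset_of_avoid_bdIn hA.compl_conn sdiff_subset hB.isOpen ⟨z, ⟨hz.2, hz.1.2⟩, h hz⟩ ?_
      ext x; simp only [mem_inter_iff, mem_empty_iff_false, iff_false]
      rintro ⟨h1', h2'⟩; exact h1'.2 (h1 h2')
    exact absurd (h2 ⟨hA.base_mem, hA.base⟩) hB.base
  · rw [not_nonempty_iff_eq_empty, inter_comm] at hne
    exact subset_of_avoid_bdIn hA.conn.isPreconnected hA.sub hB.isOpen hAB hne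

/-- Closed sets with tame frontier. -/
structure NiceSet (Q : Set (ℝ × ℝ)) : Prop where
  closed : IsClosed Q
  compactFr : IsCompact (frontier Q)
  dense : ∀ z ∈ frontier Q, z ∈ closure (interior Q)
  loc : ∀ z ∈ frontier Q, ∀ V ∈ 𝓝 z, ∃ N, IsOpen N ∧ z ∈ N ∧ N ⊆ V ∧
    IsPreconnected (N ∩ interior Q) ∧ IsPreconnected (N \ Q)
  sph : ∀ p : ℝ × ℝ, ∀ ε > 0, ∃ r, 0 < r ∧ r < ε ∧ (frontier Q ∩ Metric.sphere p r).Finite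
  arc : ∀ U : Set (ℝ × ℝ), IsOpen U → ∀ y ∈ frontier Q ∩ U,
    ¬ connectedComponentIn (frontier Q) y ⊆ U →
    ∃ g : ℝ → ℝ × ℝ, ContinuousOn g (Icc 0 1) ∧ InjOn g (Ioo 0 1) ∧
      g '' Ioo 0 1 = connectedComponentIn (frontier Q ∩ U) y ∧ g 0 ∉ U ∧ g 1 ∉ U

/-- The component of `U \ Q` containing `u`. -/
def mainComp (U Q : Set (ℝ × ℝ)) (u : ℝ × ℝ) : Set (ℝ × ℝ) := connectedComponentIn (U \ Q) u

/-- The components of the complement of the closure of the main component. -/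
def IsDoor (U Q : Set (ℝ × ℝ)) (u : ℝ × ℝ) (A : Set (ℝ × ℝ)) : Prop :=
  IsCompOf (U \ closure (mainComp U Q u)) A

section Doors

variable {U Q : Set (ℝ × ℝ)} {u : ℝ × ℝ} {A B : Set (ℝ × ℝ)}

theorem mainComp_subset : mainComp U Q u ⊆ U \ Q := connectedComponentIn_subset _ _

theorem mem_mainComp (hu : u ∈ U \ Q) : u ∈ mainComp U Q u := mem_connectedComponentIn hu

theorem isOpen_mainComp (hU : IsOpen U) (hQ : NiceSet Q) : IsOpen (mainComp U Q u) :=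
  (hU.sdiff hQ.closed).connectedComponentIn

theorem closure_mainComp_inter_interior :
    closure (mainComp U Q u) ∩ interior Q = ∅ := by
  have : Disjoint (mainComp U Q u) (interior Q) :=
    Set.disjoint_left.2 fun x hx hx' => (mainComp_subset hx).2 (interior_subset hx')
  exact (this.closure_left isOpen_interior).inter_eq

theorem mem_mainComp_of_closure {f : ℝ × ℝ} (hf : f ∈ closure (mainComp U Q u)) (hfU : f ∈ U)
    (hfΓ : f ∉ frontier Q) : f ∈ mainComp U Q u := by
  refine closure_connectedComponentIn_inter u ⟨hf, hfU, fun hfQ => hfΓ ?_⟩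
  refine ⟨subset_closure hfQ, fun hi => ?_⟩
  exact (Set.eq_empty_iff_forall_notMem.1 closure_mainComp_inter_interior) f ⟨hf, hi⟩

theorem IsDoor.eq_of_mem (hA : IsDoor U Q u A) {x : ℝ × ℝ} (hx : x ∈ A) :
    A = connectedComponentIn (U \ closure (mainComp U Q u)) x := by
  obtain ⟨y, hy, rfl⟩ := hA
  exact connectedComponentIn_eq hx

theorem IsDoor.eq_of_mem_mem (hA : IsDoor U Q u A) (hB : IsDoor U Q u B) {x : ℝ × ℝ} (hx : x ∈ A)
    (hx' : x ∈ B) : A = B := by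
  rw [hA.eq_of_mem hx, hB.eq_of_mem hx']

theorem IsDoor.subset (hA : IsDoor U Q u A) : A ⊆ U \ closure (mainComp U Q u) := by
  obtain ⟨x, hx, rfl⟩ := hA
  exact connectedComponentIn_subset _ _

theorem IsDoor.isOpen (hU : IsOpen U) (hA : IsDoor U Q u A) : IsOpen A := by
  obtain ⟨x, hx, rfl⟩ := hA
  exact (hU.sdiff isClosed_closure).connectedComponentIn

theorem IsDoor.isConnected (hA : IsDoor U Q u A) : IsConnected A := by
  obtain ⟨x, hx, rfl⟩ := hA
  exact isConnected_connectedComponentIn_iff.2 hx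

theorem isDoor_of_mem {x : ℝ × ℝ} (hx : x ∈ U \ closure (mainComp U Q u)) :
    IsDoor U Q u (connectedComponentIn (U \ closure (mainComp U Q u)) x) := ⟨x, hx, rfl⟩

theorem IsDoor.bd_subset_closure (hA : IsDoor U Q u A) :
    bdIn U A ⊆ closure (mainComp U Q u) := by
  rintro f ⟨⟨hf, hfA⟩, hfU⟩
  by_contra hc
  obtain ⟨x, hx, rfl⟩ := hA
  exact hfA (closure_connectedComponentIn_inter x ⟨hf, hfU, hc⟩)

theorem IsDoor.closure_inter_main (hU : IsOpen U) (hQ : NiceSet Q) (hA : IsDoor U Q u A) :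
    closure A ∩ mainComp U Q u = ∅ := by
  have : Disjoint A (mainComp U Q u) :=
    Set.disjoint_left.2 fun x hx hx' => (hA.subset hx).2 (subset_closure hx')
  exact (this.closure_left (isOpen_mainComp hU hQ)).inter_eq

theorem IsDoor.bd_subset (hU : IsOpen U) (hQ : NiceSet Q) (hA : IsDoor U Q u A) :
    bdIn U A ⊆ frontier Q ∩ U := by
  intro f hf
  refine ⟨?_, hf.2⟩
  by_contra hfr
  have := mem_mainComp_of_closure (hA.bd_subset_closure hf) hf.2 hfr
  exact (Set.eq_empty_iff_forall_notMem.1 (hA.closure_inter_main hU hQ)) f ⟨hf.1.1, this⟩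

theorem IsDoor.bd_nonempty (hU : IsOpen U) (hUc : IsPreconnected U) (hu : u ∈ U \ Q)
    (hA : IsDoor U Q u A) : (bdIn U A).Nonempty := by
  by_contra hne
  rw [not_nonempty_iff_eq_empty] at hne
  obtain ⟨a, ha⟩ := hA.isConnected.nonempty
  have := subset_of_avoid_bdIn hUc Subset.rfl (hA.isOpen hU) ⟨a, (hA.subset ha).1, ha⟩
    (by rw [hne, inter_empty]) hu.1
  exact (hA.subset this).2 (subset_closure (mem_mainComp hu))

theorem IsDoor.base_notMem (hu : u ∈ U \ Q) (hA : IsDoor U Q u A) : u ∉ A :=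
  fun h => (hA.subset h).2 (subset_closure (mem_mainComp hu))

theorem isPreconnected_closure_mainComp_inter :
    IsPreconnected (closure (mainComp U Q u) ∩ U) :=
  IsPreconnected.subset_closure (isPreconnected_connectedComponentIn (F := U \ Q) (x := u))
    (subset_inter subset_closure (mainComp_subset.trans sdiff_subset)) inter_subset_left

theorem IsDoor.compl_conn (hU : IsOpen U) (hUc : IsPreconnected U) (hu : u ∈ U \ Q)
    (hA : IsDoor U Q u A) : IsPreconnected (U \ A) := by
  have huW := mem_mainComp hu
  have hWA : closure (mainComp U Q u) ∩ U ⊆ U \ A :=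
    fun x hx => ⟨hx.2, fun h => (hA.subset h).2 hx.1⟩
  refine isPreconnected_of_forall u fun y hy => ?_
  by_cases hyW : y ∈ closure (mainComp U Q u)
  · exact ⟨_, hWA, ⟨subset_closure huW, hu.1⟩, ⟨hyW, hy.1⟩, isPreconnected_closure_mainComp_inter⟩
  · have hB := isDoor_of_mem (u := u) ⟨hy.1, hyW⟩
    set B := connectedComponentIn (U \ closure (mainComp U Q u)) y with hBdef
    have hyB : y ∈ B := mem_connectedComponentIn ⟨hy.1, hyW⟩
    have hBA : closure B ∩ A = ∅ := by
      have : Disjoint B A := Set.disjoint_left.2 fun x hx hx' => by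
        have := hB.eq_of_mem_mem hA hx hx'
        exact hy.2 (this ▸ hyB)
      exact (this.closure_left (hA.isOpen hU)).inter_eq
    obtain ⟨f, hf⟩ := hB.bd_nonempty hU hUc hu
    refine ⟨(closure (mainComp U Q u) ∩ U) ∪ (closure B ∩ U), union_subset hWA ?_, ?_, ?_, ?_⟩
    · exact fun x hx => ⟨hx.2, fun h => Set.eq_empty_iff_forall_notMem.1 hBA x ⟨hx.1, h⟩⟩
    · exact Or.inl ⟨subset_closure huW, hu.1⟩
    · exact Or.inr ⟨subset_closure hyB, hy.1⟩
    · refine IsPreconnected.union f ⟨hB.bd_subset_closure hf, hf.2⟩ ⟨hf.1.1, hf.2⟩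
        isPreconnected_closure_mainComp_inter ?_
      exact hB.isConnected.isPreconnected.subset_closure
        (subset_inter subset_closure (hB.subset.trans sdiff_subset)) inter_subset_left

theorem IsDoor.isCut (hU : IsOpen U) (hUc : IsPreconnected U) (hUu : Unicoh U)
    (hu : u ∈ U \ Q) (hA : IsDoor U Q u A) : IsCut U u A where
  isOpen := hA.isOpen hU
  sub := hA.subset.trans sdiff_subset
  conn := hA.isConnected
  compl_conn := hA.compl_conn hU hUc hu
  bd_conn := ⟨hA.bd_nonempty hU hUc hu, hUu A (hA.isOpen hU) (hA.subset.trans sdiff_subset)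
    hA.isConnected.isPreconnected (hA.compl_conn hU hUc hu)⟩
  base_mem := hu.1
  base := hA.base_notMem hu

/-- Near a frontier point seen from the main component, a door is locally everything. -/
theorem door_local (hU : IsOpen U) (hQ : NiceSet Q) {f : ℝ × ℝ}
    (hf : f ∈ closure (mainComp U Q u)) (hfΓ : f ∈ frontier Q ∩ U) {V : Set (ℝ × ℝ)}
    (hV : V ∈ 𝓝 f) :
    ∃ N, IsOpen N ∧ f ∈ N ∧ N ⊆ V ∧ N ⊆ U ∧ (N ∩ interior Q).Nonempty ∧
      IsPreconnected (N ∩ interior Q) ∧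
      N ∩ frontier Q ⊆ closure (mainComp U Q u) ∧
      ∀ A, IsDoor U Q u A → (A ∩ N).Nonempty → N ∩ interior Q ⊆ A ∧ N ∩ frontier Q ⊆ bdIn U A := by
  obtain ⟨N, hNo, hfN, hNV, hNi, hNe⟩ :=
    hQ.loc f hfΓ.1 (V ∩ U) (inter_mem hV (hU.mem_nhds hfΓ.2))
  have hNU : N ⊆ U := hNV.trans inter_subset_right
  have hNW : N \ Q ⊆ mainComp U Q u := by
    obtain ⟨w, hwN, hwW⟩ := mem_closure_iff.1 hf N hNo hfN
    have h1 := hNe.subset_connectedComponentIn (x := w) (F := U \ Q) ⟨hwN, (mainComp_subset hwW).2⟩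
      (fun x hx => ⟨hNU hx.1, hx.2⟩)
    unfold mainComp at hwW ⊢
    rwa [connectedComponentIn_eq hwW]
  have hNΓ : N ∩ frontier Q ⊆ closure (mainComp U Q u) := by
    rintro z ⟨hzN, hzΓ⟩
    rw [frontier_eq_closure_inter_closure] at hzΓ
    rw [mem_closure_iff]
    intro O hO hzO
    obtain ⟨w, hw, hwQ⟩ := mem_closure_iff.1 hzΓ.2 (O ∩ N) (hO.inter hNo) ⟨hzO, hzN⟩
    exact ⟨w, hw.1, hNW ⟨hw.2, hwQ⟩⟩
  have hWe := Set.eq_empty_iff_forall_notMem.1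
    (closure_mainComp_inter_interior (U := U) (Q := Q) (u := u))
  refine ⟨N, hNo, hfN, hNV.trans inter_subset_left, hNU,
    mem_closure_iff.1 (hQ.dense f hfΓ.1) N hNo hfN, hNi, hNΓ, ?_⟩
  rintro A hA ⟨a, haA, haN⟩
  have haQ : a ∈ Q := by
    by_contra h
    exact (hA.subset haA).2 (subset_closure (hNW ⟨haN, h⟩))
  have hai : a ∈ interior Q := by
    by_contra h
    exact (hA.subset haA).2 (hNΓ ⟨haN, subset_closure haQ, h⟩)
  have hsub : N ∩ interior Q ⊆ A := by
    rw [hA.eq_of_mem haA]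
    exact hNi.subset_connectedComponentIn ⟨haN, hai⟩
      fun x hx => ⟨hNU hx.1, fun h => hWe x ⟨h, hx.2⟩⟩
  refine ⟨hsub, ?_⟩
  rintro z ⟨hzN, hzΓ⟩
  refine ⟨⟨?_, fun h => (hA.subset h).2 (hNΓ ⟨hzN, hzΓ⟩)⟩, hNU hzN⟩
  rw [mem_closure_iff]
  intro O hO hzO
  obtain ⟨w, hw, hwQ⟩ := mem_closure_iff.1 (hQ.dense z hzΓ) (O ∩ N) (hO.inter hNo) ⟨hzO, hzN⟩
  exact ⟨w, hw.1, hsub ⟨hw.2, hwQ⟩⟩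

theorem IsDoor.eq_of_bd_inter (hU : IsOpen U) (hQ : NiceSet Q) (hA : IsDoor U Q u A)
    (hB : IsDoor U Q u B) {f : ℝ × ℝ} (hf : f ∈ bdIn U A) (hf' : f ∈ bdIn U B) : A = B := by
  obtain ⟨N, hNo, hfN, -, -, ⟨z, hz⟩, -, -, h⟩ := door_local hU hQ (hA.bd_subset_closure hf)
    (hA.bd_subset hU hQ hf) univ_mem
  have mA := mem_closure_iff.1 hf.1.1 N hNo hfN
  have mB := mem_closure_iff.1 hf'.1.1 N hNo hfN
  rw [inter_comm] at mA mB
  exact hA.eq_of_mem_mem hB ((h A hA mA).1 hz) ((h B hB mB).1 hz)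

theorem IsDoor.bd_eq_comp (hU : IsOpen U) (hQ : NiceSet Q) (hc : IsPreconnected (bdIn U A))
    (hA : IsDoor U Q u A) {y : ℝ × ℝ} (hy : y ∈ bdIn U A) :
    bdIn U A = connectedComponentIn (frontier Q ∩ U) y := by
  apply Subset.antisymm
  · exact hc.subset_connectedComponentIn hy (hA.bd_subset hU hQ)
  · set T := connectedComponentIn (frontier Q ∩ U) y with hT
    have hTs : T ⊆ frontier Q ∩ U := connectedComponentIn_subset _ _
    let O : Set (ℝ × ℝ) := ⋃₀ {N | IsOpen N ∧ N ∩ frontier Q ⊆ bdIn U A}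
    have hO : IsOpen O := isOpen_sUnion fun N hN => hN.1
    have hTO : T ⊆ O := by
      have hpre : IsPreconnected T := isPreconnected_connectedComponentIn
      have hA' := hA.isOpen hU
      have key : ∀ f ∈ bdIn U A, f ∈ O := by
        intro f hf
        obtain ⟨N, hNo, hfN, -, -, -, -, -, h⟩ := door_local hU hQ (hA.bd_subset_closure hf)
          (hA.bd_subset hU hQ hf) univ_mem
        have mA := mem_closure_iff.1 hf.1.1 N hNo hfN
        rw [inter_comm] at mA
        exact mem_sUnion.2 ⟨N, ⟨hNo, (h A hA mA).2⟩, hfN⟩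
      have hAO : ∀ x ∈ T, x ∈ O → x ∈ bdIn U A := by
        rintro x hx ⟨N, hN, hxN⟩
        exact hN.2 ⟨hxN, (hTs hx).1⟩
      rcases isPreconnected_iff_subset_of_disjoint.1 hpre O ((closure A)ᶜ ∪ A) hO
        (isClosed_closure.isOpen_compl.union hA') (fun x hx => by
          by_cases h1 : x ∈ closure A
          · by_cases h2 : x ∈ A
            · exact Or.inr (Or.inr h2)
            · exact Or.inl (key x ⟨⟨h1, h2⟩, (hTs hx).2⟩)
          · exact Or.inr (Or.inl h1)) (by
          ext x; simp only [mem_inter_iff, mem_empty_iff_false, iff_false]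
          rintro ⟨h1, h2, h3⟩
          have := hAO x h1 h2
          rcases h3 with h3 | h3
          · exact h3 this.1.1
          · exact this.1.2 h3) with h | h
      · exact h
      · have hyT : y ∈ T := mem_connectedComponentIn (hA.bd_subset hU hQ hy)
        rcases h hyT with h3 | h3
        · exact absurd hy.1.1 h3
        · exact absurd h3 hy.1.2
    rintro x hx
    obtain ⟨N, hN, hxN⟩ := hTO hx
    exact hN.2 ⟨hxN, (hTs hx).1⟩

theorem IsDoor.outside_conn (hU : IsOpen U) (hUc : IsPreconnected U) (hQ : NiceSet Q)
    (hu : u ∈ U \ Q) (hA : IsDoor U Q u A) : IsConnected (U \ closure A) := by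
  have huW := mem_mainComp hu
  have hWA := Set.eq_empty_iff_forall_notMem.1 (hA.closure_inter_main hU hQ)
  have hW' : mainComp U Q u ⊆ U \ closure A :=
    fun x hx => ⟨(mainComp_subset hx).1, fun h => hWA x ⟨h, hx⟩⟩
  have hWc : IsPreconnected (mainComp U Q u) := isPreconnected_connectedComponentIn
  refine ⟨⟨u, hW' huW⟩, isPreconnected_of_forall u fun y hy => ?_⟩
  by_cases hyW : y ∈ closure (mainComp U Q u)
  · refine ⟨insert y (mainComp U Q u), insert_subset hy hW', mem_insert_of_mem _ huW,
      mem_insert _ _, hWc.subset_closure (subset_insert _ _) (insert_subset hyW subset_closure)⟩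
  · have hB := isDoor_of_mem (u := u) ⟨hy.1, hyW⟩
    set B := connectedComponentIn (U \ closure (mainComp U Q u)) y with hBdef
    have hyB : y ∈ B := mem_connectedComponentIn ⟨hy.1, hyW⟩
    have hne : A ≠ B := by rintro h; exact hy.2 (subset_closure (h ▸ hyB))
    have hdisj : Disjoint A B := Set.disjoint_left.2 fun x hx hx' =>
      hne (hA.eq_of_mem_mem hB hx hx')
    have hBA := Set.eq_empty_iff_forall_notMem.1 (hdisj.closure_left (hB.isOpen hU)).inter_eq
    have hBA' := Set.eq_empty_iff_forall_notMem.1 (hdisj.symm.closure_left (hA.isOpen hU)).inter_eq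
    obtain ⟨f, hf⟩ := hB.bd_nonempty hU hUc hu
    have hfA : f ∈ U \ closure A := by
      refine ⟨hf.2, fun h => ?_⟩
      have hfA : f ∉ A := fun h' => hBA' f ⟨hf.1.1, h'⟩
      exact hne (hA.eq_of_bd_inter hU hQ hB ⟨⟨h, hfA⟩, hf.2⟩ hf)
    refine ⟨insert f (mainComp U Q u) ∪ insert f B, union_subset (insert_subset hfA hW')
      (insert_subset hfA fun x hx => ⟨(hB.subset hx).1, fun h => hBA x ⟨h, hx⟩⟩),
      Or.inl (mem_insert_of_mem _ huW), Or.inr (mem_insert_of_mem _ hyB), ?_⟩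
    refine IsPreconnected.union f (mem_insert _ _) (mem_insert _ _) ?_ ?_
    · exact hWc.subset_closure (subset_insert _ _)
        (insert_subset (hB.bd_subset_closure hf) subset_closure)
    · exact hB.isConnected.isPreconnected.subset_closure (subset_insert _ _)
        (insert_subset hf.1.1 subset_closure)

theorem IsDoor.hasTwoComps (hU : IsOpen U) (hUc : IsPreconnected U) (hQ : NiceSet Q)
    (hu : u ∈ U \ Q) (hA : IsDoor U Q u A) : HasTwoComps (U \ bdIn U A) A (U \ closure A) := by
  refine hasTwoComps_of_open_union (hA.isOpen hU) (hU.sdiff isClosed_closure) hA.isConnected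
    (hA.outside_conn hU hUc hQ hu) ?_ ?_
  · exact Set.disjoint_left.2 fun x hx hx' => hx'.2 (subset_closure hx)
  · ext x
    have h1 : x ∈ A → x ∈ U := fun h => (hA.subset h).1
    have h2 : x ∈ A → x ∈ closure A := fun h => subset_closure h
    simp only [bdIn, Set.mem_sdiff, mem_inter_iff, mem_union]
    tauto

end Doors

theorem isPreconnected_compl_closedBall (R : ℝ) (hR : 0 ≤ R) :
    IsPreconnected ((Metric.closedBall (0 : ℝ × ℝ) R)ᶜ) := by
  have h0 : IsPreconnected ({0}ᶜ : Set (ℝ × ℝ)) :=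
    (isConnected_compl_singleton_of_one_lt_rank (by
      rw [rank_prod']; simp only [Module.rank_self]; rw [one_add_one_eq_two]; exact Cardinal.one_lt_two) _).isPreconnected
  have : (Metric.closedBall (0 : ℝ × ℝ) R)ᶜ = (fun x : ℝ × ℝ => (1 + R / ‖x‖) • x) '' {0}ᶜ := by
    ext y
    simp only [mem_compl_iff, Metric.mem_closedBall, dist_zero_right, not_le, mem_image,
      mem_singleton_iff]
    constructor
    · intro hy
      have hy0 : ‖y‖ ≠ 0 := by linarith
      have hpos : 0 < 1 - R / ‖y‖ := by
        rw [sub_pos, div_lt_one (by linarith)]; exact hy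
      refine ⟨(1 - R / ‖y‖) • y, ?_, ?_⟩
      · intro h
        rcases smul_eq_zero.1 h with h | h
        · linarith
        · exact hy0 (by rw [h, norm_zero])
      · rw [norm_smul, Real.norm_of_nonneg hpos.le, smul_smul]
        convert one_smul ℝ y
        have : ‖y‖ - R ≠ 0 := by linarith
        field_simp
        ring
    · rintro ⟨x, hx, rfl⟩
      have hx0 : 0 < ‖x‖ := norm_pos_iff.2 hx
      rw [norm_smul, Real.norm_of_nonneg (by positivity)]
      field_simp
      linarith
  rw [this]
  refine h0.image _ ?_
  refine ContinuousOn.smul (continuousOn_const.add (continuousOn_const.div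
    continuous_norm.continuousOn fun x hx => norm_ne_zero_iff.2 hx)) continuousOn_id

theorem frontier_comp_not_subset {U Q V : Set (ℝ × ℝ)} {u : ℝ × ℝ} (hU : IsOpen U)
    (hUc : IsPreconnected U) (hsc : SimplyConnectedSpace U) (hQ : NiceSet Q) (hu : u ∈ U \ Q)
    (hV : IsPreconnected V) (huV : u ∈ V) (hVQ : V ∩ Q = ∅)
    (hVcpt : ∀ C, IsCompact C → C ⊆ U → ¬ V ⊆ C) {B : Set (ℝ × ℝ)} (hB : IsDoor U Q u B)
    (hBcpt : ∀ C, IsCompact C → C ⊆ U → ¬ B ⊆ C) {y : ℝ × ℝ} (hy : y ∈ bdIn U B) :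
    ¬ connectedComponentIn (frontier Q) y ⊆ U := by
  intro hcon
  have hBcut := hB.isCut hU hUc (unicoh_of_simplyConnected hU hsc) hu
  set σ := bdIn U B with hσ
  have hyΓ : y ∈ frontier Q := (hB.bd_subset hU hQ hy).1
  have hσ1 : σ = connectedComponentIn (frontier Q) y := by
    rw [hσ, hB.bd_eq_comp hU hQ hBcut.bd_conn.isPreconnected hy]
    apply Subset.antisymm (connectedComponentIn_mono _ inter_subset_left)
    exact isPreconnected_connectedComponentIn.subset_connectedComponentIn
      (mem_connectedComponentIn hyΓ) (subset_inter (connectedComponentIn_subset _ _) hcon)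
  have hσcpt : IsCompact σ := hQ.compactFr.of_isClosed_subset
    (hσ1 ▸ isClosed_connectedComponentIn' isClosed_frontier y)
    (hσ1 ▸ connectedComponentIn_subset _ _)
  have hσU : σ ⊆ U := inter_subset_right
  have hσΓ : σ ⊆ frontier Q := hσ1 ▸ connectedComponentIn_subset _ _
  have hu' : u ∈ univ \ Q := ⟨trivial, hu.2⟩
  have hWW : mainComp U Q u ⊆ mainComp univ Q u :=
    connectedComponentIn_mono _ fun x hx => ⟨trivial, hx.2⟩
  have hyW := closure_mono hWW (hB.bd_subset_closure hy)
  obtain ⟨N, hNo, hyN, hNU, -, ⟨x, hxN, hxQ⟩, -, hNΓ, hN⟩ :=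
    door_local isOpen_univ hQ hyW ⟨hyΓ, trivial⟩ (hU.mem_nhds (hσU hy))
  have hxW : x ∉ closure (mainComp univ Q u) := fun h =>
    Set.eq_empty_iff_forall_notMem.1 closure_mainComp_inter_interior x ⟨h, hxQ⟩
  have hA := isDoor_of_mem (U := univ) (Q := Q) (u := u) ⟨trivial, hxW⟩
  set A := connectedComponentIn (univ \ closure (mainComp univ Q u)) x with hAdef
  have hxA : x ∈ A := mem_connectedComponentIn ⟨trivial, hxW⟩
  have hAcut := hA.isCut isOpen_univ isPreconnected_univ unicoh_univ hu'
  have hNA := hN A hA ⟨x, hxA, hxN⟩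
  have hyA : y ∈ bdIn univ A := hNA.2 ⟨hyN, hyΓ⟩
  have hσ2 : bdIn univ A = σ := by
    rw [hA.bd_eq_comp isOpen_univ hQ hAcut.bd_conn.isPreconnected hyA, hσ1, inter_univ]
  have hBA : B ⊆ A := by
    refine subset_of_avoid_bdIn (U := univ) hBcut.conn.isPreconnected (subset_univ _) hAcut.isOpen
      ?_ ?_
    · obtain ⟨z, hzN, hzB⟩ := mem_closure_iff.1 hy.1.1 N hNo hyN
      obtain ⟨N', hN'o, hyN', hN'N, -, ⟨z, hz⟩, -, -, hN'⟩ :=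
        door_local hU hQ (hB.bd_subset_closure hy) ⟨hyΓ, hσU hy⟩ (hNo.mem_nhds hyN)
      have mB := mem_closure_iff.1 hy.1.1 N' hN'o hyN'
      rw [inter_comm] at mB
      exact ⟨z, (hN' B hB mB).1 hz, hNA.1 ⟨hN'N hz.1, hz.2⟩⟩
    · rw [hσ2]
      ext z; simp only [mem_inter_iff, mem_empty_iff_false, iff_false]
      rintro ⟨h1, h2⟩; exact h2.1.2 h1
  have hσA : σ = frontier A := by
    rw [← hσ2, bdIn, inter_univ, hAcut.isOpen.frontier_eq]
  have hVA : V ∩ closure A = ∅ := by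
    refine inter_eq_empty_of_avoid_bdIn (U := univ) hV (subset_univ _) hAcut.isOpen huV
      hAcut.base ?_
    rw [hσ2]
    ext z; simp only [mem_inter_iff, mem_empty_iff_false, iff_false]
    rintro ⟨h1, h2⟩
    exact Set.eq_empty_iff_forall_notMem.1 hVQ z ⟨h1, hQ.closed.frontier_subset (hσΓ h2)⟩
  obtain ⟨R, hR0, hR⟩ := hσcpt.isBounded.subset_closedBall_lt 0 0
  have hcb := isPreconnected_compl_closedBall R hR0.le
  have hcbσ : (Metric.closedBall (0 : ℝ × ℝ) R)ᶜ ∩ bdIn univ A = ∅ := by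
    rw [hσ2]
    ext z; simp only [mem_inter_iff, mem_empty_iff_false, iff_false]
    rintro ⟨h1, h2⟩; exact h1 (hR h2)
  have finish : ∀ I : Set (ℝ × ℝ), IsOpen I → Bornology.IsBounded I → frontier I ⊆ σ →
      ∃ C, IsCompact C ∧ C ⊆ U ∧ I ⊆ C := by
    intro I hI hIb hIσ
    have hIU := no_compact_hole hU hsc hI hIb (hIσ.trans hσU)
    refine ⟨closure I, hIb.isCompact_closure, ?_, subset_closure⟩
    rw [closure_eq_self_union_frontier]
    exact union_subset hIU (hIσ.trans hσU)
  by_cases hcase : ((Metric.closedBall (0 : ℝ × ℝ) R)ᶜ ∩ A).Nonempty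
  · have h1 := subset_of_avoid_bdIn (U := univ) hcb (subset_univ _) hAcut.isOpen hcase hcbσ
    obtain ⟨C, hC, hCU, hIC⟩ := finish (closure A)ᶜ isClosed_closure.isOpen_compl
      (Metric.isBounded_closedBall.subset (compl_subset_comm.1
        (h1.trans subset_closure) : _ ⊆ Metric.closedBall (0 : ℝ × ℝ) R))
      (by rw [frontier_compl, hσA]; exact frontier_closure_subset)
    have h2 : V ⊆ (closure A)ᶜ := fun z hz h =>
      Set.eq_empty_iff_forall_notMem.1 hVA z ⟨hz, h⟩
    exact hVcpt C hC hCU (h2.trans hIC)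
  · obtain ⟨C, hC, hCU, hIC⟩ := finish A hAcut.isOpen
      (Metric.isBounded_closedBall.subset (fun z hz => by
        by_contra h
        exact hcase ⟨z, h, hz⟩ : A ⊆ Metric.closedBall (0 : ℝ × ℝ) R)) hσA.symm.subset
    exact hBcpt C hC hCU (hBA.trans hIC)

section Loops

variable {V : Type} (σ : Equiv.Perm V) (p : V → ℝ × ℝ)

/-- The point at parameter `τ` of the segment from `p v` to `p (σ v)`. -/
def segPt (v : V) (τ : ℝ) : ℝ × ℝ := p v + τ • (p (σ v) - p v)

/-- The closed polygonal curve through the points of the orbit of `v`. -/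
def loopPt (v : V) (t : ℝ) : ℝ × ℝ := segPt σ p ((σ ^ ⌊t⌋) v) (Int.fract t)

theorem continuous_segPt (v : V) : Continuous (segPt σ p v) := by
  unfold segPt
  fun_prop

theorem segPt_one (v : V) : segPt σ p v 1 = segPt σ p (σ v) 0 := by
  simp [segPt]

theorem loopPt_eq (v : V) (n : ℤ) {t : ℝ} (h : t ∈ Icc (n : ℝ) (n + 1)) :
    loopPt σ p v t = segPt σ p ((σ ^ n) v) (t - n) := by
  rcases h.2.eq_or_lt with rfl | h2
  · have h1 : ⌊(n : ℝ) + 1⌋ = n + 1 := by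
      rw [← Int.cast_one, ← Int.cast_add, Int.floor_intCast]
    rw [loopPt, Int.fract, h1]
    push_cast
    rw [sub_self, add_sub_cancel_left, segPt_one, add_comm n 1, zpow_add, zpow_one,
      Equiv.Perm.mul_apply]
  · have h1 : ⌊t⌋ = n := Int.floor_eq_iff.2 ⟨h.1, h2⟩
    rw [loopPt, Int.fract, h1]

theorem continuous_loopPt (v : V) : Continuous (loopPt σ p v) := by
  rw [continuous_iff_continuousAt]
  intro t
  have hfl : ∀ n : ℤ, ContinuousOn (loopPt σ p v) (Icc (n : ℝ) (n + 1)) := fun n =>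
    ((continuous_segPt σ p ((σ ^ n) v)).comp (continuous_id.sub continuous_const)).continuousOn.congr
      fun t ht => loopPt_eq σ p v n ht
  have h2 : ContinuousOn (loopPt σ p v) (Icc ((⌊t⌋ - 1 : ℤ) : ℝ) ((⌊t⌋ - 1 : ℤ) + 1) ∪
      Icc (⌊t⌋ : ℝ) (⌊t⌋ + 1)) :=
    (hfl _).union_of_isClosed (hfl _) isClosed_Icc isClosed_Icc
  refine h2.continuousAt (mem_of_superset (Ioo_mem_nhds (a := (⌊t⌋ : ℝ) - 1) (b := ⌊t⌋ + 1) ?_ ?_) ?_)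
  · linarith [Int.floor_le t]
  · exact Int.lt_floor_add_one t
  · rintro s ⟨hs1, hs2⟩
    push_cast
    rcases le_total s ⌊t⌋ with h | h
    · exact Or.inl ⟨hs1.le, by linarith⟩
    · exact Or.inr ⟨h, hs2.le⟩

theorem loopPt_add {v : V} {n : ℤ} (h : (σ ^ n) v = v) (t : ℝ) :
    loopPt σ p v (t + n) = loopPt σ p v t := by
  rw [loopPt, loopPt, Int.floor_add_intCast, Int.fract_add_intCast, zpow_add,
    Equiv.Perm.mul_apply, h]

variable {σ p}

theorem loopPt_eq_iff (hinj : ∀ v v' τ τ', τ ∈ Ico (0:ℝ) 1 → τ' ∈ Ico (0:ℝ) 1 →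
    segPt σ p v τ = segPt σ p v' τ' → v = v' ∧ τ = τ') {v : V} {s t : ℝ}
    (h : loopPt σ p v s = loopPt σ p v t) : ∃ n : ℤ, (σ ^ n) v = v ∧ t = s + n := by
  obtain ⟨h1, h2⟩ := hinj _ _ _ _ ⟨Int.fract_nonneg s, Int.fract_lt_one s⟩
    ⟨Int.fract_nonneg t, Int.fract_lt_one t⟩ h
  refine ⟨⌊t⌋ - ⌊s⌋, ?_, ?_⟩
  · rw [sub_eq_neg_add, zpow_add, Equiv.Perm.mul_apply, ← h1, zpow_neg,
      Equiv.Perm.coe_inv, Equiv.symm_apply_apply]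
  · push_cast
    linarith [Int.floor_add_fract s, Int.floor_add_fract t]

/-- The components of the trace on an open set of a finite disjoint union of polygonal loops are
open arcs. -/
theorem exists_arc_of_loops [Finite V]
    (hinj : ∀ v v' τ τ', τ ∈ Ico (0:ℝ) 1 → τ' ∈ Ico (0:ℝ) 1 →
      segPt σ p v τ = segPt σ p v' τ' → v = v' ∧ τ = τ')
    {Γ : Set (ℝ × ℝ)} (hΓ : ∀ z, z ∈ Γ ↔ ∃ v, ∃ τ ∈ Ico (0:ℝ) 1, z = segPt σ p v τ)
    {U : Set (ℝ × ℝ)} (hU : IsOpen U) {y : ℝ × ℝ} (hy : y ∈ Γ ∩ U)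
    (hnot : ¬ connectedComponentIn Γ y ⊆ U) :
    ∃ g : ℝ → ℝ × ℝ, ContinuousOn g (Icc 0 1) ∧ InjOn g (Ioo 0 1) ∧
      g '' Ioo 0 1 = connectedComponentIn (Γ ∩ U) y ∧ g 0 ∉ U ∧ g 1 ∉ U := by
  obtain ⟨v, τ₀, hτ₀, rfl⟩ := (hΓ y).1 hy.1
  set c := loopPt σ p v with hc
  have hcc : Continuous c := continuous_loopPt σ p v
  have hcy : c τ₀ = segPt σ p v τ₀ := by
    have := loopPt_eq σ p v 0 (t := τ₀) ⟨by simpa using hτ₀.1, by simpa using hτ₀.2.le⟩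
    simpa using this
  rw [← hcy] at hy hnot ⊢
  have hcΓ : ∀ t, c t ∈ Γ := fun t =>
    (hΓ _).2 ⟨_, _, ⟨Int.fract_nonneg t, Int.fract_lt_one t⟩, rfl⟩
  -- the minimal period
  have hper : ∃ N : ℕ, 0 < N ∧ (σ ^ N) v = v :=
    ⟨orderOf σ, orderOf_pos σ, by rw [pow_orderOf_eq_one]; rfl⟩
  classical
  obtain ⟨N, ⟨hN0, hNv⟩, hNmin⟩ : ∃ N : ℕ, (0 < N ∧ (σ ^ N) v = v) ∧
      ∀ m : ℕ, 0 < m ∧ (σ ^ m) v = v → N ≤ m :=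
    ⟨Nat.find hper, Nat.find_spec hper, fun m hm => Nat.find_min' hper hm⟩
  have hN0' : (0:ℝ) < N := by exact_mod_cast hN0
  have hcN : ∀ (k : ℤ) t, c (t + k * N) = c t := by
    intro k t
    have : (σ ^ (k * (N:ℤ))) v = v := by
      rw [mul_comm, zpow_mul, zpow_natCast]
      exact Function.IsFixedPt.perm_zpow hNv k
    have := loopPt_add σ p this t
    push_cast at this
    exact this
  have hsep : ∀ s t, c s = c t → s < t → s + N ≤ t := by
    intro s t h hst
    obtain ⟨n, hn, rfl⟩ := loopPt_eq_iff hinj h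
    have hn0 : (0:ℝ) < n := by linarith
    have hn0 : 0 < n := by exact_mod_cast hn0
    lift n to ℕ using hn0.le
    have := hNmin n ⟨by exact_mod_cast hn0, by simpa using hn⟩
    have : (N:ℝ) ≤ n := by exact_mod_cast this
    simpa using this
  have hwrap : ∀ a t : ℝ, ∃ s ∈ Ico a (a + N), c s = c t := by
    intro a t
    obtain ⟨k, hk, -⟩ := existsUnique_add_zsmul_mem_Ico hN0' t a
    refine ⟨_, hk, ?_⟩
    rw [zsmul_eq_mul]
    exact hcN k t
  -- the other loops
  set Γ' : Set (ℝ × ℝ) := ⋃ w ∈ {w | ∀ n : ℤ, (σ ^ n) v ≠ w}, segPt σ p w '' Icc 0 1 with hΓ'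
  have hΓ'c : IsClosed Γ' := by
    refine (Set.toFinite _).isClosed_biUnion fun w _ => ?_
    exact (isCompact_Icc.image (continuous_segPt σ p w)).isClosed
  have hdis : ∀ t, c t ∉ Γ' := by
    intro t ht
    simp only [hΓ', mem_iUnion] at ht
    obtain ⟨w, hw, τ, hτ, h⟩ := ht
    rcases hτ.2.eq_or_lt with rfl | hlt
    · rw [segPt_one] at h
      have := (hinj _ _ _ _ ⟨le_rfl, one_pos⟩ ⟨Int.fract_nonneg t, Int.fract_lt_one t⟩ h).1
      refine hw (⌊t⌋ - 1) ?_
      rw [sub_eq_neg_add, zpow_add, Equiv.Perm.mul_apply, ← this, zpow_neg, zpow_one,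
        Equiv.Perm.coe_inv, Equiv.symm_apply_apply]
    · have := (hinj _ _ _ _ ⟨hτ.1, hlt⟩ ⟨Int.fract_nonneg t, Int.fract_lt_one t⟩ h).1
      exact hw _ this.symm
  have hcov : ∀ z ∈ Γ, (∃ t, c t = z) ∨ z ∈ Γ' := by
    intro z hz
    obtain ⟨w, τ, hτ, rfl⟩ := (hΓ z).1 hz
    by_cases hw : ∃ n : ℤ, (σ ^ n) v = w
    · obtain ⟨n, rfl⟩ := hw
      refine Or.inl ⟨n + τ, ?_⟩
      rw [hc, loopPt_eq σ p v n ⟨by linarith [hτ.1], by linarith [hτ.2]⟩, add_sub_cancel_left]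
    · push Not at hw
      exact Or.inr (mem_biUnion (show w ∈ {w | ∀ n : ℤ, (σ ^ n) v ≠ w} from hw)
        ⟨τ, Ico_subset_Icc_self hτ, rfl⟩)
  have hrange : IsClosed (range c) := by
    have : range c = c '' Icc 0 (0 + N) := by
      refine Subset.antisymm ?_ (image_subset_range _ _)
      rintro _ ⟨t, rfl⟩
      obtain ⟨s, hs, h⟩ := hwrap 0 t
      exact ⟨s, Ico_subset_Icc_self hs, h⟩
    rw [this]
    exact (isCompact_Icc.image hcc).isClosed
  -- a point of the loop outside `U`
  obtain ⟨t₁, ht₁⟩ : ∃ t, c t ∉ U := by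
    by_contra! hcon
    refine hnot fun z hz => ?_
    have hpre := isPreconnected_closed_iff.1
      (isPreconnected_connectedComponentIn (x := c τ₀) (F := Γ)) (range c) Γ' hrange hΓ'c
      (fun w hw => hcov w (connectedComponentIn_subset _ _ hw))
      ⟨c τ₀, mem_connectedComponentIn hy.1, τ₀, rfl⟩
    rcases hcov z (connectedComponentIn_subset _ _ hz) with ⟨t, rfl⟩ | h
    · exact hcon t
    · obtain ⟨_, -, ⟨t, rfl⟩, h'⟩ := hpre ⟨z, hz, h⟩
      exact absurd h' (hdis t)
  have hcl : IsClosed {t | c t ∉ U} := hU.isClosed_compl.preimage hcc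
  -- the maximal parameter interval
  obtain ⟨a, ha, haU, hamax⟩ : ∃ a, a < τ₀ ∧ c a ∉ U ∧ ∀ t, a < t → t ≤ τ₀ → c t ∈ U := by
    set T := {t | c t ∉ U} ∩ Iic τ₀ with hT
    obtain ⟨s, hs, hst⟩ := hwrap (τ₀ - N) t₁
    have hne : T.Nonempty := ⟨s, by
      change c s ∉ U
      rw [hst]; exact ht₁, by have := hs.2; simp at this; exact this.le⟩
    have hbd : BddAbove T := ⟨τ₀, fun t ht => ht.2⟩
    have hmem : sSup T ∈ T := (hcl.inter isClosed_Iic).csSup_mem hne hbd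
    refine ⟨sSup T, lt_of_le_of_ne hmem.2 ?_, hmem.1, fun t ht htτ => ?_⟩
    · intro h
      have := hmem.1
      rw [h] at this
      exact this hy.2
    · by_contra hcon
      exact ht.not_ge (le_csSup hbd ⟨hcon, htτ⟩)
  obtain ⟨b, hb, hbU, hbmin⟩ : ∃ b, τ₀ < b ∧ c b ∉ U ∧ ∀ t, τ₀ ≤ t → t < b → c t ∈ U := by
    set T := {t | c t ∉ U} ∩ Ici τ₀ with hT
    obtain ⟨s, hs, hst⟩ := hwrap τ₀ t₁
    have hne : T.Nonempty := ⟨s, by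
      change c s ∉ U
      rw [hst]; exact ht₁, hs.1⟩
    have hbd : BddBelow T := ⟨τ₀, fun t ht => ht.2⟩
    have hmem : sInf T ∈ T := (hcl.inter isClosed_Ici).csInf_mem hne hbd
    refine ⟨sInf T, lt_of_le_of_ne hmem.2 ?_, hmem.1, fun t htτ ht => ?_⟩
    · intro h
      have := hmem.1
      rw [← h] at this
      exact this hy.2
    · by_contra hcon
      exact ht.not_ge (csInf_le hbd ⟨hcon, htτ⟩)
  have hab : ∀ t ∈ Ioo a b, c t ∈ U := fun t ht =>
    (le_total t τ₀).elim (hamax t ht.1) fun h => hbmin t h ht.2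
  have hbN : b ≤ a + N := by
    by_contra! hcon
    have h1 := hab (a + N) ⟨by linarith, hcon⟩
    have h2 := hcN 1 a
    rw [Int.cast_one, one_mul] at h2
    rw [h2] at h1
    exact haU h1
  have hcomp : connectedComponentIn (Γ ∩ U) (c τ₀) = c '' Ioo a b := by
    refine Subset.antisymm ?_ ?_
    · have hF1 : IsClosed (c '' Icc a b) := (isCompact_Icc.image hcc).isClosed
      have hF2 : IsClosed (c '' Icc b (a + N) ∪ Γ') :=
        (isCompact_Icc.image hcc).isClosed.union hΓ'c
      have hcov' : Γ ∩ U ⊆ c '' Icc a b ∪ (c '' Icc b (a + N) ∪ Γ') := by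
        rintro z ⟨hz, -⟩
        rcases hcov z hz with ⟨t, rfl⟩ | h
        · obtain ⟨s, hs, hst⟩ := hwrap a t
          rw [← hst]
          rcases le_total s b with h | h
          · exact Or.inl ⟨s, ⟨hs.1, h⟩, rfl⟩
          · exact Or.inr (Or.inl ⟨s, ⟨h, hs.2.le⟩, rfl⟩)
        · exact Or.inr (Or.inr h)
      have hIoo : ∀ z ∈ c '' Icc a b, z ∈ U → z ∈ c '' Ioo a b := by
        rintro _ ⟨t, ht, rfl⟩ htU
        refine ⟨t, ⟨lt_of_le_of_ne ht.1 ?_, lt_of_le_of_ne ht.2 ?_⟩, rfl⟩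
        · rintro rfl; exact haU htU
        · rintro rfl; exact hbU htU
      have hsub := connectedComponentIn_subset (Γ ∩ U) (c τ₀)
      have hpre := isPreconnected_closed_iff.1
        (isPreconnected_connectedComponentIn (x := c τ₀) (F := Γ ∩ U)) _ _ hF1 hF2
        (hsub.trans hcov') ⟨c τ₀, mem_connectedComponentIn hy, τ₀, ⟨ha.le, hb.le⟩, rfl⟩
      intro z hz
      rcases hcov' (hsub hz) with h | h
      · exact hIoo z h (hsub hz).2
      · exfalso
        obtain ⟨w, hw, hw1, hw2⟩ := hpre ⟨z, hz, h⟩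
        obtain ⟨s, hs, rfl⟩ := hIoo w hw1 (hsub hw).2
        rcases hw2 with ⟨t, ht, hts⟩ | h'
        · have := hsep s t hts.symm (hs.2.trans_le ht.1)
          linarith [ht.2, hs.1]
        · exact hdis s h'
    · refine IsPreconnected.subset_connectedComponentIn
        (isPreconnected_Ioo.image _ hcc.continuousOn) ⟨τ₀, ⟨ha, hb⟩, rfl⟩ ?_
      rintro _ ⟨t, ht, rfl⟩
      exact ⟨hcΓ t, hab t ht⟩
  have hba : 0 < b - a := by linarith
  have himg : (fun s : ℝ => a + s * (b - a)) '' Ioo 0 1 = Ioo a b := by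
    ext t
    constructor
    · rintro ⟨s, hs, rfl⟩
      constructor
      · nlinarith [hs.1, hs.2]
      · nlinarith [hs.1, hs.2]
    · intro ht
      refine ⟨(t - a) / (b - a), ⟨div_pos (by linarith [ht.1]) hba,
        (div_lt_one hba).2 (by linarith [ht.2])⟩, ?_⟩
      simp only
      rw [div_mul_cancel₀ _ hba.ne']
      ring
  refine ⟨fun s => c (a + s * (b - a)), ?_, ?_, ?_, ?_, ?_⟩
  · exact (hcc.comp (by fun_prop)).continuousOn
  · have key : ∀ s t, s ∈ Ioo (0:ℝ) 1 → t ∈ Ioo (0:ℝ) 1 →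
        c (a + s * (b - a)) = c (a + t * (b - a)) → ¬ s < t := by
      intro s t hs ht h hst
      have h1 := hsep _ _ h (by nlinarith)
      have h2 : a + t * (b - a) < b := (himg ▸ mem_image_of_mem _ ht : _ ∈ Ioo a b).2
      nlinarith [hs.1]
    intro s hs t ht h
    exact le_antisymm (not_lt.1 (key t s ht hs h.symm)) (not_lt.1 (key s t hs ht h))
  · rw [hcomp, ← himg, image_image]
  · simpa using haU
  · simpa using hbU

end Loops

/-- The index of the unit interval to the left of `x`. -/
def lo (x : ℝ) : ℤ := ⌈x⌉ - 1

/-- The index of the unit interval to the right of `x`. -/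
def hi (x : ℝ) : ℤ := ⌊x⌋

theorem lo_int (n : ℤ) : lo n = n - 1 := by simp [lo]

theorem hi_int (n : ℤ) : hi n = n := by simp [hi]

theorem lo_eq {x : ℝ} {n : ℤ} (h : (n : ℝ) < x) (h' : x ≤ n + 1) : lo x = n := by
  have : ⌈x⌉ = n + 1 := Int.ceil_eq_iff.2 ⟨by push_cast; linarith, by push_cast; linarith⟩
  rw [lo, this]; ring

theorem hi_eq {x : ℝ} {n : ℤ} (h : (n : ℝ) ≤ x) (h' : x < n + 1) : hi x = n :=
  Int.floor_eq_iff.2 ⟨h, h'⟩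

theorem int_or_between (x : ℝ) : (∃ n : ℤ, x = n) ∨ ∃ n : ℤ, (n : ℝ) < x ∧ x < n + 1 := by
  rcases (Int.floor_le x).eq_or_lt with h | h
  · exact Or.inl ⟨_, h.symm⟩
  · exact Or.inr ⟨_, h, Int.lt_floor_add_one x⟩

theorem lo_lt (x : ℝ) : (lo x : ℝ) < x := by
  have := Int.ceil_lt_add_one x
  rw [lo]; push_cast; linarith

theorem le_lo_add_one (x : ℝ) : x ≤ lo x + 1 := by
  have := Int.le_ceil x
  rw [lo]; push_cast; linarith

theorem exists_local_cells (x : ℝ) : ∃ r > 0, ∀ w ∈ Ioo (x - r) (x + r),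
    (w < x → lo w = lo x ∧ hi w = lo x) ∧ (x < w → lo w = hi x ∧ hi w = hi x) := by
  refine ⟨min (x - lo x) (hi x + 1 - x), lt_min (sub_pos.2 (lo_lt x))
    (sub_pos.2 (Int.lt_floor_add_one x)), fun w hw => ?_⟩
  have h1 : (lo x : ℝ) < w := by linarith [hw.1, min_le_left (x - lo x) (hi x + 1 - x)]
  have h2 : w < hi x + 1 := by linarith [hw.2, min_le_right (x - lo x) (hi x + 1 - x)]
  have h3 := le_lo_add_one x
  have h4 : (hi x : ℝ) ≤ x := Int.floor_le x
  exact ⟨fun h => ⟨lo_eq h1 (h.le.trans h3), hi_eq h1.le (h.trans_le h3)⟩,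
    fun h => ⟨lo_eq (h4.trans_lt h) h2.le, hi_eq (h4.trans h.le) h2⟩⟩

/-- The open square of radius `r` around `z`. -/
def box (z : ℝ × ℝ) (r : ℝ) : Set (ℝ × ℝ) := Ioo (z.1 - r) (z.1 + r) ×ˢ Ioo (z.2 - r) (z.2 + r)

/-- In `box z r`, only the cells touching `z` are visible. -/
def Small (z : ℝ × ℝ) (r : ℝ) : Prop := 0 < r ∧ ∀ w ∈ box z r,
    ((w.1 < z.1 → lo w.1 = lo z.1 ∧ hi w.1 = lo z.1) ∧
      (z.1 < w.1 → lo w.1 = hi z.1 ∧ hi w.1 = hi z.1)) ∧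
    (w.2 < z.2 → lo w.2 = lo z.2 ∧ hi w.2 = lo z.2) ∧
      (z.2 < w.2 → lo w.2 = hi z.2 ∧ hi w.2 = hi z.2)

theorem exists_small {z : ℝ × ℝ} {V : Set (ℝ × ℝ)} (hV : V ∈ 𝓝 z) :
    ∃ r, Small z r ∧ box z r ⊆ V := by
  obtain ⟨r₁, h₁, H₁⟩ := exists_local_cells z.1
  obtain ⟨r₂, h₂, H₂⟩ := exists_local_cells z.2
  obtain ⟨ε, hε, hεV⟩ := Metric.mem_nhds_iff.1 hV
  have hr1 : min (min r₁ r₂) ε ≤ r₁ := (min_le_left _ _).trans (min_le_left _ _)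
  have hr2 : min (min r₁ r₂) ε ≤ r₂ := (min_le_left _ _).trans (min_le_right _ _)
  have hr3 : min (min r₁ r₂) ε ≤ ε := min_le_right _ _
  refine ⟨min (min r₁ r₂) ε, ⟨by positivity, fun w hw => ⟨H₁ w.1 ?_, H₂ w.2 ?_⟩⟩, fun w hw => hεV ?_⟩
  · exact ⟨by linarith [hw.1.1], by linarith [hw.1.2]⟩
  · exact ⟨by linarith [hw.2.1], by linarith [hw.2.2]⟩
  · rw [Metric.mem_ball, Prod.dist_eq, max_lt_iff, Real.dist_eq, Real.dist_eq, abs_lt, abs_lt]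
    exact ⟨⟨by linarith [hw.1.1], by linarith [hw.1.2]⟩, by linarith [hw.2.1], by linarith [hw.2.2]⟩

theorem isOpen_box (z : ℝ × ℝ) (r : ℝ) : IsOpen (box z r) := isOpen_Ioo.prod isOpen_Ioo

theorem mem_box {z : ℝ × ℝ} {r : ℝ} (hr : 0 < r) : z ∈ box z r :=
  ⟨⟨by linarith, by linarith⟩, by linarith, by linarith⟩

/-- The union of the closed unit cells with index in `C`. -/
def cellSet (C : ℤ → ℤ → Prop) : Set (ℝ × ℝ) :=
  {z | C (lo z.1) (lo z.2) ∨ C (hi z.1) (lo z.2) ∨ C (lo z.1) (hi z.2) ∨ C (hi z.1) (hi z.2)}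

/-- The points all of whose adjacent cells have index in `C`. -/
def openCells (C : ℤ → ℤ → Prop) : Set (ℝ × ℝ) :=
  {z | C (lo z.1) (lo z.2) ∧ C (hi z.1) (lo z.2) ∧ C (lo z.1) (hi z.2) ∧ C (hi z.1) (hi z.2)}

/-- The part of `box z r` outside the closed quadrants excluded by the four propositions. -/
def quadSet (z : ℝ × ℝ) (r : ℝ) (A B C D : Prop) : Set (ℝ × ℝ) :=
  {w | w ∈ box z r ∧ (w.1 ≤ z.1 → w.2 ≤ z.2 → A) ∧ (z.1 ≤ w.1 → w.2 ≤ z.2 → B) ∧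
    (w.1 ≤ z.1 → z.2 ≤ w.2 → C) ∧ (z.1 ≤ w.1 → z.2 ≤ w.2 → D)}

theorem isPreconnected_quadSet {z : ℝ × ℝ} {r : ℝ} (hr : 0 < r) {A B C D : Prop}
    (h1 : ¬ (A ∧ D ∧ ¬ B ∧ ¬ C)) (h2 : ¬ (B ∧ C ∧ ¬ A ∧ ¬ D)) :
    IsPreconnected (quadSet z r A B C D) := by
  have rect : ∀ a b c d : ℝ, IsPreconnected (Ioo a b ×ˢ Ioo c d) := fun a b c d =>
    isPreconnected_Ioo.prod isPreconnected_Ioo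
  obtain ⟨x, y⟩ := z
  have two : ∀ (a b c d a' b' c' d' s t : ℝ), (s, t) ∈ Ioo a b ×ˢ Ioo c d →
      (s, t) ∈ Ioo a' b' ×ˢ Ioo c' d' →
      (∀ u v, (u, v) ∈ quadSet (x, y) r A B C D ↔
        (a < u ∧ u < b ∧ c < v ∧ v < d) ∨ (a' < u ∧ u < b' ∧ c' < v ∧ v < d')) →
      IsPreconnected (quadSet (x, y) r A B C D) := by
    intro a b c d a' b' c' d' s t hw hw' h
    have : quadSet (x, y) r A B C D = Ioo a b ×ˢ Ioo c d ∪ Ioo a' b' ×ˢ Ioo c' d' := by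
      ext ⟨u, v⟩
      rw [h]
      simp [and_assoc]
    rw [this]
    exact IsPreconnected.union _ hw hw' (rect _ _ _ _) (rect _ _ _ _)
  have hm : ∀ u v, (u, v) ∈ quadSet (x, y) r A B C D ↔
      (x - r < u ∧ u < x + r ∧ y - r < v ∧ v < y + r) ∧ (u ≤ x → v ≤ y → A) ∧
        (x ≤ u → v ≤ y → B) ∧ (u ≤ x → y ≤ v → C) ∧ (x ≤ u → y ≤ v → D) := by
    intro u v
    simp [quadSet, box, and_assoc]
  simp only [hm] at two
  clear hm
  by_cases hA : A <;> by_cases hB : B <;> by_cases hC : C <;> by_cases hD : D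
  · exact two (x - r) (x + r) (y - r) (y + r) (x - r) (x + r) (y - r) (y + r) (x + r / 2) (y + r / 2) (by constructor <;> constructor <;> dsimp only <;> linarith) (by constructor <;> constructor <;> dsimp only <;> linarith)
      (by simp only [hA, hB, hC, hD]; grind)
  · exact two (x - r) (x + r) (y - r) (y) (x - r) (x) (y - r) (y + r) (x - r / 2) (y - r / 2) (by constructor <;> constructor <;> dsimp only <;> linarith) (by constructor <;> constructor <;> dsimp only <;> linarith)
      (by simp only [hA, hB, hC, hD]; grind)
  · exact two (x - r) (x + r) (y - r) (y) (x) (x + r) (y - r) (y + r) (x + r / 2) (y - r / 2) (by constructor <;> constructor <;> dsimp only <;> linarith) (by constructor <;> constructor <;> dsimp only <;> linarith)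
      (by simp only [hA, hB, hC, hD]; grind)
  · exact two (x - r) (x + r) (y - r) (y) (x - r) (x + r) (y - r) (y) (x + r / 2) (y - r / 2) (by constructor <;> constructor <;> dsimp only <;> linarith) (by constructor <;> constructor <;> dsimp only <;> linarith)
      (by simp only [hA, hB, hC, hD]; grind)
  · exact two (x - r) (x) (y - r) (y + r) (x - r) (x + r) (y) (y + r) (x - r / 2) (y + r / 2) (by constructor <;> constructor <;> dsimp only <;> linarith) (by constructor <;> constructor <;> dsimp only <;> linarith)
      (by simp only [hA, hB, hC, hD]; grind)
  · exact two (x - r) (x) (y - r) (y + r) (x - r) (x) (y - r) (y + r) (x - r / 2) (y + r / 2) (by constructor <;> constructor <;> dsimp only <;> linarith) (by constructor <;> constructor <;> dsimp only <;> linarith)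
      (by simp only [hA, hB, hC, hD]; grind)
  · exact absurd ⟨by assumption, by assumption, by assumption, by assumption⟩ h1
  · exact two (x - r) (x) (y - r) (y) (x - r) (x) (y - r) (y) (x - r / 2) (y - r / 2) (by constructor <;> constructor <;> dsimp only <;> linarith) (by constructor <;> constructor <;> dsimp only <;> linarith)
      (by simp only [hA, hB, hC, hD]; grind)
  · exact two (x) (x + r) (y - r) (y + r) (x - r) (x + r) (y) (y + r) (x + r / 2) (y + r / 2) (by constructor <;> constructor <;> dsimp only <;> linarith) (by constructor <;> constructor <;> dsimp only <;> linarith)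
      (by simp only [hA, hB, hC, hD]; grind)
  · exact absurd ⟨by assumption, by assumption, by assumption, by assumption⟩ h2
  · exact two (x) (x + r) (y - r) (y + r) (x) (x + r) (y - r) (y + r) (x + r / 2) (y + r / 2) (by constructor <;> constructor <;> dsimp only <;> linarith) (by constructor <;> constructor <;> dsimp only <;> linarith)
      (by simp only [hA, hB, hC, hD]; grind)
  · exact two (x) (x + r) (y - r) (y) (x) (x + r) (y - r) (y) (x + r / 2) (y - r / 2) (by constructor <;> constructor <;> dsimp only <;> linarith) (by constructor <;> constructor <;> dsimp only <;> linarith)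
      (by simp only [hA, hB, hC, hD]; grind)
  · exact two (x - r) (x + r) (y) (y + r) (x - r) (x + r) (y) (y + r) (x + r / 2) (y + r / 2) (by constructor <;> constructor <;> dsimp only <;> linarith) (by constructor <;> constructor <;> dsimp only <;> linarith)
      (by simp only [hA, hB, hC, hD]; grind)
  · exact two (x - r) (x) (y) (y + r) (x - r) (x) (y) (y + r) (x - r / 2) (y + r / 2) (by constructor <;> constructor <;> dsimp only <;> linarith) (by constructor <;> constructor <;> dsimp only <;> linarith)
      (by simp only [hA, hB, hC, hD]; grind)
  · exact two (x) (x + r) (y) (y + r) (x) (x + r) (y) (y + r) (x + r / 2) (y + r / 2) (by constructor <;> constructor <;> dsimp only <;> linarith) (by constructor <;> constructor <;> dsimp only <;> linarith)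
      (by simp only [hA, hB, hC, hD]; grind)
  · have : quadSet (x, y) r A B C D = ∅ := by
      refine eq_empty_of_forall_notMem fun w hw => ?_
      rcases le_total w.1 x with h | h <;> rcases le_total w.2 y with h' | h'
      · exact hA (hw.2.1 h h')
      · exact hC (hw.2.2.2.1 h h')
      · exact hB (hw.2.2.1 h h')
      · exact hD (hw.2.2.2.2 h h')
    rw [this]
    exact isPreconnected_empty

/-- No four cells around a lattice point form a checkerboard. -/
def NoChecker (C : ℤ → ℤ → Prop) : Prop :=
  ∀ i j, (C i j ↔ C (i + 1) j) ∨ (C i (j + 1) ↔ C (i + 1) (j + 1))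

theorem lo_hi (x : ℝ) : lo x = hi x ∨ hi x = lo x + 1 := by
  rcases int_or_between x with ⟨n, rfl⟩ | ⟨n, h1, h2⟩
  · right; rw [lo_int, hi_int]; ring
  · left; rw [lo_eq h1 h2.le, hi_eq h1.le h2]

variable {C : ℤ → ℤ → Prop}

theorem box_inter_openCells {z : ℝ × ℝ} {r : ℝ} (hs : Small z r) :
    box z r ∩ openCells C = quadSet z r (C (lo z.1) (lo z.2)) (C (hi z.1) (lo z.2))
      (C (lo z.1) (hi z.2)) (C (hi z.1) (hi z.2)) := by
  ext w
  change w ∈ box z r ∧ w ∈ openCells C ↔ w ∈ box z r ∧ _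
  refine and_congr_right fun hw => ?_
  obtain ⟨⟨h1, h2⟩, h3, h4⟩ := hs.2 w hw
  simp only [openCells, Set.mem_ofPred_eq]
  rcases lt_trichotomy w.1 z.1 with h | h | h <;> rcases lt_trichotomy w.2 z.2 with h' | h' | h'
  · simp [h1 h, h3 h', h.le, h'.le, h.not_ge, h'.not_ge]
  · simp [h1 h, h', h.le, h.not_ge]
  · simp [h1 h, h4 h', h.le, h'.le, h.not_ge, h'.not_ge]
  · simp [h, h3 h', h'.le, h'.not_ge]; tauto
  · simp [h, h']
  · simp [h, h4 h', h'.le, h'.not_ge]; tauto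
  · simp [h2 h, h3 h', h.le, h'.le, h.not_ge, h'.not_ge]
  · simp [h2 h, h', h.le, h.not_ge]
  · simp [h2 h, h4 h', h.le, h'.le, h.not_ge, h'.not_ge]

theorem compl_cellSet : (cellSet C)ᶜ = openCells fun i j => ¬ C i j := by
  ext z
  simp [cellSet, openCells, not_or]

theorem openCells_subset : openCells C ⊆ cellSet C := fun _ hz => Or.inl hz.1

theorem isOpen_openCells : IsOpen (openCells C) := by
  rw [isOpen_iff_forall_mem_open]
  intro z hz
  obtain ⟨r, hs, -⟩ := exists_small (z := z) univ_mem
  refine ⟨box z r, fun w hw => ?_, isOpen_box z r, mem_box hs.1⟩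
  have : w ∈ box z r ∩ openCells C := by
    rw [box_inter_openCells hs]
    exact ⟨hw, fun _ _ => hz.1, fun _ _ => hz.2.1, fun _ _ => hz.2.2.1, fun _ _ => hz.2.2.2⟩
  exact this.2

theorem isClosed_cellSet : IsClosed (cellSet C) := by
  rw [← isOpen_compl_iff, compl_cellSet]
  exact isOpen_openCells

/-- Every cell touching `z` has interior points near `z`. -/
theorem exists_near {z : ℝ × ℝ} {V : Set (ℝ × ℝ)} (hV : V ∈ 𝓝 z) {i j : ℤ}
    (hi' : i = lo z.1 ∨ i = hi z.1) (hj : j = lo z.2 ∨ j = hi z.2) :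
    ∃ w ∈ V, lo w.1 = i ∧ hi w.1 = i ∧ lo w.2 = j ∧ hi w.2 = j := by
  obtain ⟨r, ⟨hr, hs⟩, hrV⟩ := exists_small hV
  have hone : ∀ (x : ℝ) (i : ℤ), i = lo x ∨ i = hi x → ∃ t, t ∈ Ioo (x - r) (x + r) ∧
      ((t < x ∧ i = lo x) ∨ (x < t ∧ i = hi x)) := by
    rintro x i (h | h)
    · exact ⟨x - r / 2, ⟨by linarith, by linarith⟩, Or.inl ⟨by linarith, h⟩⟩
    · exact ⟨x + r / 2, ⟨by linarith, by linarith⟩, Or.inr ⟨by linarith, h⟩⟩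
  obtain ⟨s, hs1, hs2⟩ := hone z.1 i hi'
  obtain ⟨t, ht1, ht2⟩ := hone z.2 j hj
  have hmem : (s, t) ∈ box z r := ⟨hs1, ht1⟩
  obtain ⟨⟨h1, h2⟩, h3, h4⟩ := hs _ hmem
  refine ⟨(s, t), hrV hmem, ?_⟩
  rcases hs2 with ⟨h, rfl⟩ | ⟨h, rfl⟩ <;> rcases ht2 with ⟨h', rfl⟩ | ⟨h', rfl⟩
  · exact ⟨(h1 h).1, (h1 h).2, (h3 h').1, (h3 h').2⟩
  · exact ⟨(h1 h).1, (h1 h).2, (h4 h').1, (h4 h').2⟩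
  · exact ⟨(h2 h).1, (h2 h).2, (h3 h').1, (h3 h').2⟩
  · exact ⟨(h2 h).1, (h2 h).2, (h4 h').1, (h4 h').2⟩

theorem interior_cellSet : interior (cellSet C) = openCells C := by
  refine Subset.antisymm (fun z hz => ?_) (interior_maximal openCells_subset isOpen_openCells)
  have key : ∀ i j, (i = lo z.1 ∨ i = hi z.1) → (j = lo z.2 ∨ j = hi z.2) → C i j := by
    intro i j h h'
    obtain ⟨w, hw, h1, h2, h3, h4⟩ := exists_near (mem_interior_iff_mem_nhds.1 hz) h h'
    simpa [cellSet, h1, h2, h3, h4] using hw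
  exact ⟨key _ _ (Or.inl rfl) (Or.inl rfl), key _ _ (Or.inr rfl) (Or.inl rfl),
    key _ _ (Or.inl rfl) (Or.inr rfl), key _ _ (Or.inr rfl) (Or.inr rfl)⟩

theorem frontier_cellSet : frontier (cellSet C) = cellSet C \ openCells C := by
  rw [isClosed_cellSet.frontier_eq, interior_cellSet]

theorem cellSet_subset_closure : cellSet C ⊆ closure (openCells C) := by
  intro z hz
  rw [mem_closure_iff_nhds]
  intro V hV
  obtain ⟨i, j, h, h', hc⟩ : ∃ i j, (i = lo z.1 ∨ i = hi z.1) ∧ (j = lo z.2 ∨ j = hi z.2) ∧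
      C i j := by
    rcases hz with h | h | h | h
    · exact ⟨_, _, Or.inl rfl, Or.inl rfl, h⟩
    · exact ⟨_, _, Or.inr rfl, Or.inl rfl, h⟩
    · exact ⟨_, _, Or.inl rfl, Or.inr rfl, h⟩
    · exact ⟨_, _, Or.inr rfl, Or.inr rfl, h⟩
  obtain ⟨w, hw, h1, h2, h3, h4⟩ := exists_near hV h h'
  exact ⟨w, hw, by simp [openCells, h1, h2, h3, h4, hc]⟩

theorem not_checker (hC : NoChecker C) (z : ℝ × ℝ) :
    ¬ (C (lo z.1) (lo z.2) ∧ C (hi z.1) (hi z.2) ∧ ¬ C (hi z.1) (lo z.2) ∧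
      ¬ C (lo z.1) (hi z.2)) ∧
    ¬ (C (hi z.1) (lo z.2) ∧ C (lo z.1) (hi z.2) ∧ ¬ C (lo z.1) (lo z.2) ∧
      ¬ C (hi z.1) (hi z.2)) := by
  rcases lo_hi z.1 with h | h <;> rcases lo_hi z.2 with h' | h'
  · rw [h, h']; tauto
  · rw [h]; tauto
  · rw [h']; tauto
  · have := hC (lo z.1) (lo z.2)
    rw [h, h']; tauto

theorem isPreconnected_box_inter (hC : NoChecker C) {z : ℝ × ℝ} {r : ℝ} (hs : Small z r) :
    IsPreconnected (box z r ∩ openCells C) := by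
  rw [box_inter_openCells hs]
  exact isPreconnected_quadSet hs.1 (not_checker hC z).1 (not_checker hC z).2

theorem NoChecker.compl (hC : NoChecker C) : NoChecker fun i j => ¬ C i j := fun i j =>
  (hC i j).imp not_congr not_congr

theorem isCompact_cellSet (hfin : {c : ℤ × ℤ | C c.1 c.2}.Finite) : IsCompact (cellSet C) := by
  have hK : IsCompact (⋃ c ∈ {c : ℤ × ℤ | C c.1 c.2},
      Icc ((c.1 : ℝ), (c.2 : ℝ)) ((c.1 : ℝ) + 1, (c.2 : ℝ) + 1)) :=
    hfin.isCompact_biUnion fun c _ => isCompact_Icc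
  refine hK.of_isClosed_subset isClosed_cellSet fun z hz => ?_
  have h1 := lo_lt z.1
  have h2 := le_lo_add_one z.1
  have h3 := Int.floor_le z.1
  have h4 := Int.lt_floor_add_one z.1
  have h5 := lo_lt z.2
  have h6 := le_lo_add_one z.2
  have h7 := Int.floor_le z.2
  have h8 := Int.lt_floor_add_one z.2
  rcases hz with h | h | h | h
  · exact mem_biUnion (x := (lo z.1, lo z.2)) h ⟨⟨h1.le, h5.le⟩, h2, h6⟩
  · exact mem_biUnion (x := (hi z.1, lo z.2)) h ⟨⟨h3, h5.le⟩, h4.le, h6⟩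
  · exact mem_biUnion (x := (lo z.1, hi z.2)) h ⟨⟨h1.le, h7⟩, h2, h8.le⟩
  · exact mem_biUnion (x := (hi z.1, hi z.2)) h ⟨⟨h3, h7⟩, h4.le, h8.le⟩

theorem frontier_cellSet_int {z : ℝ × ℝ} (hz : z ∈ frontier (cellSet C)) :
    (∃ n : ℤ, z.1 = n) ∨ ∃ n : ℤ, z.2 = n := by
  by_contra! hcon
  obtain ⟨n, hn⟩ := (int_or_between z.1).resolve_left (by push Not; exact hcon.1)
  obtain ⟨m, hm⟩ := (int_or_between z.2).resolve_left (by push Not; exact hcon.2)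
  rw [frontier_cellSet] at hz
  simp [cellSet, openCells, lo_eq hn.1 hn.2.le, hi_eq hn.1.le hn.2, lo_eq hm.1 hm.2.le,
    hi_eq hm.1.le hm.2] at hz

theorem exists_sphere_finite (p : ℝ × ℝ) {ε : ℝ} (hε : 0 < ε) : ∃ r, 0 < r ∧ r < ε ∧
    (frontier (cellSet C) ∩ Metric.sphere p r).Finite := by
  set B : Set ℝ := range (fun n : ℤ => (n : ℝ) - p.1) ∪ range (fun n : ℤ => p.1 - n) ∪
    (range (fun n : ℤ => (n : ℝ) - p.2) ∪ range (fun n : ℤ => p.2 - n)) with hB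
  have hBc : B.Countable := ((countable_range _).union (countable_range _)).union
    ((countable_range _).union (countable_range _))
  obtain ⟨r, hr, hr0, hrε⟩ := (hBc.dense_compl ℝ).exists_between hε
  refine ⟨r, hr0, hrε, ?_⟩
  have hfin : ∀ x : ℝ, {t : ℝ | (∃ n : ℤ, t = n) ∧ |t - x| ≤ r}.Finite := by
    intro x
    refine ((Set.finite_Icc ⌊x - r⌋ ⌈x + r⌉).image (fun n : ℤ => (n : ℝ))).subset ?_
    rintro _ ⟨⟨n, rfl⟩, h⟩
    rw [abs_le] at h
    refine ⟨n, ⟨?_, ?_⟩, rfl⟩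
    · exact_mod_cast (Int.floor_le _).trans (by linarith : x - r ≤ n)
    · exact_mod_cast (by linarith : (n : ℝ) ≤ x + r).trans (Int.le_ceil _)
  have hpm : ∀ x : ℝ, ({x - r, x + r} : Set ℝ).Finite := fun x => by simp
  refine (((hpm p.1).prod (hfin p.2)).union ((hfin p.1).prod (hpm p.2))).subset ?_
  rintro ⟨s, t⟩ ⟨hz, hd⟩
  have hst := frontier_cellSet_int hz
  rw [Metric.mem_sphere, Prod.dist_eq, Real.dist_eq, Real.dist_eq] at hd
  dsimp only at hd hst
  have hle1 : |s - p.1| ≤ r := hd ▸ le_max_left _ _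
  have hle2 : |t - p.2| ≤ r := hd ▸ le_max_right _ _
  have hpm' : ∀ x u : ℝ, |u - x| = r → u = x - r ∨ u = x + r := by
    intro x u h
    rcases abs_cases (u - x) with ⟨h1, -⟩ | ⟨h1, -⟩
    · right; linarith
    · left; linarith
  have h1 : ∀ n : ℤ, s = n → |s - p.1| ≠ r := by
    rintro n rfl h
    refine hr (Or.inl ?_)
    rcases hpm' _ _ h with h | h
    · exact Or.inr ⟨n, by linarith⟩
    · exact Or.inl ⟨n, by linarith⟩
  have h2 : ∀ n : ℤ, t = n → |t - p.2| ≠ r := by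
    rintro n rfl h
    refine hr (Or.inr ?_)
    rcases hpm' _ _ h with h | h
    · exact Or.inr ⟨n, by linarith⟩
    · exact Or.inl ⟨n, by linarith⟩
  rcases max_choice |s - p.1| |t - p.2| with h | h
  · rw [h] at hd
    exact Or.inl ⟨hpm' _ _ hd, hst.resolve_left fun ⟨n, hn⟩ => h1 n hn hd, hle2⟩
  · rw [h] at hd
    exact Or.inr ⟨⟨hst.resolve_right fun ⟨n, hn⟩ => h2 n hn hd, hle1⟩, hpm' _ _ hd⟩

section CellArc

variable {C : ℤ → ℤ → Prop}

/-- Some but not all of the four cells around the lattice point `v` have index in `C`. -/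
def Mixed (C : ℤ → ℤ → Prop) (v : ℤ × ℤ) : Prop :=
  (C v.1 v.2 ∨ C (v.1 - 1) v.2 ∨ C (v.1 - 1) (v.2 - 1) ∨ C v.1 (v.2 - 1)) ∧
    ¬ (C v.1 v.2 ∧ C (v.1 - 1) v.2 ∧ C (v.1 - 1) (v.2 - 1) ∧ C v.1 (v.2 - 1))

/-- The boundary edge with `C` on its left that starts in the lattice point `v`. -/
def Leaves (C : ℤ → ℤ → Prop) (v d : ℤ × ℤ) : Prop :=
  (d = (1, 0) ∧ C v.1 v.2 ∧ ¬ C v.1 (v.2 - 1)) ∨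
    (d = (0, 1) ∧ C (v.1 - 1) v.2 ∧ ¬ C v.1 v.2) ∨
    (d = (-1, 0) ∧ C (v.1 - 1) (v.2 - 1) ∧ ¬ C (v.1 - 1) v.2) ∨
    (d = (0, -1) ∧ C v.1 (v.2 - 1) ∧ ¬ C (v.1 - 1) (v.2 - 1))

theorem Mixed.exists_leaves {v : ℤ × ℤ} (hv : Mixed C v) : ∃ d, Leaves C v d := by
  unfold Mixed at hv
  unfold Leaves
  by_cases h1 : C v.1 v.2 ∧ ¬ C v.1 (v.2 - 1)
  · exact ⟨_, Or.inl ⟨rfl, h1⟩⟩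
  by_cases h2 : C (v.1 - 1) v.2 ∧ ¬ C v.1 v.2
  · exact ⟨_, Or.inr (Or.inl ⟨rfl, h2⟩)⟩
  by_cases h3 : C (v.1 - 1) (v.2 - 1) ∧ ¬ C (v.1 - 1) v.2
  · exact ⟨_, Or.inr (Or.inr (Or.inl ⟨rfl, h3⟩))⟩
  · exact ⟨_, Or.inr (Or.inr (Or.inr ⟨rfl, by tauto⟩))⟩

theorem Leaves.mixed {v d : ℤ × ℤ} (h : Leaves C v d) : Mixed C v := by
  unfold Mixed
  rcases h with h | h | h | h <;> tauto

theorem NoChecker.at (hC : NoChecker C) (i j : ℤ) :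
    (C (i - 1) (j - 1) ↔ C i (j - 1)) ∨ (C (i - 1) j ↔ C i j) := by
  simpa using hC (i - 1) (j - 1)

theorem Leaves.unique (hC : NoChecker C) {v d d' : ℤ × ℤ} (h : Leaves C v d) (h' : Leaves C v d') :
    d = d' := by
  have := hC.at v.1 v.2
  rcases h with ⟨rfl, h⟩ | ⟨rfl, h⟩ | ⟨rfl, h⟩ | ⟨rfl, h⟩ <;>
    rcases h' with ⟨rfl, h'⟩ | ⟨rfl, h'⟩ | ⟨rfl, h'⟩ | ⟨rfl, h'⟩ <;> first | rfl | (exfalso; tauto)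

theorem Leaves.mixed_add {v d : ℤ × ℤ} (h : Leaves C v d) : Mixed C (v + d) := by
  obtain ⟨i, j⟩ := v
  unfold Mixed
  rcases h with ⟨rfl, h⟩ | ⟨rfl, h⟩ | ⟨rfl, h⟩ | ⟨rfl, h⟩ <;>
    simp only [Prod.mk_add_mk, add_sub_cancel_right, add_zero, ← sub_eq_add_neg] at h ⊢ <;> tauto

theorem Leaves.eq_of_add_eq (hC : NoChecker C) {v d v' d' : ℤ × ℤ} (h : Leaves C v d)
    (h' : Leaves C v' d') (he : v + d = v' + d') : v = v' := by
  obtain ⟨i, j⟩ := v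
  obtain ⟨i', j'⟩ := v'
  have h0 := hC.at (i + d.1) (j + d.2)
  rcases h with ⟨rfl, h⟩ | ⟨rfl, h⟩ | ⟨rfl, h⟩ | ⟨rfl, h⟩ <;>
    rcases h' with ⟨rfl, h'⟩ | ⟨rfl, h'⟩ | ⟨rfl, h'⟩ | ⟨rfl, h'⟩ <;>
    simp only [Prod.mk_add_mk, Prod.mk.injEq] at he h h' h0 ⊢ <;> grind

theorem int_add_eq {m n : ℤ} {s t : ℝ} (hs : s ∈ Ico (0 : ℝ) 1) (ht : t ∈ Ico (0 : ℝ) 1)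
    (h : (m : ℝ) + s = n + t) : m = n ∧ s = t := by
  have h1 : m < n + 1 := by exact_mod_cast (by linarith [hs.1, ht.2] : (m : ℝ) < n + 1)
  have h2 : n < m + 1 := by exact_mod_cast (by linarith [hs.2, ht.1] : (n : ℝ) < m + 1)
  obtain rfl : m = n := by omega
  exact ⟨rfl, by linarith⟩

theorem int_add_eq_sub {m n : ℤ} {s t : ℝ} (hs : s ∈ Ico (0 : ℝ) 1) (ht : t ∈ Ico (0 : ℝ) 1)
    (h : (m : ℝ) + s = n - t) : n = m + 1 ∨ (m = n ∧ s = 0 ∧ t = 0) := by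
  have h1 : m < n + 1 := by exact_mod_cast (by linarith [hs.1, ht.1] : (m : ℝ) < n + 1)
  have h2 : n < m + 2 := by exact_mod_cast (by linarith [hs.2, ht.2] : (n : ℝ) < m + 2)
  rcases (by omega : n = m + 1 ∨ m = n) with h3 | rfl
  · exact Or.inl h3
  · exact Or.inr ⟨rfl, by linarith [hs.1, ht.1], by linarith [hs.1, ht.1]⟩

theorem int_sub_eq {m n : ℤ} {s t : ℝ} (hs : s ∈ Ico (0 : ℝ) 1) (ht : t ∈ Ico (0 : ℝ) 1)
    (h : (m : ℝ) - s = n - t) : m = n ∧ s = t := by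
  obtain ⟨h1, h2⟩ := int_add_eq (m := m) (n := n) ht hs (by linarith)
  exact ⟨h1, h2.symm⟩

theorem Leaves.inj {v d v' d' : ℤ × ℤ} (h : Leaves C v d)
    (h' : Leaves C v' d') {s t : ℝ} (hs : s ∈ Ico (0 : ℝ) 1) (ht : t ∈ Ico (0 : ℝ) 1)
    (h1 : (v.1 : ℝ) + s * d.1 = v'.1 + t * d'.1) (h2 : (v.2 : ℝ) + s * d.2 = v'.2 + t * d'.2) :
    v = v' ∧ s = t := by
  obtain ⟨i, j⟩ := v
  obtain ⟨i', j'⟩ := v'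
  have h0 : (0 : ℝ) ∈ Ico (0 : ℝ) 1 := ⟨le_rfl, one_pos⟩
  have a1 : ∀ {m n : ℤ}, (m : ℝ) + s = n → m = n ∧ s = 0 := fun h => int_add_eq hs h0 (by simpa)
  have a2 : ∀ {m n : ℤ}, (m : ℝ) = n + t → m = n ∧ 0 = t := fun h => int_add_eq h0 ht (by simpa)
  have a3 : ∀ {m n : ℤ}, (m : ℝ) - s = n → m = n ∧ s = 0 := fun h => int_sub_eq hs h0 (by simpa)
  have a4 : ∀ {m n : ℤ}, (m : ℝ) = n - t → m = n ∧ 0 = t := fun h => int_sub_eq h0 ht (by simpa)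
  have a5 : ∀ {m n : ℤ}, (m : ℝ) + s = n + t → m = n ∧ s = t := int_add_eq hs ht
  have a6 : ∀ {m n : ℤ}, (m : ℝ) - s = n - t → m = n ∧ s = t := int_sub_eq hs ht
  have a7 : ∀ {m n : ℤ}, (m : ℝ) + s = n - t → n = m + 1 ∨ (m = n ∧ s = 0 ∧ t = 0) :=
    int_add_eq_sub hs ht
  have a8 : ∀ {m n : ℤ}, (m : ℝ) - s = n + t → m = n + 1 ∨ (n = m ∧ t = 0 ∧ s = 0) :=
    fun h => int_add_eq_sub ht hs h.symm
  rcases h with ⟨rfl, h⟩ | ⟨rfl, h⟩ | ⟨rfl, h⟩ | ⟨rfl, h⟩ <;>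
    rcases h' with ⟨rfl, h'⟩ | ⟨rfl, h'⟩ | ⟨rfl, h'⟩ | ⟨rfl, h'⟩ <;>
    simp only [Int.cast_zero, Int.cast_one, Int.cast_neg, mul_zero, mul_one, mul_neg, add_zero,
      ← sub_eq_add_neg, Int.cast_inj, Prod.mk.injEq] at h1 h2 h h' ⊢ <;>
    first
      | (have := a5 h1; tauto)
      | (have := a5 h2; tauto)
      | (have := a6 h1; tauto)
      | (have := a6 h2; tauto)
      | (have hk := a7 h1; rcases hk with hh | hh <;> grind)
      | (have hk := a7 h2; rcases hk with hh | hh <;> grind)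
      | (have hk := a8 h1; rcases hk with hh | hh <;> grind)
      | (have hk := a8 h2; rcases hk with hh | hh <;> grind)
      | (have := a1 h1; have := a2 h2; grind)
      | (have := a1 h1; have := a4 h2; grind)
      | (have := a2 h1; have := a1 h2; grind)
      | (have := a4 h1; have := a1 h2; grind)
      | (have := a3 h1; have := a2 h2; grind)
      | (have := a3 h1; have := a4 h2; grind)
      | (have := a2 h1; have := a3 h2; grind)
      | (have := a4 h1; have := a3 h2; grind)

theorem finite_mixed (hfin : {c : ℤ × ℤ | C c.1 c.2}.Finite) : {v | Mixed C v}.Finite := by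
  set F := {c : ℤ × ℤ | C c.1 c.2}
  refine ((hfin.union (hfin.image (· + ((1, 0) : ℤ × ℤ)))).union
    ((hfin.image (· + ((1, 1) : ℤ × ℤ))).union (hfin.image (· + ((0, 1) : ℤ × ℤ))))).subset ?_
  rintro ⟨i, j⟩ ⟨h | h | h | h, -⟩
  · exact Or.inl (Or.inl h)
  · exact Or.inl (Or.inr ⟨(i - 1, j), h, by simp⟩)
  · exact Or.inr (Or.inl ⟨(i - 1, j - 1), h, by simp⟩)
  · exact Or.inr (Or.inr ⟨(i, j - 1), h, by simp⟩)

theorem mem_frontier_iff {z : ℝ × ℝ} : z ∈ frontier (cellSet C) ↔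
    ∃ v d : ℤ × ℤ, Leaves C v d ∧ ∃ t ∈ Ico (0 : ℝ) 1, z = (v.1 + t * d.1, v.2 + t * d.2) := by
  rw [frontier_cellSet]
  constructor
  · intro hz
    rcases int_or_between z.1 with ⟨i, hi⟩ | ⟨i, hi, hi'⟩ <;>
      rcases int_or_between z.2 with ⟨j, hj⟩ | ⟨j, hj, hj'⟩
    · have : Mixed C (i, j) := by
        simp only [cellSet, openCells, hi, hj, lo_int, hi_int, Set.mem_sdiff,
          Set.mem_ofPred_eq] at hz
        unfold Mixed
        tauto
      obtain ⟨d, hd⟩ := this.exists_leaves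
      exact ⟨_, d, hd, 0, ⟨le_rfl, one_pos⟩, by ext <;> simp [hi, hj]⟩
    · simp only [cellSet, openCells, hi, lo_int, hi_int, lo_eq hj hj'.le, hi_eq hj.le hj',
        Set.mem_sdiff, Set.mem_ofPred_eq] at hz
      by_cases h : C i j
      · refine ⟨(i, j + 1), (0, -1), Or.inr (Or.inr (Or.inr ⟨rfl, ?_⟩)), j + 1 - z.2,
          ⟨by linarith, by linarith⟩, ?_⟩
        · simp only [add_sub_cancel_right]; tauto
        · ext <;> simp [hi]
      · refine ⟨(i, j), (0, 1), Or.inr (Or.inl ⟨rfl, ?_⟩), z.2 - j,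
          ⟨by linarith, by linarith⟩, ?_⟩
        · dsimp only; tauto
        · ext <;> simp [hi]
    · simp only [cellSet, openCells, hj, lo_int, hi_int, lo_eq hi hi'.le, hi_eq hi.le hi',
        Set.mem_sdiff, Set.mem_ofPred_eq] at hz
      by_cases h : C i j
      · refine ⟨(i, j), (1, 0), Or.inl ⟨rfl, ?_⟩, z.1 - i,
          ⟨by linarith, by linarith⟩, ?_⟩
        · dsimp only; tauto
        · ext <;> simp [hj]
      · refine ⟨(i + 1, j), (-1, 0), Or.inr (Or.inr (Or.inl ⟨rfl, ?_⟩)), i + 1 - z.1,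
          ⟨by linarith, by linarith⟩, ?_⟩
        · simp only [add_sub_cancel_right]; tauto
        · ext <;> simp [hj]
    · simp only [cellSet, openCells, lo_eq hi hi'.le, hi_eq hi.le hi', lo_eq hj hj'.le,
        hi_eq hj.le hj', Set.mem_sdiff, Set.mem_ofPred_eq] at hz
      tauto
  · rintro ⟨⟨i, j⟩, d, hd, t, ht, rfl⟩
    rcases ht.1.eq_or_lt with rfl | ht0
    · have := hd.mixed
      simp only [Mixed] at this
      simp only [cellSet, openCells, zero_mul, add_zero, lo_int, hi_int, Set.mem_sdiff,
        Set.mem_ofPred_eq]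
      tauto
    have ht1 := ht.2
    have l1 : ∀ m : ℤ, lo ((m : ℝ) + t) = m := fun m => lo_eq (by linarith) (by linarith)
    have l2 : ∀ m : ℤ, hi ((m : ℝ) + t) = m := fun m => hi_eq (by linarith) (by linarith)
    have l3 : ∀ m : ℤ, lo ((m : ℝ) - t) = m - 1 := fun m =>
      lo_eq (by push_cast; linarith) (by push_cast; linarith)
    have l4 : ∀ m : ℤ, hi ((m : ℝ) - t) = m - 1 := fun m =>
      hi_eq (by push_cast; linarith) (by push_cast; linarith)
    rcases hd with ⟨rfl, h⟩ | ⟨rfl, h⟩ | ⟨rfl, h⟩ | ⟨rfl, h⟩ <;>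
      simp only [Int.cast_zero, Int.cast_one, Int.cast_neg, mul_zero, mul_one, mul_neg, add_zero,
        ← sub_eq_add_neg, cellSet, openCells, lo_int, hi_int, l1, l2, l3, l4, Set.mem_sdiff,
        Set.mem_ofPred_eq] at h ⊢ <;> tauto

theorem exists_arc_cellSet (hC : NoChecker C) (hfin : {c : ℤ × ℤ | C c.1 c.2}.Finite)
    {U : Set (ℝ × ℝ)} (hU : IsOpen U) {y : ℝ × ℝ} (hy : y ∈ frontier (cellSet C) ∩ U)
    (hnot : ¬ connectedComponentIn (frontier (cellSet C)) y ⊆ U) :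
    ∃ g : ℝ → ℝ × ℝ, ContinuousOn g (Icc 0 1) ∧ InjOn g (Ioo 0 1) ∧
      g '' Ioo 0 1 = connectedComponentIn (frontier (cellSet C) ∩ U) y ∧ g 0 ∉ U ∧ g 1 ∉ U := by
  have hV : Finite {v // Mixed C v} := (finite_mixed hfin).to_subtype
  choose dir hdir using fun v : {v // Mixed C v} => v.2.exists_leaves
  have hinj : Function.Injective fun v : {v // Mixed C v} =>
      (⟨v.1 + dir v, (hdir v).mixed_add⟩ : {v // Mixed C v}) := fun v w h =>
    Subtype.ext ((hdir v).eq_of_add_eq hC (hdir w) (congrArg Subtype.val h))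
  set σ : Equiv.Perm {v // Mixed C v} := Equiv.ofBijective _ (Finite.injective_iff_bijective.1 hinj)
    with hσ
  have hσv : ∀ v, (σ v).1 = v.1 + dir v := fun v => rfl
  have hseg : ∀ v t, segPt σ (fun v : {v // Mixed C v} => ((v.1.1 : ℝ), (v.1.2 : ℝ))) v t =
      (v.1.1 + t * (dir v).1, v.1.2 + t * (dir v).2) := by
    intro v t
    ext <;> simp [segPt, hσv]
  refine exists_arc_of_loops (σ := σ)
    (p := fun v : {v // Mixed C v} => ((v.1.1 : ℝ), (v.1.2 : ℝ))) ?_ ?_ hU hy hnot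
  · intro v v' s t hs ht h
    rw [hseg, hseg, Prod.mk.injEq] at h
    obtain ⟨h1, h2⟩ := (hdir v).inj (hdir v') hs ht h.1 h.2
    exact ⟨Subtype.ext h1, h2⟩
  · intro z
    simp only [hseg]
    rw [mem_frontier_iff]
    constructor
    · rintro ⟨v, d, hd, t, ht, rfl⟩
      exact ⟨⟨v, hd.mixed⟩, t, ht, by rw [(hdir ⟨v, hd.mixed⟩).unique hC hd]⟩
    · rintro ⟨v, t, ht, rfl⟩
      exact ⟨_, _, hdir v, t, ht, rfl⟩

theorem niceSet_cellSet (hC : NoChecker C) (hfin : {c : ℤ × ℤ | C c.1 c.2}.Finite) :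
    NiceSet (cellSet C) where
  closed := isClosed_cellSet
  compactFr := (isCompact_cellSet hfin).of_isClosed_subset isClosed_frontier
    isClosed_cellSet.frontier_subset
  dense := fun z hz => by
    rw [interior_cellSet]
    exact cellSet_subset_closure (isClosed_cellSet.frontier_subset hz)
  loc := fun z _ V hV => by
    obtain ⟨r, hs, hr⟩ := exists_small hV
    refine ⟨box z r, isOpen_box z r, mem_box hs.1, hr, ?_, ?_⟩
    · rw [interior_cellSet]
      exact isPreconnected_box_inter hC hs
    · rw [sdiff_eq, compl_cellSet]
      exact isPreconnected_box_inter hC.compl hs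
  sph := fun p ε hε => exists_sphere_finite p hε
  arc := fun _ hU _ hy hnot => exists_arc_cellSet hC hfin hU hy hnot

end CellArc

theorem NiceSet.smul {Q : Set (ℝ × ℝ)} (hQ : NiceSet Q) {δ : ℝ} (hδ : 0 < δ) :
    NiceSet (Homeomorph.smulOfNeZero δ hδ.ne' '' Q) := by
  have hf : ∀ w : ℝ × ℝ, Homeomorph.smulOfNeZero δ hδ.ne' w = δ • w := fun _ => rfl
  set f : (ℝ × ℝ) ≃ₜ (ℝ × ℝ) := Homeomorph.smulOfNeZero δ hδ.ne'
  refine ⟨f.isClosed_image.2 hQ.closed, ?_, ?_, ?_, ?_, ?_⟩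
  · rw [← f.image_frontier]
    exact hQ.compactFr.image f.continuous
  · rw [← f.image_frontier, ← f.image_interior, ← f.image_closure]
    rintro _ ⟨w, hw, rfl⟩
    exact mem_image_of_mem f (hQ.dense w hw)
  · rw [← f.image_frontier, ← f.image_interior]
    rintro _ ⟨w, hw, rfl⟩ V hV
    obtain ⟨N, hN, hwN, hNV, h1, h2⟩ := hQ.loc w hw _ (f.continuous.continuousAt.preimage_mem_nhds hV)
    refine ⟨f '' N, f.isOpen_image.2 hN, mem_image_of_mem f hwN, image_subset_iff.2 hNV, ?_, ?_⟩
    · rw [← image_inter f.injective]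
      exact h1.image f f.continuous.continuousOn
    · rw [← image_sdiff f.injective]
      exact h2.image f f.continuous.continuousOn
  · intro p ε hε
    obtain ⟨r, hr, hrε, hfin⟩ := hQ.sph (δ⁻¹ • p) (δ⁻¹ * ε) (by positivity)
    refine ⟨δ * r, by positivity, by rwa [lt_inv_mul_iff₀ hδ] at hrε, (hfin.image f).subset ?_⟩
    rw [← f.image_frontier]
    rintro _ ⟨⟨w, hw, rfl⟩, hs⟩
    refine ⟨w, ⟨hw, ?_⟩, rfl⟩
    rw [Metric.mem_sphere] at hs ⊢
    have hp : p = δ • δ⁻¹ • p := (smul_inv_smul₀ hδ.ne' p).symm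
    rw [hf, hp, dist_smul₀, Real.norm_of_nonneg hδ.le] at hs
    exact mul_left_cancel₀ hδ.ne' hs
  · rw [← f.image_frontier]
    rintro U hU _ ⟨⟨x, hx, rfl⟩, hxU⟩ hnot
    rw [← f.image_connectedComponentIn hx, image_subset_iff] at hnot
    obtain ⟨g, hg, hinj, him, h0, h1⟩ := hQ.arc _ (hU.preimage f.continuous) x ⟨hx, hxU⟩ hnot
    refine ⟨f ∘ g, f.continuous.comp_continuousOn hg, f.injective.comp_injOn hinj, ?_, h0, h1⟩
    rw [image_comp, him, f.image_connectedComponentIn (show x ∈ frontier Q ∩ f ⁻¹' U from ⟨hx, hxU⟩),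
      image_inter f.injective, f.image_preimage]

/-- The cells whose brick, in a staggered brick pattern, is close to `L`. -/
def brickCells (L : Set (ℝ × ℝ)) (i j : ℤ) : Prop :=
  ∃ z ∈ L, |z.1 - (2 * ((i + j) / 2) - j : ℤ)| ≤ 3 ∧ |z.2 - j| ≤ 2

theorem noChecker_brickCells (L : Set (ℝ × ℝ)) : NoChecker (brickCells L) := by
  intro i j
  unfold brickCells
  rcases Int.even_or_odd (i + j) with ⟨k, hk⟩ | ⟨k, hk⟩
  · left
    rw [show (i + 1 + j) / 2 = (i + j) / 2 by omega]
  · right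
    rw [show (i + 1 + (j + 1)) / 2 = (i + (j + 1)) / 2 by omega]

theorem brick_near (i j : ℤ) : |(i : ℝ) - (2 * ((i + j) / 2) - j : ℤ)| ≤ 1 := by
  have : |i - (2 * ((i + j) / 2) - j)| ≤ 1 := by rw [abs_le]; omega
  exact_mod_cast this

theorem brickCells_of_near {L : Set (ℝ × ℝ)} {z : ℝ × ℝ} (hz : z ∈ L) {i j : ℤ}
    (hi : |z.1 - i| ≤ 2) (hj : |z.2 - j| ≤ 2) : brickCells L i j :=
  ⟨z, hz, (abs_sub_le _ (i : ℝ) _).trans (by linarith [brick_near i j]), hj⟩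

theorem brickCells.exists_near {L : Set (ℝ × ℝ)} {i j : ℤ} (h : brickCells L i j) :
    ∃ z ∈ L, |z.1 - i| ≤ 4 ∧ |z.2 - j| ≤ 2 := by
  obtain ⟨z, hz, h1, h2⟩ := h
  refine ⟨z, hz, (abs_sub_le _ ((2 * ((i + j) / 2) - j : ℤ) : ℝ) _).trans ?_, h2⟩
  have := brick_near i j
  rw [abs_sub_comm] at this
  linarith

theorem finite_brickCells {L : Set (ℝ × ℝ)} (hL : Bornology.IsBounded L) :
    {c : ℤ × ℤ | brickCells L c.1 c.2}.Finite := by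
  obtain ⟨M, hM⟩ := hL.exists_norm_le
  obtain ⟨n, hn⟩ := exists_nat_ge (M + 4)
  refine ((Set.finite_Icc (-(n : ℤ)) n).prod (Set.finite_Icc (-(n : ℤ)) n)).subset ?_
  rintro ⟨i, j⟩ h
  obtain ⟨z, hz, h1, h2⟩ := brickCells.exists_near h
  have h3 := (norm_fst_le z).trans (hM z hz)
  have h4 := (norm_snd_le z).trans (hM z hz)
  rw [Real.norm_eq_abs] at h3 h4
  rw [abs_le] at h1 h2 h3 h4
  refine ⟨⟨?_, ?_⟩, ?_, ?_⟩ <;> dsimp only at *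
  · exact_mod_cast (by linarith [h1.2, h3.1] : (-(n : ℝ)) ≤ i)
  · exact_mod_cast (by linarith [h1.1, h3.2] : (i : ℝ) ≤ n)
  · exact_mod_cast (by linarith [h2.2, h4.1] : (-(n : ℝ)) ≤ j)
  · exact_mod_cast (by linarith [h2.1, h4.2] : (j : ℝ) ≤ n)

theorem abs_sub_lo_le (x : ℝ) : |x - lo x| ≤ 1 := by
  rw [abs_le]
  constructor <;> linarith [lo_lt x, le_lo_add_one x]

theorem abs_sub_hi_le (x : ℝ) : |x - hi x| ≤ 1 := by
  have h1 : (hi x : ℝ) ≤ x := Int.floor_le x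
  have h2 : x < hi x + 1 := Int.lt_floor_add_one x
  rw [abs_le]
  constructor <;> linarith

theorem subset_openCells_brickCells (L : Set (ℝ × ℝ)) : L ⊆ openCells (brickCells L) := by
  intro z hz
  have h1 := abs_sub_lo_le z.1
  have h2 := abs_sub_hi_le z.1
  have h3 := abs_sub_lo_le z.2
  have h4 := abs_sub_hi_le z.2
  refine ⟨?_, ?_, ?_, ?_⟩ <;> exact brickCells_of_near hz (by linarith) (by linarith)

theorem exists_near_of_mem_cellSet {L : Set (ℝ × ℝ)} {w : ℝ × ℝ}
    (hw : w ∈ cellSet (brickCells L)) : ∃ z ∈ L, dist w z ≤ 5 := by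
  obtain ⟨i, j, h1, h2, h⟩ : ∃ i j : ℤ, |w.1 - i| ≤ 1 ∧ |w.2 - j| ≤ 1 ∧ brickCells L i j := by
    rcases hw with h | h | h | h
    · exact ⟨_, _, abs_sub_lo_le _, abs_sub_lo_le _, h⟩
    · exact ⟨_, _, abs_sub_hi_le _, abs_sub_lo_le _, h⟩
    · exact ⟨_, _, abs_sub_lo_le _, abs_sub_hi_le _, h⟩
    · exact ⟨_, _, abs_sub_hi_le _, abs_sub_hi_le _, h⟩
  obtain ⟨z, hz, h3, h4⟩ := h.exists_near
  refine ⟨z, hz, ?_⟩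
  rw [Prod.dist_eq, Real.dist_eq, Real.dist_eq, max_le_iff]
  rw [abs_le] at h1 h2 h3 h4
  constructor <;> rw [abs_le] <;> constructor <;>
    linarith [h1.1, h1.2, h2.1, h2.2, h3.1, h3.2, h4.1, h4.2]

theorem exists_niceSet {L O : Set (ℝ × ℝ)} (hL : IsCompact L) (hO : IsOpen O) (hLO : L ⊆ O) :
    ∃ K, NiceSet K ∧ IsCompact K ∧ L ⊆ interior K ∧ K ⊆ O := by
  obtain ⟨ε, hε, hεO⟩ := hL.exists_thickening_subset_open hO hLO
  have hδ : 0 < ε / 6 := by positivity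
  have hf : ∀ w : ℝ × ℝ, Homeomorph.smulOfNeZero (ε / 6) hδ.ne' w = (ε / 6) • w := fun _ => rfl
  have hs := fun C (hC : NoChecker C) hfin => (niceSet_cellSet hC hfin).smul hδ
  set f : (ℝ × ℝ) ≃ₜ (ℝ × ℝ) := Homeomorph.smulOfNeZero (ε / 6) hδ.ne'
  have hL' : IsCompact (f ⁻¹' L) := f.isCompact_preimage.2 hL
  have hfin := finite_brickCells hL'.isBounded
  refine ⟨_, hs _ (noChecker_brickCells (f ⁻¹' L)) hfin,
    (isCompact_cellSet hfin).image f.continuous, ?_, ?_⟩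
  · rw [← f.image_interior, interior_cellSet]
    exact (f.image_preimage L).symm.subset.trans (image_mono (subset_openCells_brickCells _))
  · rintro _ ⟨w, hw, rfl⟩
    obtain ⟨z, hz, hd⟩ := exists_near_of_mem_cellSet hw
    refine hεO (Metric.mem_thickening_iff.2 ⟨f z, hz, ?_⟩)
    rw [hf, hf, dist_smul₀, Real.norm_of_nonneg hδ.le]
    linarith [mul_le_mul_of_nonneg_left hd hδ.le]

theorem NiceSet.closure_interior {K : Set (ℝ × ℝ)} (hK : NiceSet K) : closure (interior K) = K := by
  apply Subset.antisymm (closure_minimal interior_subset hK.closed)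
  intro z hz
  by_cases hi : z ∈ interior K
  · exact subset_closure hi
  · exact hK.dense z ⟨subset_closure hz, hi⟩

theorem NiceSet.interior_compl_interior {K : Set (ℝ × ℝ)} (hK : NiceSet K) :
    interior (interior K)ᶜ = Kᶜ := by
  rw [interior_compl, hK.closure_interior]

theorem NiceSet.frontier_compl_interior {K : Set (ℝ × ℝ)} (hK : NiceSet K) :
    frontier (interior K)ᶜ = frontier K := by
  rw [frontier_compl, frontier, hK.closure_interior, interior_interior, hK.closed.frontier_eq]

theorem NiceSet.compl_interior {K : Set (ℝ × ℝ)} (hK : NiceSet K) : NiceSet (interior K)ᶜ where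
  closed := isOpen_interior.isClosed_compl
  compactFr := by rw [hK.frontier_compl_interior]; exact hK.compactFr
  dense := by
    rw [hK.frontier_compl_interior, hK.interior_compl_interior]
    intro z hz
    rw [frontier_eq_closure_inter_closure] at hz
    exact hz.2
  loc := by
    rw [hK.frontier_compl_interior, hK.interior_compl_interior]
    intro z hz V hV
    obtain ⟨N, h1, h2, h3, h4, h5⟩ := hK.loc z hz V hV
    refine ⟨N, h1, h2, h3, h5, ?_⟩
    rwa [sdiff_compl]
  sph := by rw [hK.frontier_compl_interior]; exact hK.sph
  arc := by rw [hK.frontier_compl_interior]; exact hK.arc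

section Catch

variable {U : Set (ℝ × ℝ)} {u : ℝ × ℝ} {𝓕 : Ultrafilter (ℝ × ℝ)}

theorem inter_interior_subset {Q : Set (ℝ × ℝ)} :
    U ∩ interior Q ⊆ U \ closure (mainComp U Q u) := fun x hx => ⟨hx.1, fun h =>
  Set.eq_empty_iff_forall_notMem.1 closure_mainComp_inter_interior x ⟨h, hx.2⟩⟩

/-- If no door of `Q` is caught by the ultrafilter, the doors shrink to a point outside `U`. -/
theorem doors_shrink (hU : IsOpen U) (hUc : IsPreconnected U) (hUu : Unicoh U)
    {Q : Set (ℝ × ℝ)} (hQ : NiceSet Q) (hu : u ∈ U \ Q)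
    (hmem : U \ closure (mainComp U Q u) ∈ 𝓕)
    (hno : ∀ A, IsDoor U Q u A → A ∉ 𝓕) :
    ∃ p ∉ U, ∀ V, IsOpen V → p ∈ V →
      ∀ᶠ x in (𝓕 : Filter (ℝ × ℝ)),
        bdIn U (connectedComponentIn (U \ closure (mainComp U Q u)) x) ⊆ V := by
  set O := U \ closure (mainComp U Q u) with hO
  have hdoor : ∀ x ∈ O, IsDoor U Q u (connectedComponentIn O x) := fun x hx => isDoor_of_mem hx
  have hex : ∀ x, ∃ y, x ∈ O → y ∈ bdIn U (connectedComponentIn O x) := by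
    intro x
    by_cases hx : x ∈ O
    · obtain ⟨y, hy⟩ := (hdoor x hx).bd_nonempty hU hUc hu
      exact ⟨y, fun _ => hy⟩
    · exact ⟨x, fun h => absurd h hx⟩
  choose y hy using hex
  have hconst : ∀ A, IsDoor U Q u A →
      ¬ ∀ᶠ x in (𝓕 : Filter (ℝ × ℝ)), x ∈ O ∧ connectedComponentIn O x = A := by
    intro A hA h
    refine hno A hA (mem_of_superset h ?_)
    rintro x ⟨hx, rfl⟩
    exact mem_connectedComponentIn hx
  have hyΓ : ∀ᶠ x in (𝓕 : Filter (ℝ × ℝ)), y x ∈ frontier Q ∩ closure (mainComp U Q u) := by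
    filter_upwards [hmem] with x hx
    exact ⟨((hdoor x hx).bd_subset hU hQ (hy x hx)).1, (hdoor x hx).bd_subset_closure (hy x hx)⟩
  obtain ⟨p, hp, hpl⟩ := (hQ.compactFr.inter_right isClosed_closure).ultrafilter_le_nhds
    (𝓕.map y) (le_principal_iff.2 hyΓ)
  have hev : ∀ V, IsOpen V → p ∈ V → ∀ᶠ x in (𝓕 : Filter (ℝ × ℝ)), y x ∈ V :=
    fun V hV hpV => hpl (hV.mem_nhds hpV)
  refine ⟨p, fun hpU => ?_, fun V hV hpV => ?_⟩
  · obtain ⟨N, hNo, hpN, -, -, ⟨z, hz⟩, -, -, h⟩ := door_local hU hQ hp.2 ⟨hp.1, hpU⟩ univ_mem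
    have h1 : ∀ᶠ x in (𝓕 : Filter (ℝ × ℝ)), x ∈ O ∧ z ∈ connectedComponentIn O x := by
      filter_upwards [hmem, hev N hNo hpN] with x hx hxN
      have m := mem_closure_iff.1 (hy x hx).1.1 N hNo hxN
      rw [inter_comm] at m
      exact ⟨hx, (h _ (hdoor x hx) m).1 hz⟩
    obtain ⟨x0, hx0⟩ := h1.exists
    refine hconst _ (hdoor x0 hx0.1) ?_
    filter_upwards [h1] with x hx
    exact ⟨hx.1, (hdoor x hx.1).eq_of_mem_mem (hdoor x0 hx0.1) hx.2 hx0.2⟩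
  · by_contra hcon
    rw [Ultrafilter.eventually_not.symm] at hcon
    obtain ⟨ε, hε, hεV⟩ := Metric.isOpen_iff.1 hV p hpV
    obtain ⟨r, hr0, hrε, hfin⟩ := hQ.sph p ε hε
    have h1 : ∀ᶠ x in (𝓕 : Filter (ℝ × ℝ)), x ∈ ⋃ s ∈ frontier Q ∩ Metric.sphere p r,
        {x | x ∈ O ∧ s ∈ bdIn U (connectedComponentIn O x)} := by
      filter_upwards [hmem, hcon, hev _ Metric.isOpen_ball (Metric.mem_ball_self hr0)]
        with x hx hxV hxB
      simp only [mem_iUnion, exists_prop]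
      by_contra hcc
      push Not at hcc
      refine hxV (Subset.trans ?_ ((Metric.ball_subset_ball hrε.le).trans hεV))
      refine subset_of_inter_bd_empty
        ((hdoor x hx).isCut hU hUc hUu hu).bd_conn.isPreconnected Metric.isOpen_ball
        ⟨y x, hy x hx, hxB⟩ fun s hs hsc => ?_
      by_contra hsb
      have : s ∈ Metric.sphere p r := by
        have h2 := Metric.closure_ball_subset_closedBall hsc
        rw [Metric.mem_sphere]
        rw [Metric.mem_closedBall] at h2
        rw [Metric.mem_ball, not_lt] at hsb
        exact le_antisymm h2 hsb
      exact hcc s ⟨((hdoor x hx).bd_subset hU hQ hs).1, this⟩ ⟨hx, hs⟩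
    obtain ⟨s, hs, hsF⟩ := (Ultrafilter.finite_biUnion_mem_iff hfin).1 h1
    obtain ⟨x0, hx0⟩ := 𝓕.nonempty_of_mem hsF
    refine hconst _ (hdoor x0 hx0.1) ?_
    filter_upwards [hsF] with x hx
    exact ⟨hx.1, (hdoor x hx.1).eq_of_bd_inter hU hQ (hdoor x0 hx0.1) hx.2 hx0.2⟩

/-- A nice finite cover of the complement of `U` catches every ultrafilter on `U`. -/
theorem exists_door_mem (hU : IsOpen U) (hUc : IsPreconnected U) (hUu : Unicoh U)
    (hU𝓕 : U ∈ 𝓕) {𝒬 : Set (Set (ℝ × ℝ))} (hfin : 𝒬.Finite) (hnice : ∀ Q ∈ 𝒬, NiceSet Q)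
    (hu : ∀ Q ∈ 𝒬, u ∈ U \ Q) (hcov : ∀ p ∉ U, ∃ Q ∈ 𝒬, p ∈ interior Q)
    (h𝓕 : ∃ Q ∈ 𝒬, interior Q ∈ 𝓕) :
    ∃ Q ∈ 𝒬, ∃ A, IsDoor U Q u A ∧ A ∈ 𝓕 := by
  by_contra hno
  push Not at hno
  let O : Set (ℝ × ℝ) → Set (ℝ × ℝ) := fun Q => U \ closure (mainComp U Q u)
  let J := {Q ∈ 𝒬 | O Q ∈ 𝓕}
  have hJne : J.Nonempty := by
    obtain ⟨Q, hQ, hQ𝓕⟩ := h𝓕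
    exact ⟨Q, hQ, mem_of_superset (inter_mem hU𝓕 hQ𝓕) inter_interior_subset⟩
  have claim : ∀ Q ∈ J, ∀ᶠ x in (𝓕 : Filter (ℝ × ℝ)), ∃ Q' ∈ J,
      connectedComponentIn (O Q) x ⊂ connectedComponentIn (O Q') x := by
    intro Q hQ
    obtain ⟨p, hpU, hp⟩ := doors_shrink hU hUc hUu (hnice Q hQ.1) (hu Q hQ.1) hQ.2 (hno Q hQ.1)
    obtain ⟨Q', hQ', hpQ'⟩ := hcov p hpU
    have key : ∀ᶠ x in (𝓕 : Filter (ℝ × ℝ)), x ∈ O Q' ∧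
        connectedComponentIn (O Q) x ⊂ connectedComponentIn (O Q') x := by
      filter_upwards [hp _ isOpen_interior hpQ', hQ.2] with x hx hxO
      have hA := (isDoor_of_mem hxO).isCut hU hUc hUu (hu Q hQ.1)
      obtain ⟨y, hy⟩ := hA.bd_conn.nonempty
      have hsub : bdIn U (connectedComponentIn (O Q) x) ⊆ O Q' :=
        fun z hz => inter_interior_subset ⟨hz.2, hx hz⟩
      have hB := isDoor_of_mem (hsub hy)
      have h1 := hA.union_bd_subset (hB.isCut hU hUc hUu (hu Q' hQ'))
        (hA.bd_conn.isPreconnected.subset_connectedComponentIn hy hsub)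
      have hxB := h1 (Or.inl (mem_connectedComponentIn hxO))
      refine ⟨(hB.subset hxB), ?_⟩
      rw [hB.eq_of_mem hxB] at h1
      exact ⟨subset_union_left.trans h1, fun h => hy.1.2 (h (h1 (Or.inr hy)))⟩
    have hQ'J : Q' ∈ J := ⟨hQ', mem_of_superset key fun x hx => hx.1⟩
    filter_upwards [key] with x hx
    exact ⟨Q', hQ'J, hx.2⟩
  have hJfin : J.Finite := hfin.subset (sep_subset _ _)
  obtain ⟨x, hx⟩ := ((hJfin.eventually_all (l := (𝓕 : Filter (ℝ × ℝ)))).2 claim).exists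
  obtain ⟨Q, hQ⟩ := hJfin.exists_maximalFor (fun Q => connectedComponentIn (O Q) x) J hJne
  obtain ⟨Q', hQ', hlt⟩ := hx Q hQ.1
  exact hlt.2 (hQ.2 hQ' hlt.1)

theorem cut_dichotomy {S : Set (ℝ × ℝ)} (hU : IsOpen U) (hUc : IsPreconnected U) (hUu : Unicoh U)
    (hS : IsOpen S) (hUS : U ⊆ S) (hu : u ∈ U) (hU𝓕 : U ∈ 𝓕)
    (hlim : ∀ x ∈ U, ¬ (𝓕 : Filter (ℝ × ℝ)) ≤ 𝓝 x) :
    (∀ C, IsCompact C → C ⊆ S → ∃ A, IsCut U u A ∧ A ∈ 𝓕 ∧ bdIn U A ∩ C = ∅) ∨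
    ∃ p ∈ S \ U, ∀ ε > 0, ∃ A, IsCut U u A ∧ A ∈ 𝓕 ∧ bdIn U A ⊆ Metric.ball p ε := by
  by_contra hcon
  push Not at hcon
  obtain ⟨⟨C, hC, hCS, hCno⟩, hp⟩ := hcon
  obtain ⟨K, hK, hKc, hCK, hKS⟩ := exists_niceSet (hC.union (isCompact_singleton (x := u))) hS
    (union_subset hCS (singleton_subset_iff.2 (hUS hu)))
  have huK : u ∈ interior K := hCK (Or.inr rfl)
  have hex : ∀ p, ∃ Q, p ∈ S \ U → NiceSet Q ∧ p ∈ interior Q ∧ u ∉ Q ∧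
      ∀ A, IsCut U u A → A ∈ 𝓕 → ¬ bdIn U A ⊆ Q := by
    intro p
    by_cases hpS : p ∈ S \ U
    · obtain ⟨ε, hε, hno⟩ := hp p hpS
      have hd : 0 < dist u p := dist_pos.2 fun h => hpS.2 (h ▸ hu)
      obtain ⟨Q, hQ, -, hpQ, hQb⟩ := exists_niceSet (isCompact_singleton (x := p))
        (Metric.isOpen_ball (x := p) (ε := min ε (dist u p)))
        (singleton_subset_iff.2 (Metric.mem_ball_self (lt_min hε hd)))
      refine ⟨Q, fun _ => ⟨hQ, hpQ rfl, fun h => ?_, fun A hA hA𝓕 h => hno A hA hA𝓕 ?_⟩⟩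
      · have := hQb h
        rw [Metric.mem_ball] at this
        exact absurd this (not_lt.2 (min_le_right _ _))
      · exact h.trans (hQb.trans (Metric.ball_subset_ball (min_le_left _ _)))
    · exact ⟨∅, fun h => absurd h hpS⟩
  choose Q hQ using hex
  obtain ⟨t, ht, htc⟩ := (hKc.diff hU).elim_nhds_subcover (fun p => interior (Q p))
    fun p hpK => isOpen_interior.mem_nhds (hQ p ⟨hKS hpK.1, hpK.2⟩).2.1
  have htS : ∀ p ∈ t, p ∈ S \ U := fun p hp => ⟨hKS (ht p hp).1, (ht p hp).2⟩
  have hcov : ∀ p ∈ K \ U, ∃ q ∈ t, p ∈ interior (Q q) := by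
    intro p hp
    have := htc hp
    simp only [mem_iUnion, exists_prop] at this
    exact this
  obtain ⟨R, hR, A, hA, hA𝓕⟩ := exists_door_mem (u := u) (𝒬 := insert (interior K)ᶜ (Q '' t))
    hU hUc hUu hU𝓕
    ((t.finite_toSet.image Q).insert _) (by
      rintro R (rfl | ⟨p, hp, rfl⟩)
      · exact hK.compl_interior
      · exact (hQ p (htS p hp)).1) (by
      rintro R (rfl | ⟨p, hp, rfl⟩)
      · exact ⟨hu, fun h => h huK⟩
      · exact ⟨hu, (hQ p (htS p hp)).2.2.1⟩) (by
      intro p hpU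
      by_cases hpK : p ∈ K
      · obtain ⟨q, hq, hpq⟩ := hcov p ⟨hpK, hpU⟩
        exact ⟨Q q, Or.inr ⟨q, hq, rfl⟩, hpq⟩
      · exact ⟨_, Or.inl rfl, by rw [hK.interior_compl_interior]; exact hpK⟩) (by
      by_cases hK𝓕 : K ∈ 𝓕
      · obtain ⟨z, hzK, hz⟩ := hKc.ultrafilter_le_nhds 𝓕 (le_principal_iff.2 hK𝓕)
        obtain ⟨q, hq, hzq⟩ := hcov z ⟨hzK, fun h => hlim z h hz⟩
        exact ⟨Q q, Or.inr ⟨q, hq, rfl⟩, hz (isOpen_interior.mem_nhds hzq)⟩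
      · refine ⟨_, Or.inl rfl, ?_⟩
        rw [hK.interior_compl_interior]
        exact Ultrafilter.compl_mem_iff_notMem.2 hK𝓕)
  rcases hR with rfl | ⟨p, hp, rfl⟩
  · have hu' : u ∈ U \ (interior K)ᶜ := ⟨hu, fun h => h huK⟩
    refine (hCno A (hA.isCut hU hUc hUu hu') hA𝓕).ne_empty ?_
    ext x; simp only [mem_inter_iff, mem_empty_iff_false, iff_false]
    rintro ⟨h1, h2⟩
    have := (hA.bd_subset hU hK.compl_interior h1).1
    rw [hK.frontier_compl_interior] at this
    exact this.2 (hCK (Or.inl h2))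
  · have hQp := hQ p (htS p hp)
    exact hQp.2.2.2 A (hA.isCut hU hUc hUu ⟨hu, hQp.2.2.1⟩) hA𝓕
      ((hA.bd_subset hU hQp.1).trans (inter_subset_left.trans hQp.1.closed.frontier_subset))

end Catch

/-- `D` is a cross-section of `U` relative to the open set `S` of the plane. -/
def PlaneCS (S U D : Set (ℝ × ℝ)) : Prop :=
  ∃ g : ℝ → ℝ × ℝ, ContinuousOn g (Icc 0 1) ∧ InjOn g (Ioo 0 1) ∧ (∀ t ∈ Ioo (0:ℝ) 1, g t ∈ U) ∧
    g 0 ∈ frontier U ∩ S ∧ g 1 ∈ frontier U ∩ S ∧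
    ∃ D₁ D₂ : Set (ℝ × ℝ), HasTwoComps (U \ g '' Ioo 0 1) D₁ D₂ ∧
      (frontier D₁ ∩ (frontier U \ g '' Icc 0 1) ∩ S).Nonempty ∧
      (frontier D₂ ∩ (frontier U \ g '' Icc 0 1) ∩ S).Nonempty ∧
      IsCompOf (U \ g '' Ioo 0 1) D

/-- A chain of cross-sections relative to `S`. -/
def PlaneChain (S U : Set (ℝ × ℝ)) (D : ℕ → Set (ℝ × ℝ)) : Prop :=
  (∀ i, PlaneCS S U (D i)) ∧ (∀ i j : ℕ, j ≤ i → D i ⊆ D j) ∧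
    ∀ i j : ℕ, i ≠ j → closure (bdIn U (D i)) ∩ closure (bdIn U (D j)) = ∅

/-- The boundaries of the sets `D n` leave every compact subset of `U` and shrink to at most
one point of the end compactification of `S`. -/
def NullSeq (S U : Set (ℝ × ℝ)) (D : ℕ → Set (ℝ × ℝ)) : Prop :=
  (∀ A, IsCompact A → A ⊆ U → ∀ᶠ n in atTop, bdIn U (D n) ∩ A = ∅) ∧
    ∀ A B, IsCompact A → IsCompact B → A ⊆ S → B ⊆ S → Disjoint A B →
      (∀ᶠ n in atTop, bdIn U (D n) ∩ A = ∅) ∨ ∀ᶠ n in atTop, bdIn U (D n) ∩ B = ∅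

theorem eventually_not_subset_compact {U : Set (ℝ × ℝ)} {𝓕 : Ultrafilter (ℝ × ℝ)}
    (hlim : ∀ x ∈ U, ¬ (𝓕 : Filter (ℝ × ℝ)) ≤ 𝓝 x) {C : Set (ℝ × ℝ)} (hC : IsCompact C)
    (hCU : C ⊆ U) : C ∉ 𝓕 := by
  intro h
  obtain ⟨x, hx, hle⟩ := hC.ultrafilter_le_nhds 𝓕 (le_principal_iff.2 h)
  exact hlim x (hCU hx) hle

theorem exists_path_compact {U : Set (ℝ × ℝ)} (hU : IsOpen U) (hUc : IsPreconnected U)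
    {x y : ℝ × ℝ} (hx : x ∈ U) (hy : y ∈ U) :
    ∃ P, IsCompact P ∧ IsPreconnected P ∧ P ⊆ U ∧ x ∈ P ∧ y ∈ P := by
  have hpc : IsPathConnected U :=
    (hU.isConnected_iff_isPathConnected).1 ⟨⟨x, hx⟩, hUc⟩
  obtain ⟨γ, hγ⟩ := hpc.joinedIn x hx y hy
  exact ⟨range γ, isCompact_range γ.continuous, isPreconnected_range γ.continuous,
    range_subset_iff.2 hγ, ⟨0, γ.source⟩, ⟨1, γ.target⟩⟩

/-- An arc in `U` whose image has closure in `S` and whose ends lie outside `U`. -/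
theorem door_arc {S U Q V : Set (ℝ × ℝ)} {u : ℝ × ℝ} (hU : IsOpen U)
    (hUc : IsPreconnected U) (hsc : SimplyConnectedSpace U) (hQ : NiceSet Q) (hu : u ∈ U \ Q)
    (hQS : frontier Q ⊆ S)
    (hV : IsPreconnected V) (huV : u ∈ V) (hVQ : V ∩ Q = ∅)
    (hVcpt : ∀ C, IsCompact C → C ⊆ U → ¬ V ⊆ C) {B : Set (ℝ × ℝ)} (hB : IsDoor U Q u B)
    (hBcpt : ∀ C, IsCompact C → C ⊆ U → ¬ B ⊆ C) :
    ∃ g : ℝ → ℝ × ℝ, ContinuousOn g (Icc 0 1) ∧ InjOn g (Ioo 0 1) ∧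
      g '' Ioo 0 1 = bdIn U B ∧ g 0 ∈ frontier U ∩ S ∧ g 1 ∈ frontier U ∩ S ∧
      g '' Icc 0 1 ⊆ closure (bdIn U B) := by
  have hcut := hB.isCut hU hUc (unicoh_of_simplyConnected hU hsc) hu
  obtain ⟨y, hy⟩ := hcut.bd_conn.nonempty
  obtain ⟨g, hg, hgi, hgim, h0, h1⟩ := hQ.arc U hU y (hB.bd_subset hU hQ hy)
    (frontier_comp_not_subset hU hUc hsc hQ hu hV huV hVQ hVcpt hB hBcpt hy)
  rw [← hB.bd_eq_comp hU hQ hcut.bd_conn.isPreconnected hy] at hgim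
  have hcl : g '' Icc 0 1 ⊆ closure (bdIn U B) := by
    rw [← hgim, ← closure_Ioo (zero_ne_one' ℝ)]
    apply ContinuousOn.image_closure
    rwa [closure_Ioo (zero_ne_one' ℝ)]
  have hfr : closure (bdIn U B) ⊆ frontier Q :=
    closure_minimal (fun x hx => (hB.bd_subset hU hQ hx).1) isClosed_frontier
  have key : ∀ t ∈ Icc (0:ℝ) 1, g t ∉ U → g t ∈ frontier U ∩ S := by
    intro t ht htU
    have := hcl ⟨t, ht, rfl⟩
    refine ⟨?_, hQS (hfr this)⟩
    rw [hU.frontier_eq]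
    exact ⟨closure_mono inter_subset_right this, htU⟩
  exact ⟨g, hg, hgi, hgim, key 0 (by simp) h0, key 1 (by simp) h1, hcl⟩

theorem exists_door_of_cut {U Q : Set (ℝ × ℝ)} {u : ℝ × ℝ} {𝓕 : Ultrafilter (ℝ × ℝ)}
    (hU : IsOpen U)
    (hUc : IsPreconnected U) (hUu : Unicoh U) (hu : u ∈ U \ Q) {A : Set (ℝ × ℝ)}
    (hA : IsCut U u A) (hA𝓕 : A ∈ 𝓕) (hbd : bdIn U A ⊆ interior Q) :
    ∃ B, IsDoor U Q u B ∧ B ∈ 𝓕 := by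
  obtain ⟨x, hx⟩ := hA.bd_conn.nonempty
  have hsub : bdIn U A ⊆ U \ closure (mainComp U Q u) := fun z hz =>
    inter_interior_subset ⟨hz.2, hbd hz⟩
  have hB := isDoor_of_mem (hsub hx)
  refine ⟨_, hB, mem_of_superset hA𝓕 ?_⟩
  exact subset_union_left.trans (hA.union_bd_subset (hB.isCut hU hUc hUu hu)
    (hA.bd_conn.isPreconnected.subset_connectedComponentIn hx hsub))

theorem exists_seq_of_eventually {R : ℕ → ℕ → Prop} (h : ∀ m, ∀ᶠ k in atTop, R m k) :
    ∃ φ : ℕ → ℕ, StrictMono φ ∧ ∀ n k, n < k → R (φ n) (φ k) := by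
  have h' : ∀ m, ∃ N, m < N ∧ ∀ k ≥ N, R m k := fun m => by
    obtain ⟨N, hN⟩ := eventually_atTop.1 (h m)
    exact ⟨max N (m + 1), by simp, fun k hk => hN k (le_trans (le_max_left _ _) hk)⟩
  choose N hN hR using h'
  let φ : ℕ → ℕ := fun n => Nat.rec 0 (fun _ m => N m) n
  have hφ : StrictMono φ := strictMono_nat_of_lt_succ fun n => hN (φ n)
  exact ⟨φ, hφ, fun n k hnk => hR _ _ (hφ.monotone (Nat.succ_le_of_lt hnk))⟩

theorem exists_null_chain_of_seq {S U V : Set (ℝ × ℝ)} {u : ℝ × ℝ} {𝓕 : Ultrafilter (ℝ × ℝ)}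
    (hU : IsOpen U) (hUc : IsPreconnected U) (hsc : SimplyConnectedSpace U)
    (huU : u ∈ U)
    (hlim : ∀ x ∈ U, ¬ (𝓕 : Filter (ℝ × ℝ)) ≤ 𝓝 x)
    {Q : ℕ → Set (ℝ × ℝ)} (hQ : ∀ m, NiceSet (Q m)) (hQS : ∀ m, frontier (Q m) ⊆ S)
    (hmono : ∀ m, Q (m + 1) ⊆ interior (Q m)) 
    (hV : IsPreconnected V) (huV : u ∈ V) (hVQ : ∀ m, V ∩ Q m = ∅)
    (hVcpt : ∀ C, IsCompact C → C ⊆ U → ¬ V ⊆ C)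
    (hesc : ∀ A, IsCompact A → A ⊆ U → ∀ᶠ m in atTop, Q m ∩ A = ∅)
    (hsep : ∀ A B, IsCompact A → IsCompact B → A ⊆ S → B ⊆ S → Disjoint A B →
      (∀ᶠ m in atTop, Q m ∩ A = ∅) ∨ ∀ᶠ m in atTop, Q m ∩ B = ∅)
    (hcut : ∀ m, ∃ A, IsCut U u A ∧ A ∈ 𝓕 ∧ bdIn U A ⊆ interior (Q m)) :
    ∃ D, PlaneChain S U D ∧ NullSeq S U D ∧ ∀ m, D m ∈ 𝓕 := by
  have hUu := unicoh_of_simplyConnected hU hsc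
  have huQ : ∀ m, u ∈ U \ Q m := fun m =>
    ⟨huU, fun h => (Set.eq_empty_iff_forall_notMem.1 (hVQ m)) u ⟨huV, h⟩⟩
  have hdoor : ∀ m, ∃ B, IsDoor U (Q m) u B ∧ B ∈ 𝓕 := fun m => by
    obtain ⟨A, hA, hA𝓕, hbd⟩ := hcut m
    exact exists_door_of_cut hU hUc hUu (huQ m) hA hA𝓕 hbd
  choose B hB hB𝓕 using hdoor
  have hBcut : ∀ m, IsCut U u (B m) := fun m => (hB m).isCut hU hUc hUu (huQ m)
  have hanti : Antitone Q := antitone_nat_of_succ_le fun m => (hmono m).trans interior_subset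
  have hBQ : ∀ m, bdIn U (B m) ⊆ Q m := fun m x hx =>
    (hQ m).closed.frontier_subset ((hB m).bd_subset hU (hQ m) hx).1
  have hfrQ : ∀ m k, m < k → frontier (Q m) ∩ Q k = ∅ := by
    intro m k hmk
    ext x; simp only [mem_inter_iff, mem_empty_iff_false, iff_false]
    rintro ⟨h1, h2⟩
    exact h1.2 (hmono m (hanti (Nat.succ_le_of_lt hmk) h2))
  have hfrfr : ∀ m k, m ≠ k → frontier (Q m) ∩ frontier (Q k) = ∅ := by
    have : ∀ m k, m < k → frontier (Q m) ∩ frontier (Q k) = ∅ := fun m k h =>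
      subset_empty_iff.1 ((inter_subset_inter_right _ (hQ k).closed.frontier_subset).trans
        (hfrQ m k h).subset)
    intro m k hmk
    rcases lt_or_gt_of_ne hmk with h | h
    · exact this m k h
    · rw [inter_comm]; exact this k m h
  have hclfr : ∀ m, closure (bdIn U (B m)) ⊆ frontier (Q m) := fun m =>
    closure_minimal (fun x hx => ((hB m).bd_subset hU (hQ m) hx).1) isClosed_frontier
  have hev : ∀ m, ∀ᶠ k in atTop, B k ⊆ B m ∧ bdIn U (B m) ∩ closure (B k) = ∅ := by
    intro m
    obtain ⟨z, hz⟩ := (hBcut m).bd_conn.nonempty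
    obtain ⟨P, hPc, hPp, hPU, huP, hzP⟩ := exists_path_compact hU hUc huU hz.2
    filter_upwards [hesc P hPc hPU, eventually_gt_atTop m] with k hk hmk
    have hT : IsPreconnected (P ∪ bdIn U (B m)) :=
      hPp.union z hzP hz (hBcut m).bd_conn.isPreconnected
    have hTU : P ∪ bdIn U (B m) ⊆ U := union_subset hPU inter_subset_right
    have hav : (P ∪ bdIn U (B m)) ∩ bdIn U (B k) = ∅ := by
      ext x; simp only [mem_inter_iff, mem_empty_iff_false, iff_false]
      rintro ⟨h1 | h1, h2⟩
      · exact Set.eq_empty_iff_forall_notMem.1 hk x ⟨hBQ k h2, h1⟩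
      · exact Set.eq_empty_iff_forall_notMem.1 (hfrQ m k hmk) x
          ⟨hclfr m (subset_closure h1), hBQ k h2⟩
    have hd := inter_eq_empty_of_avoid_bdIn hT hTU (hBcut k).isOpen (Or.inl huP)
      (hBcut k).base hav
    have hd' : bdIn U (B m) ∩ closure (B k) = ∅ := subset_empty_iff.1
      ((inter_subset_inter_left _ subset_union_right).trans hd.subset)
    refine ⟨?_, hd'⟩
    refine subset_of_avoid_bdIn (hBcut k).conn.isPreconnected (hBcut k).sub (hBcut m).isOpen
      (𝓕.nonempty_of_mem (inter_mem (hB𝓕 k) (hB𝓕 m))) ?_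
    rw [inter_comm]
    exact subset_empty_iff.1 ((inter_subset_inter_right _ subset_closure).trans hd'.subset)
  obtain ⟨φ, hφ, hR⟩ := exists_seq_of_eventually hev
  have hBcpt : ∀ m, ∀ C, IsCompact C → C ⊆ U → ¬ B m ⊆ C := fun m C hC hCU hsub =>
    eventually_not_subset_compact hlim hC hCU (mem_of_superset (hB𝓕 m) hsub)
  have harc := fun m => door_arc hU hUc hsc (hQ m) (huQ m) (hQS m) hV huV (hVQ m) hVcpt (hB m)
    (hBcpt m)
  have hend : ∀ m, ∃ e, e ∈ frontier U ∩ S ∧ e ∈ closure (bdIn U (B m)) := fun m => by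
    obtain ⟨g, -, -, -, h0, -, h⟩ := harc m
    exact ⟨g 0, h0, h ⟨0, by simp, rfl⟩⟩
  have hCS : ∀ n, PlaneCS S U (B (φ (n + 1))) := by
    intro n
    obtain ⟨g, hg, hgi, hgim, h0, h1, hcl⟩ := harc (φ (n + 1))
    refine ⟨g, hg, hgi, fun t ht => ?_, h0, h1, B (φ (n + 1)), U \ closure (B (φ (n + 1))), ?_,
      ?_, ?_, ?_⟩
    · have : g t ∈ bdIn U (B (φ (n + 1))) := hgim ▸ ⟨t, ht, rfl⟩
      exact this.2
    · rw [hgim]; exact (hB _).hasTwoComps hU hUc (hQ _) (huQ _)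
    · obtain ⟨e, heS, he⟩ := hend (φ (n + 2))
      have heU : e ∉ U := by have := heS.1; rw [hU.frontier_eq] at this; exact this.2
      refine ⟨e, ⟨?_, heS.1, fun h => ?_⟩, heS.2⟩
      · rw [(hBcut _).isOpen.frontier_eq]
        refine ⟨?_, fun h => heU ((hBcut _).sub h)⟩
        have hsub := closure_mono (hR (n + 1) (n + 2) (Nat.lt_succ_self _)).1
        exact closure_minimal (fun x hx => hsub hx.1.1) isClosed_closure he
      · exact Set.eq_empty_iff_forall_notMem.1
          (hfrfr (φ (n + 1)) (φ (n + 2)) (hφ (Nat.lt_succ_self _)).ne) e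
          ⟨hclfr _ (hcl h), hclfr _ he⟩
    · obtain ⟨e, heS, he⟩ := hend (φ n)
      have heU : e ∉ U := by have := heS.1; rw [hU.frontier_eq] at this; exact this.2
      refine ⟨e, ⟨?_, heS.1, fun h => ?_⟩, heS.2⟩
      · have ho : IsOpen (U \ closure (B (φ (n + 1)))) := hU.sdiff isClosed_closure
        rw [ho.frontier_eq]
        have hsub : bdIn U (B (φ n)) ⊆ U \ closure (B (φ (n + 1))) := fun x hx =>
          ⟨hx.2, fun h => Set.eq_empty_iff_forall_notMem.1
            (hR n (n + 1) (Nat.lt_succ_self n)).2 x ⟨hx, h⟩⟩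
        exact ⟨closure_mono hsub he, fun h => heU h.1⟩
      · exact Set.eq_empty_iff_forall_notMem.1
          (hfrfr (φ (n + 1)) (φ n) (hφ (Nat.lt_succ_self _)).ne') e
          ⟨hclfr _ (hcl h), hclfr _ he⟩
    · rw [hgim]; exact ((hB _).hasTwoComps hU hUc (hQ _) (huQ _)).1
  have htend : Tendsto (fun n => φ (n + 1)) atTop atTop :=
    hφ.tendsto_atTop.comp (tendsto_add_atTop_nat 1)
  have hnull : ∀ A, (∀ᶠ m in atTop, Q m ∩ A = ∅) →
      ∀ᶠ n in atTop, bdIn U (B (φ (n + 1))) ∩ A = ∅ := by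
    intro A hA
    filter_upwards [htend.eventually hA] with n hn
    exact subset_empty_iff.1 ((inter_subset_inter_left _ (hBQ _)).trans hn.subset)
  refine ⟨fun n => B (φ (n + 1)), ⟨hCS, ?_, ?_⟩, ⟨?_, ?_⟩, fun m => hB𝓕 _⟩
  · intro i j hji
    rcases hji.eq_or_lt with rfl | h
    · exact Subset.rfl
    · exact (hR _ _ (Nat.succ_lt_succ h)).1
  · intro i j hij
    have := hfrfr (φ (i + 1)) (φ (j + 1)) (hφ.injective.ne (by simpa using hij))
    exact subset_empty_iff.1 ((inter_subset_inter (hclfr _) (hclfr _)).trans this.subset)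
  · exact fun A hA hAU => hnull A (hesc A hA hAU)
  · intro A A' hA hA' hAS hAS' hd
    exact (hsep A A' hA hA' hAS hAS' hd).imp (hnull A) (hnull A')

theorem exists_null_chain_of_point {S U : Set (ℝ × ℝ)} {u p : ℝ × ℝ} {𝓕 : Ultrafilter (ℝ × ℝ)}
    (hU : IsOpen U) (hUc : IsPreconnected U) (hsc : SimplyConnectedSpace U)
    (huU : u ∈ U) (hS : IsOpen S)
    (hlim : ∀ x ∈ U, ¬ (𝓕 : Filter (ℝ × ℝ)) ≤ 𝓝 x) (hp : p ∈ S \ U)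
    (hcut : ∀ ε > 0, ∃ A, IsCut U u A ∧ A ∈ 𝓕 ∧ bdIn U A ⊆ Metric.ball p ε) :
    ∃ D, PlaneChain S U D ∧ NullSeq S U D ∧ ∀ m, D m ∈ 𝓕 := by
  have hpu : 0 < dist u p := dist_pos.2 fun h => hp.2 (h ▸ huU)
  obtain ⟨r₀, hr₀, hr₀S⟩ := Metric.isOpen_iff.1 hS p hp.1
  obtain ⟨r, hr, hrlt⟩ : ∃ r, 0 < r ∧ r < min r₀ (dist u p) := exists_between (lt_min hr₀ hpu)
  have hr' : ∀ m : ℕ, 0 < r * (1 / 3) ^ m := fun m => by positivity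
  have hle : ∀ m : ℕ, r * (1 / 3) ^ m ≤ r := fun m =>
    mul_le_of_le_one_right hr.le (pow_le_one₀ (by norm_num) (by norm_num))
  have hnice : ∀ m : ℕ, ∃ K, NiceSet K ∧ IsCompact K ∧
      Metric.closedBall p (r * (1 / 3) ^ m / 2) ⊆ interior K ∧
      K ⊆ Metric.ball p (r * (1 / 3) ^ m) := fun m =>
    exists_niceSet (isCompact_closedBall _ _) Metric.isOpen_ball
      (Metric.closedBall_subset_ball (half_lt_self (hr' m)))
  choose Q hQ hQc hQin hQsub using hnice
  have hsmall : ∀ V ∈ 𝓝 p, ∀ᶠ m in atTop, Q m ⊆ V := by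
    intro V hV
    obtain ⟨ε, hε, hεV⟩ := Metric.mem_nhds_iff.1 hV
    have ht : Tendsto (fun m : ℕ => r * (1 / 3 : ℝ) ^ m) atTop (𝓝 (r * 0)) :=
      (tendsto_pow_atTop_nhds_zero_of_lt_one (by norm_num) (by norm_num)).const_mul r
    rw [mul_zero] at ht
    filter_upwards [ht.eventually (gt_mem_nhds hε)] with m hm
    exact ((hQsub m).trans (Metric.ball_subset_ball hm.le)).trans hεV
  have hdis : ∀ A, IsCompact A → p ∉ A → ∀ᶠ m in atTop, Q m ∩ A = ∅ := by
    intro A hA hpA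
    filter_upwards [hsmall Aᶜ (hA.isClosed.isOpen_compl.mem_nhds hpA)] with m hm
    exact (disjoint_compl_left.mono_left hm).inter_eq
  have hQball : ∀ m, Q m ⊆ Metric.closedBall p r := fun m =>
    (hQsub m).trans (Metric.ball_subset_closedBall.trans (Metric.closedBall_subset_closedBall (hle m)))
  have hVp : IsPreconnected ((Metric.closedBall p r)ᶜ) := by
    have := (isPreconnected_compl_closedBall r hr.le).image (fun x => x + p)
      (by fun_prop)
    convert this using 1
    ext x
    simp only [mem_compl_iff, Metric.mem_closedBall, mem_image, dist_eq_norm, sub_zero]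
    constructor
    · intro h; exact ⟨x - p, h, by simp⟩
    · rintro ⟨y, hy, rfl⟩; simpa using hy
  refine exists_null_chain_of_seq (V := (Metric.closedBall p r)ᶜ) hU hUc hsc huU hlim hQ ?_ ?_ hVp
    ?_ ?_ ?_ ?_ ?_ ?_
  · intro m x hx
    have := hQball m ((hQ m).closed.frontier_subset hx)
    refine hr₀S (Metric.closedBall_subset_ball (hrlt.trans_le (min_le_left _ _)) this)
  · intro m
    refine (hQsub (m + 1)).trans (Subset.trans ?_ (hQin m))
    refine Metric.ball_subset_closedBall.trans (Metric.closedBall_subset_closedBall ?_)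
    have := hr' m
    rw [pow_succ]; nlinarith
  · simp only [mem_compl_iff, Metric.mem_closedBall, not_le]
    exact hrlt.trans_le (min_le_right _ _)
  · intro m
    exact (disjoint_compl_left.mono_right (hQball m)).inter_eq
  · intro C hC _ hsub
    have hb : Bornology.IsBounded (univ : Set (ℝ × ℝ)) := by
      have : (univ : Set (ℝ × ℝ)) ⊆ C ∪ Metric.closedBall p r := fun x _ => by
        by_cases h : x ∈ Metric.closedBall p r
        · exact Or.inr h
        · exact Or.inl (hsub h)
      exact (hC.isBounded.union Metric.isBounded_closedBall).subset this
    exact NoncompactSpace.noncompact_univ (Metric.isCompact_of_isClosed_isBounded isClosed_univ hb)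
  · exact fun A hA hAU => hdis A hA fun h => hp.2 (hAU h)
  · intro A A' hA hA' _ _ hd
    by_cases h : p ∈ A
    · exact Or.inr (hdis A' hA' fun h' => Set.disjoint_left.1 hd h h')
    · exact Or.inl (hdis A hA h)
  · intro m
    obtain ⟨A, hA, hA𝓕, hbd⟩ := hcut (r * (1 / 3) ^ m / 2) (half_pos (hr' m))
    exact ⟨A, hA, hA𝓕, (hbd.trans Metric.ball_subset_closedBall).trans (hQin m)⟩

theorem exists_exhaustion {S : Set (ℝ × ℝ)} (hS : IsOpen S) :
    ∃ E : ℕ → Set (ℝ × ℝ), (∀ m, IsCompact (E m)) ∧ (∀ m, E m ⊆ interior (E (m + 1))) ∧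
      (∀ m, E m ⊆ S) ∧ ∀ A, IsCompact A → A ⊆ S → ∀ᶠ m in atTop, A ⊆ E m := by
  have : LocallyCompactSpace S := hS.locallyCompactSpace
  let K : CompactExhaustion S := default
  have hsub : ∀ m, (Subtype.val '' K m : Set (ℝ × ℝ)) ⊆
      interior (Subtype.val '' K (m + 1)) := by
    intro m
    refine (image_mono (K.subset_interior_succ m)).trans ?_
    exact interior_maximal (image_mono interior_subset)
      (hS.isOpenMap_subtype_val _ isOpen_interior)
  refine ⟨fun m => Subtype.val '' K m, fun m => (K.isCompact m).image continuous_subtype_val,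
    hsub, fun m => by rintro _ ⟨x, -, rfl⟩; exact x.2, ?_⟩
  intro A hA hAS
  have hmono : Monotone fun m => (Subtype.val '' K m : Set (ℝ × ℝ)) :=
    monotone_nat_of_le_succ fun m => (hsub m).trans interior_subset
  obtain ⟨N, hN⟩ := hA.elim_directed_cover
    (fun m => interior (Subtype.val '' K m : Set (ℝ × ℝ))) (fun _ => isOpen_interior)
    (fun x hx => by
      obtain ⟨m, hm⟩ := mem_iUnion.1 (K.iUnion_eq.symm ▸ mem_univ (⟨x, hAS hx⟩ : S))
      exact mem_iUnion.2 ⟨m + 1, hsub m ⟨_, hm, rfl⟩⟩)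
    (directed_of_isDirected_le fun i j hij => interior_mono (hmono hij))
  filter_upwards [eventually_ge_atTop N] with m hm
  exact hN.trans (interior_subset.trans (hmono hm))

theorem exists_null_chain_of_infinity {S U : Set (ℝ × ℝ)} {u : ℝ × ℝ} {𝓕 : Ultrafilter (ℝ × ℝ)}
    (hU : IsOpen U) (hUc : IsPreconnected U) (hsc : SimplyConnectedSpace U)
    (huU : u ∈ U) (hS : IsOpen S) (hSc : IsPreconnected S) (hUS : U ⊆ S) (hne : U ≠ S)
    (hlim : ∀ x ∈ U, ¬ (𝓕 : Filter (ℝ × ℝ)) ≤ 𝓝 x)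
    (hcut : ∀ C, IsCompact C → C ⊆ S → ∃ A, IsCut U u A ∧ A ∈ 𝓕 ∧ bdIn U A ∩ C = ∅) :
    ∃ D, PlaneChain S U D ∧ NullSeq S U D ∧ ∀ m, D m ∈ 𝓕 := by
  obtain ⟨p, hpS, hpU⟩ : ∃ p ∈ S, p ∉ U := by
    by_contra h
    push Not at h
    exact hne (hUS.antisymm h)
  obtain ⟨V, hVc, hVp, hVS, huV, hpV⟩ := exists_path_compact hS hSc (hUS huU) hpS
  obtain ⟨E, hEc, hEsub, hES, hEex⟩ := exists_exhaustion hS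
  obtain ⟨N, hN⟩ := (hEex V hVc hVS).exists_forall_of_atTop
  have hnice : ∀ m : ℕ, ∃ K, NiceSet K ∧ IsCompact K ∧ E (N + m) ⊆ interior K ∧
      K ⊆ interior (E (N + m + 1)) := fun m =>
    exists_niceSet (hEc _) isOpen_interior (hEsub _)
  choose K hK hKc hKin hKsub using hnice
  have hKS : ∀ m, K m ⊆ S := fun m => (hKsub m).trans (interior_subset.trans (hES _))
  have hdis : ∀ A, IsCompact A → A ⊆ S → ∀ᶠ m in atTop, (interior (K m))ᶜ ∩ A = ∅ := by
    intro A hA hAS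
    have : Tendsto (fun m => N + m) atTop atTop := tendsto_add_atTop_iff_nat N |>.2 tendsto_id |>.congr
      fun m => by simp [add_comm]
    filter_upwards [this.eventually (hEex A hA hAS)] with m hm
    exact (disjoint_compl_left.mono_right (hm.trans (hKin m))).inter_eq
  refine exists_null_chain_of_seq (V := V) (Q := fun m => (interior (K m))ᶜ) hU hUc hsc huU hlim
    (fun m => (hK m).compl_interior) ?_ ?_ hVp huV ?_ ?_ ?_ ?_ ?_
  · intro m
    rw [(hK m).frontier_compl_interior]
    exact (hK m).closed.frontier_subset.trans (hKS m)
  · intro m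
    rw [(hK m).interior_compl_interior, compl_subset_compl]
    exact (hKsub m).trans (interior_subset.trans (hKin (m + 1)))
  · intro m
    exact (disjoint_compl_right.mono_left ((hN _ (Nat.le_add_right N m)).trans (hKin m))).inter_eq
  · exact fun C _ hCU hsub => hpU (hCU (hsub hpV))
  · exact fun A hA hAU => hdis A hA (hAU.trans hUS)
  · exact fun A _ hA _ hAS _ _ => Or.inl (hdis A hA hAS)
  · intro m
    obtain ⟨A, hA, hA𝓕, hbd⟩ := hcut (K m) (hKc m) (hKS m)
    refine ⟨A, hA, hA𝓕, ?_⟩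
    rw [(hK m).interior_compl_interior]
    exact fun x hx hxK => Set.eq_empty_iff_forall_notMem.1 hbd x ⟨hx, hxK⟩

/-- Every ultrafilter on `U` without limit in `U` is caught by a null chain relative to `S`. -/
theorem exists_null_chain {S U : Set (ℝ × ℝ)} {𝓕 : Ultrafilter (ℝ × ℝ)}
    (hU : IsOpen U) (hUc : IsPreconnected U) (hsc : SimplyConnectedSpace U)
    (hS : IsOpen S) (hSc : IsPreconnected S) (hUS : U ⊆ S) (hne : U ≠ S) (hU𝓕 : U ∈ 𝓕)
    (hlim : ∀ x ∈ U, ¬ (𝓕 : Filter (ℝ × ℝ)) ≤ 𝓝 x) :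
    ∃ D, PlaneChain S U D ∧ NullSeq S U D ∧ ∀ m, D m ∈ 𝓕 := by
  obtain ⟨u, hu⟩ := 𝓕.nonempty_of_mem hU𝓕
  rcases cut_dichotomy hU hUc (unicoh_of_simplyConnected hU hsc) hS hUS hu hU𝓕 hlim with h | h
  · exact exists_null_chain_of_infinity hU hUc hsc hu hS hSc hUS hne hlim h
  · obtain ⟨p, hp, h⟩ := h
    exact exists_null_chain_of_point hU hUc hsc hu hS hlim hp h

/-- The properties of a cross-section of `U` relative to `S` used below. -/
structure Sec (S U D : Set (ℝ × ℝ)) : Prop where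
  isOpen : IsOpen D
  sub : D ⊆ U
  conn : IsConnected D
  compl_ne : (U \ D).Nonempty
  bd_conn : IsConnected (bdIn U D)
  bd_cpt : IsCompact (closure (bdIn U D))
  bd_sub : closure (bdIn U D) ⊆ S
  not_cpt : ∀ A, IsCompact A → A ⊆ U → ¬ D ⊆ A

theorem _root_.IsCompOf.eq_of_mem {A : Type*} [TopologicalSpace A] {M D : Set A} (h : IsCompOf M D)
    {x : A} (hx : x ∈ D) : D = connectedComponentIn M x := by
  obtain ⟨y, -, rfl⟩ := h
  exact connectedComponentIn_eq hx

theorem _root_.IsCompOf.closure_inter {A : Type*} [TopologicalSpace A] {M D : Set A} (h : IsCompOf M D) :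
    closure D ∩ M ⊆ D := by
  obtain ⟨y, -, rfl⟩ := h
  exact closure_connectedComponentIn_inter y

theorem _root_.IsCompOf.isConnected {A : Type*} [TopologicalSpace A] {M D : Set A} (h : IsCompOf M D) :
    IsConnected D := by
  obtain ⟨y, hy, rfl⟩ := h
  exact isConnected_connectedComponentIn_iff.2 hy

theorem _root_.IsCompOf.subset {A : Type*} [TopologicalSpace A] {M D : Set A} (h : IsCompOf M D) :
    D ⊆ M := by
  obtain ⟨y, hy, rfl⟩ := h
  exact connectedComponentIn_subset _ _

theorem PlaneCS.sec {S U D : Set (ℝ × ℝ)} (hU : IsOpen U) (hUc : IsPreconnected U)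
    (hUu : Unicoh U) (hUS : U ⊆ S) (h : PlaneCS S U D) : Sec S U D := by
  obtain ⟨g, hg, hgi, hgU, h0, h1, D₁, D₂, h2, hf1, hf2, hD⟩ := h
  set γ := g '' Ioo 0 1 with hγ
  have hγI : γ = g '' Icc 0 1 ∩ U := by
    apply Subset.antisymm
    · rintro _ ⟨t, ht, rfl⟩
      exact ⟨⟨t, Ioo_subset_Icc_self ht, rfl⟩, hgU t ht⟩
    · rintro _ ⟨⟨t, ht, rfl⟩, htU⟩
      rw [hU.frontier_eq] at h0 h1
      refine ⟨t, ⟨lt_of_le_of_ne ht.1 ?_, lt_of_le_of_ne ht.2 ?_⟩, rfl⟩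
      · rintro rfl; exact h0.1.2 htU
      · rintro rfl; exact h1.1.2 htU
  have hIc : IsCompact (g '' Icc 0 1) := isCompact_Icc.image_of_continuousOn hg
  have hIS : g '' Icc 0 1 ⊆ S := by
    rintro _ ⟨t, ht, rfl⟩
    rcases eq_or_lt_of_le ht.1 with rfl | ht0
    · exact h0.2
    rcases eq_or_lt_of_le ht.2 with rfl | ht1
    · exact h1.2
    exact hUS (hgU t ⟨ht0, ht1⟩)
  have hγU : γ ⊆ U := hγI ▸ inter_subset_right
  have hM : IsOpen (U \ γ) := by
    have : U \ γ = U \ g '' Icc 0 1 := by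
      rw [hγI]; ext x; simp only [Set.mem_sdiff, mem_inter_iff]; tauto
    rw [this]; exact hU.sdiff hIc.isClosed
  have hγc : IsPreconnected γ := isPreconnected_Ioo.image _ (hg.mono Ioo_subset_Icc_self)
  have hop : ∀ {E}, IsCompOf (U \ γ) E → IsOpen E := by
    rintro _ ⟨x, -, rfl⟩; exact hM.connectedComponentIn
  have hbd : ∀ {E}, IsCompOf (U \ γ) E → bdIn U E ⊆ γ := by
    intro E hE x hx
    by_contra hxγ
    exact hx.1.2 (hE.closure_inter ⟨hx.1.1, hx.2, hxγ⟩)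
  obtain ⟨D', hD', hne, hcov, hfr⟩ : ∃ D', IsCompOf (U \ γ) D' ∧ D ≠ D' ∧ U \ γ ⊆ D ∪ D' ∧
      (frontier D ∩ (frontier U \ g '' Icc 0 1) ∩ S).Nonempty := by
    obtain ⟨hc1, hc2, hne, hcov⟩ := h2
    have hcov' : U \ γ ⊆ D₁ ∪ D₂ := fun x hx => by
      rcases hcov x hx with h | h
      · exact Or.inl (h ▸ mem_connectedComponentIn hx)
      · exact Or.inr (h ▸ mem_connectedComponentIn hx)
    obtain ⟨x, hx, rfl⟩ := hD
    rcases hcov x hx with h | h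
    · rw [h]; exact ⟨D₂, hc2, hne, hcov', hf1⟩
    · rw [h]; exact ⟨D₁, hc1, hne.symm, union_comm D₁ D₂ ▸ hcov', hf2⟩
  have hdisj : Disjoint D D' := by
    rw [Set.disjoint_left]
    exact fun x hx hx' => hne ((hD.eq_of_mem hx).trans (hD'.eq_of_mem hx').symm)
  have hbdne : ∀ {E E'}, IsCompOf (U \ γ) E → IsCompOf (U \ γ) E' → Disjoint E E' →
      (bdIn U E).Nonempty := by
    intro E E' hE hE' hd
    by_contra hcon
    rw [not_nonempty_iff_eq_empty] at hcon
    obtain ⟨x, hx⟩ := hE.isConnected.nonempty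
    obtain ⟨y, hy⟩ := hE'.isConnected.nonempty
    have := subset_of_avoid_bdIn hUc Subset.rfl (hop hE) ⟨x, (hE.subset hx).1, hx⟩
      (by rw [hcon, inter_empty])
    exact Set.disjoint_left.1 hd (this (hE'.subset hy).1) hy
  obtain ⟨y, hy⟩ := hbdne hD' hD hdisj.symm
  have hUD : U \ D = γ ∪ (insert y D') := by
    have hyγ := hbd hD' hy
    rw [union_insert, insert_eq_of_mem (show y ∈ γ ∪ D' from Or.inl hyγ)]
    ext x
    constructor
    · rintro ⟨hxU, hxD⟩
      by_cases hxγ : x ∈ γ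
      · exact Or.inl hxγ
      · exact Or.inr ((hcov ⟨hxU, hxγ⟩).resolve_left hxD)
    · rintro (hx | hx)
      · exact ⟨hγU hx, fun h => (hD.subset h).2 hx⟩
      · exact ⟨(hD'.subset hx).1, Set.disjoint_right.1 hdisj hx⟩
  have hcc : IsPreconnected (U \ D) := by
    rw [hUD]
    refine hγc.union y (hbd hD' hy) (mem_insert y D') ?_
    exact hD'.isConnected.isPreconnected.subset_closure (subset_insert y D')
      (insert_subset hy.1.1 subset_closure)
  have hcl : closure (bdIn U D) ⊆ g '' Icc 0 1 :=
    closure_minimal ((hbd hD).trans (image_mono Ioo_subset_Icc_self)) hIc.isClosed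
  have hDU : D ⊆ U := (hD.subset).trans sdiff_subset
  refine ⟨hop hD, hDU, hD.isConnected, ?_,
    ⟨hbdne hD hD' hdisj, hUu D (hop hD) hDU (hD.isConnected).isPreconnected hcc⟩,
    hIc.of_isClosed_subset isClosed_closure hcl, hcl.trans hIS, ?_⟩
  · exact ⟨y, hUD ▸ Or.inr (mem_insert y D')⟩
  · intro A hA hAU hsub
    obtain ⟨x, ⟨hxD, hxU, -⟩, -⟩ := hfr
    have := closure_minimal hsub hA.isClosed (frontier_subset_closure hxD)
    rw [hU.frontier_eq] at hxU
    exact hxU.2 (hAU this)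

theorem PlaneCS.mono {S S' U D : Set (ℝ × ℝ)} (hSS : S ⊆ S') (h : PlaneCS S U D) :
    PlaneCS S' U D := by
  obtain ⟨g, hg, hgi, hgU, h0, h1, D₁, D₂, h2, hf1, hf2, hD⟩ := h
  exact ⟨g, hg, hgi, hgU, ⟨h0.1, hSS h0.2⟩, ⟨h1.1, hSS h1.2⟩, D₁, D₂, h2,
    hf1.mono (inter_subset_inter_right _ hSS), hf2.mono (inter_subset_inter_right _ hSS), hD⟩

/-- A plane domain with its standing hypotheses, inside an open domain `S`. -/
structure Dom (S U : Set (ℝ × ℝ)) : Prop where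
  isOpen : IsOpen U
  preconn : IsPreconnected U
  sc : SimplyConnectedSpace U
  openS : IsOpen S
  preconnS : IsPreconnected S
  sub : U ⊆ S
  ne : U ≠ S

section

variable {S U : Set (ℝ × ℝ)}

theorem Dom.sec (h : Dom S U) {D : Set (ℝ × ℝ)} (hD : PlaneCS S U D) : Sec S U D :=
  hD.sec h.isOpen h.preconn (unicoh_of_simplyConnected h.isOpen h.sc) h.sub

theorem Dom.escape (h : Dom S U) {D : ℕ → Set (ℝ × ℝ)} (hD : PlaneChain S U D)
    (hn : NullSeq S U D) {A : Set (ℝ × ℝ)} (hA : IsCompact A) (hAU : A ⊆ U) :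
    ∀ᶠ n in atTop, D n ∩ A = ∅ := by
  obtain ⟨u₀, hu₀U, hu₀⟩ := (h.sec (hD.1 0)).compl_ne
  refine hA.induction_on (p := fun B => ∀ᶠ n in atTop, D n ∩ B = ∅) (by simp) ?_ ?_ ?_
  · intro s t hst ht
    filter_upwards [ht] with n hn
    exact subset_empty_iff.1 ((inter_subset_inter_right _ hst).trans hn.subset)
  · intro s t hs ht
    filter_upwards [hs, ht] with n h1 h2
    rw [inter_union_distrib_left, h1, h2, union_empty]
  · intro x hx
    obtain ⟨r, hr, hrU⟩ := Metric.nhds_basis_closedBall.mem_iff.1 (h.isOpen.mem_nhds (hAU hx))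
    refine ⟨Metric.closedBall x r, mem_nhdsWithin_of_mem_nhds (Metric.closedBall_mem_nhds x hr), ?_⟩
    obtain ⟨P, hPc, hPp, hPU, huP, hxP⟩ := exists_path_compact h.isOpen h.preconn hu₀U (hAU hx)
    have hT : IsPreconnected (P ∪ Metric.closedBall x r) :=
      hPp.union x hxP (Metric.mem_closedBall_self hr.le) (convex_closedBall x r).isPreconnected
    have hTU := union_subset hPU hrU
    filter_upwards [hn.1 _ (hPc.union (isCompact_closedBall x r)) hTU] with n hn
    rw [inter_comm] at hn
    have := inter_eq_empty_of_avoid_bdIn hT hTU (h.sec (hD.1 n)).isOpen (Or.inl huP)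
      (fun h => hu₀ (hD.2.1 n 0 (Nat.zero_le _) h)) hn
    rw [inter_comm]
    exact subset_empty_iff.1 ((inter_subset_inter subset_union_right subset_closure).trans
      this.subset)

theorem Dom.hlim_of_chain (h : Dom S U) {D : ℕ → Set (ℝ × ℝ)} (hD : PlaneChain S U D)
    (hn : NullSeq S U D) {𝓕 : Filter (ℝ × ℝ)} [𝓕.NeBot] (h𝓕 : ∀ n, D n ∈ 𝓕) :
    ∀ x ∈ U, ¬ 𝓕 ≤ 𝓝 x := by
  intro x hx hle
  obtain ⟨r, hr, hrU⟩ := Metric.nhds_basis_closedBall.mem_iff.1 (h.isOpen.mem_nhds hx)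
  obtain ⟨n, hn⟩ := (h.escape hD hn (isCompact_closedBall x r) hrU).exists
  have := inter_mem (h𝓕 n) (hle (Metric.closedBall_mem_nhds x hr))
  rw [hn] at this
  exact empty_notMem 𝓕 this

theorem Dom.dichotomy (h : Dom S U) {D : ℕ → Set (ℝ × ℝ)} (hD : PlaneChain S U D)
    (hn : NullSeq S U D) {E F : Set (ℝ × ℝ)} (hE : Sec S U E) (hF : Sec S U F) (hFE : F ⊆ E)
    (hEF : closure (bdIn U E) ∩ closure (bdIn U F) = ∅) (hDF : ∀ n, (D n ∩ F).Nonempty) :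
    ∃ n, D n ⊆ E := by
  by_contra hcon
  push Not at hcon
  have key : ∀ G, Sec S U G → (∀ n, (D n ∩ G).Nonempty) → (∀ n, ¬ D n ⊆ G) →
      (∀ᶠ n in atTop, bdIn U (D n) ∩ closure (bdIn U G) = ∅) → False := by
    intro G hG hDG hDnG hev
    obtain ⟨z, hz⟩ := hG.bd_conn.nonempty
    obtain ⟨n, hn1, hn2⟩ :=
      (hev.and (h.escape hD hn (isCompact_singleton (x := z)) (by simpa using hz.2))).exists
    have hDn := h.sec (hD.1 n)
    have h1 : (D n ∩ bdIn U G).Nonempty := by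
      by_contra hc
      exact hDnG n (subset_of_avoid_bdIn hDn.conn.isPreconnected hDn.sub hG.isOpen (hDG n)
        (not_nonempty_iff_eq_empty.1 hc))
    have h2 : bdIn U G ⊆ D n := by
      refine subset_of_avoid_bdIn hG.bd_conn.isPreconnected inter_subset_right hDn.isOpen
        (inter_comm _ _ ▸ h1) ?_
      rw [inter_comm]
      exact subset_empty_iff.1 ((inter_subset_inter_right _ subset_closure).trans hn1.subset)
    exact Set.eq_empty_iff_forall_notMem.1 hn2 z ⟨h2 hz, rfl⟩
  rcases hn.2 _ _ hE.bd_cpt hF.bd_cpt hE.bd_sub hF.bd_sub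
    (Set.disjoint_iff_inter_eq_empty.2 hEF) with h1 | h1
  · exact key E hE (fun n => (hDF n).mono (inter_subset_inter_right _ hFE)) hcon h1
  · exact key F hF hDF (fun n hs => hcon n (hs.trans hFE)) h1

/-- A null chain meeting every member of a chain divides it. -/
theorem Dom.divides_of_meets (h : Dom S U) {S' : Set (ℝ × ℝ)} (hSS : S' ⊆ S)
    {D C : ℕ → Set (ℝ × ℝ)}
    (hD : PlaneChain S U D) (hn : NullSeq S U D) (hC : PlaneChain S' U C)
    (hm : ∀ n k, (D n ∩ C k).Nonempty) : ChainDivides D C := fun k =>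
  h.dichotomy hD hn (h.sec ((hC.1 k).mono hSS)) (h.sec ((hC.1 (k + 1)).mono hSS))
    (hC.2.1 _ _ (Nat.le_succ k)) (hC.2.2 _ _ (Nat.lt_succ_self k).ne) (fun n => hm n (k + 1))

theorem PlaneChain.meets_of_divides {D C : ℕ → Set (ℝ × ℝ)} (h : Dom S U)
    (hD : PlaneChain S U D) (hd : ChainDivides D C) (n k : ℕ) : (D n ∩ C k).Nonempty := by
  obtain ⟨m, hm⟩ := hd k
  obtain ⟨x, hx⟩ := (h.sec (hD.1 (max n m))).conn.nonempty
  exact ⟨x, hD.2.1 _ _ (le_max_left _ _) hx, hm (hD.2.1 _ _ (le_max_right _ _) hx)⟩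

theorem Dom.prime_of_null (h : Dom S U) {D D' : ℕ → Set (ℝ × ℝ)} (hD : PlaneChain S U D)
    (hn : NullSeq S U D) (hD' : PlaneChain S U D') (hd : ChainDivides D' D) :
    ChainDivides D D' :=
  h.divides_of_meets Subset.rfl hD hn hD' fun n k =>
    inter_comm (D' k) (D n) ▸ hD'.meets_of_divides h hd k n

theorem Dom.exists_null (h : Dom S U) {𝓕 : Ultrafilter (ℝ × ℝ)} (hU𝓕 : U ∈ 𝓕)
    (hlim : ∀ x ∈ U, ¬ (𝓕 : Filter (ℝ × ℝ)) ≤ 𝓝 x) :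
    ∃ D, PlaneChain S U D ∧ NullSeq S U D ∧ ∀ m, D m ∈ 𝓕 :=
  exists_null_chain h.isOpen h.preconn h.sc h.openS h.preconnS h.sub h.ne hU𝓕 hlim

theorem Dom.refine (h : Dom S U) {S' : Set (ℝ × ℝ)} (hSS : S' ⊆ S) {C : ℕ → Set (ℝ × ℝ)}
    (hC : PlaneChain S' U C) :
    ∃ D, PlaneChain S U D ∧ NullSeq S U D ∧ ChainDivides D C := by
  have hCs : ∀ n, Sec S U (C n) := fun n => h.sec ((hC.1 n).mono hSS)
  obtain ⟨E, hEc, hEs, hEU, hEex⟩ := exists_exhaustion h.isOpen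
  have hx : ∀ n, ∃ x, x ∈ C n ∧ x ∉ E n := fun n =>
    not_subset.1 ((hCs n).not_cpt (E n) (hEc n) (hEU n))
  choose x hxC hxE using hx
  let 𝓕 : Ultrafilter (ℝ × ℝ) := Ultrafilter.of (map x atTop)
  have hle : (𝓕 : Filter (ℝ × ℝ)) ≤ map x atTop := Ultrafilter.of_le _
  have hC𝓕 : ∀ n, C n ∈ 𝓕 := fun n => hle (mem_map.2 (by
    filter_upwards [eventually_ge_atTop n] with k hk
    exact hC.2.1 k n hk (hxC k)))
  have hlim : ∀ y ∈ U, ¬ (𝓕 : Filter (ℝ × ℝ)) ≤ 𝓝 y := by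
    intro y hy hyle
    obtain ⟨r, hr, hrU⟩ := Metric.nhds_basis_closedBall.mem_iff.1 (h.isOpen.mem_nhds hy)
    have h1 : (Metric.closedBall y r)ᶜ ∈ 𝓕 := hle (mem_map.2 (by
      filter_upwards [hEex _ (isCompact_closedBall y r) hrU] with k hk
      exact fun hc => hxE k (hk hc)))
    have h2 := inter_mem h1 (hyle (Metric.closedBall_mem_nhds y hr))
    rw [compl_inter_self] at h2
    exact empty_notMem _ h2
  obtain ⟨D, hD, hDn, hD𝓕⟩ := h.exists_null (mem_of_superset (hC𝓕 0) (hCs 0).sub) hlim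
  exact ⟨D, hD, hDn, h.divides_of_meets hSS hD hDn hC fun n k =>
    𝓕.nonempty_of_mem (inter_mem (hD𝓕 n) (hC𝓕 k))⟩

end

section Transfer

variable {X : Type} [TopologicalSpace X] {e : X → ℝ × ℝ}

theorem image_connectedComponentIn' (he : IsOpenEmbedding e) {F : Set X} {x : X} (hx : x ∈ F) :
    e '' connectedComponentIn F x = connectedComponentIn (e '' F) (e x) := by
  apply Subset.antisymm
  · exact (isPreconnected_connectedComponentIn.image e he.continuous.continuousOn).subset_connectedComponentIn
      (mem_image_of_mem e (mem_connectedComponentIn hx)) (image_mono (connectedComponentIn_subset _ _))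
  · have hsub : connectedComponentIn (e '' F) (e x) ⊆ e '' F := connectedComponentIn_subset _ _
    have him : e '' (e ⁻¹' connectedComponentIn (e '' F) (e x)) =
        connectedComponentIn (e '' F) (e x) :=
      image_preimage_eq_of_subset (hsub.trans (image_subset_range _ _))
    rw [← him]
    refine image_mono (IsPreconnected.subset_connectedComponentIn ?_ ?_ ?_)
    · rw [← he.isInducing.isPreconnected_image, him]
      exact isPreconnected_connectedComponentIn
    · exact mem_connectedComponentIn (mem_image_of_mem e hx)
    · intro y hy
      obtain ⟨z, hz, hzy⟩ := hsub hy
      rwa [← he.injective hzy]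

theorem isCompOf_image (he : IsOpenEmbedding e) {F D : Set X} :
    IsCompOf (e '' F) (e '' D) ↔ IsCompOf F D := by
  constructor
  · rintro ⟨_, ⟨x, hx, rfl⟩, h⟩
    rw [← image_connectedComponentIn' he hx] at h
    exact ⟨x, hx, he.injective.image_injective h⟩
  · rintro ⟨x, hx, rfl⟩
    exact ⟨e x, mem_image_of_mem e hx, image_connectedComponentIn' he hx⟩

theorem hasTwoComps_image (he : IsOpenEmbedding e) {F D₁ D₂ : Set X} :
    HasTwoComps (e '' F) (e '' D₁) (e '' D₂) ↔ HasTwoComps F D₁ D₂ := by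
  unfold HasTwoComps
  rw [isCompOf_image he, isCompOf_image he, he.injective.image_injective.ne_iff]
  refine and_congr_right fun _ => and_congr_right fun _ => and_congr_right fun _ => ?_
  rw [forall_mem_image]
  refine forall₂_congr fun x hx => ?_
  rw [← image_connectedComponentIn' he hx, he.injective.image_injective.eq_iff,
    he.injective.image_injective.eq_iff]

theorem image_frontier' (he : IsOpenEmbedding e) (D : Set X) :
    e '' frontier D = frontier (e '' D) ∩ range e := by
  rw [← image_preimage_eq_inter_range, he.isOpenMap.preimage_frontier_eq_frontier_preimage
    he.continuous, preimage_image_eq _ he.injective]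

/-- Cross-sections of the preimage of `U` under an open embedding, given by a fixed arc. -/
theorem crossSection_arc_iff (he : IsOpenEmbedding e) {U : Set (ℝ × ℝ)} (hU : U ⊆ range e)
    {E : Set X} (g : ℝ → X) :
    (ContinuousOn g (Icc 0 1) ∧ InjOn g (Ioo 0 1) ∧ (∀ t ∈ Ioo (0:ℝ) 1, g t ∈ e ⁻¹' U) ∧
      g 0 ∈ frontier (e ⁻¹' U) ∧ g 1 ∈ frontier (e ⁻¹' U) ∧
      ∃ D₁ D₂ : Set X, HasTwoComps (e ⁻¹' U \ g '' Ioo 0 1) D₁ D₂ ∧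
        (frontier D₁ ∩ (frontier (e ⁻¹' U) \ g '' Icc 0 1)).Nonempty ∧
        (frontier D₂ ∩ (frontier (e ⁻¹' U) \ g '' Icc 0 1)).Nonempty ∧
        IsCompOf (e ⁻¹' U \ g '' Ioo 0 1) E) ↔
    (ContinuousOn (e ∘ g) (Icc 0 1) ∧ InjOn (e ∘ g) (Ioo 0 1) ∧
      (∀ t ∈ Ioo (0:ℝ) 1, (e ∘ g) t ∈ U) ∧
      (e ∘ g) 0 ∈ frontier U ∩ range e ∧ (e ∘ g) 1 ∈ frontier U ∩ range e ∧
      ∃ D₁ D₂ : Set (ℝ × ℝ), HasTwoComps (U \ (e ∘ g) '' Ioo 0 1) D₁ D₂ ∧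
        (frontier D₁ ∩ (frontier U \ (e ∘ g) '' Icc 0 1) ∩ range e).Nonempty ∧
        (frontier D₂ ∩ (frontier U \ (e ∘ g) '' Icc 0 1) ∩ range e).Nonempty ∧
        IsCompOf (U \ (e ∘ g) '' Ioo 0 1) (e '' E)) := by
  have hUe : e '' (e ⁻¹' U) = U := image_preimage_eq_of_subset hU
  have hfr : frontier (e ⁻¹' U) = e ⁻¹' frontier U :=
    (he.isOpenMap.preimage_frontier_eq_frontier_preimage he.continuous U).symm
  have hM : U \ (e ∘ g) '' Ioo 0 1 = e '' (e ⁻¹' U \ g '' Ioo 0 1) := by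
    rw [image_sdiff he.injective, hUe, image_comp]
  have hne : ∀ D : Set X, (frontier D ∩ (frontier (e ⁻¹' U) \ g '' Icc 0 1)).Nonempty ↔
      (frontier (e '' D) ∩ (frontier U \ (e ∘ g) '' Icc 0 1) ∩ range e).Nonempty := by
    intro D
    rw [← image_nonempty (f := e), image_inter he.injective, image_frontier' he,
      image_sdiff he.injective, image_frontier' he, hUe, ← image_comp]
    refine iff_of_eq (congrArg _ ?_)
    ext x; simp only [mem_inter_iff, Set.mem_sdiff]; tauto
  refine and_congr he.isInducing.continuousOn_iff (and_congr ?_ (and_congr Iff.rfl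
    (and_congr ?_ (and_congr ?_ ?_))))
  · exact ⟨fun h => he.injective.injOn.comp h (mapsTo_univ g _), fun h x hx y hy hxy =>
      h hx hy (congrArg e hxy)⟩
  · rw [hfr]; simp
  · rw [hfr]; simp
  · constructor
    · rintro ⟨D₁, D₂, h, h1, h2, hE⟩
      refine ⟨e '' D₁, e '' D₂, ?_, (hne _).1 h1, (hne _).1 h2, ?_⟩
      · rw [hM]; exact (hasTwoComps_image he).2 h
      · rw [hM]; exact (isCompOf_image he).2 hE
    · rintro ⟨D₁, D₂, h, h1, h2, hE⟩
      have hD : ∀ D, IsCompOf (U \ (e ∘ g) '' Ioo 0 1) D → ∃ D', e '' D' = D := fun D hD =>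
        ⟨_, image_preimage_eq_of_subset (hD.subset.trans (sdiff_subset.trans hU))⟩
      obtain ⟨D₁, rfl⟩ := hD _ h.1
      obtain ⟨D₂, rfl⟩ := hD _ h.2.1
      rw [hM] at h hE
      exact ⟨D₁, D₂, (hasTwoComps_image he).1 h, (hne _).2 h1, (hne _).2 h2,
        (isCompOf_image he).1 hE⟩

theorem crossSection_iff (he : IsOpenEmbedding e) {U : Set (ℝ × ℝ)} (hU : U ⊆ range e)
    {E : Set X} : IsCrossSection (e ⁻¹' U) E ↔ PlaneCS (range e) U (e '' E) := by
  constructor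
  · rintro ⟨_, ⟨g, hg, hgi, hgU, h0, h1, rfl, D₁, D₂, h, hf1, hf2⟩, hE⟩
    exact ⟨e ∘ g, (crossSection_arc_iff he hU g).1
      ⟨hg, hgi, hgU, h0, h1, D₁, D₂, h, hf1, hf2, hE⟩⟩
  · rintro ⟨g, hP⟩
    have hgr : ∀ t ∈ Icc (0:ℝ) 1, g t ∈ range e := by
      intro t ht
      rcases eq_or_lt_of_le ht.1 with rfl | ht0
      · exact hP.2.2.2.1.2
      rcases eq_or_lt_of_le ht.2 with rfl | ht1
      · exact hP.2.2.2.2.1.2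
      exact hU (hP.2.2.1 t ⟨ht0, ht1⟩)
    obtain ⟨x₀, -⟩ := hgr 0 (by simp)
    have : Nonempty X := ⟨x₀⟩
    let g' : ℝ → X := fun t => Function.invFun e (g t)
    have hgg : ∀ t ∈ Icc (0:ℝ) 1, (e ∘ g') t = g t := fun t ht =>
      Function.invFun_eq (hgr t ht)
    have hgo : ∀ t ∈ Ioo (0:ℝ) 1, (e ∘ g') t = g t := fun t ht => hgg t (Ioo_subset_Icc_self ht)
    have hi1 : (e ∘ g') '' Icc 0 1 = g '' Icc 0 1 := image_congr hgg
    have hi2 : (e ∘ g') '' Ioo 0 1 = g '' Ioo 0 1 := image_congr hgo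
    obtain ⟨hg, hgi, hgU, h0, h1, D₁, D₂, h, hf1, hf2, hE⟩ := hP
    have := (crossSection_arc_iff he hU (E := E) g').2 ⟨hg.congr hgg, hgi.congr fun t ht =>
      (hgo t ht).symm, fun t ht => (hgo t ht).symm ▸ hgU t ht, (hgg 0 (by simp)).symm ▸ h0,
      (hgg 1 (by simp)).symm ▸ h1, D₁, D₂, hi2.symm ▸ h, hi1.symm ▸ hf1, hi1.symm ▸ hf2,
      hi2.symm ▸ hE⟩
    obtain ⟨hg, hgi, hgU, h0, h1, D₁, D₂, h, hf1, hf2, hE⟩ := this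
    exact ⟨_, ⟨g', hg, hgi, hgU, h0, h1, rfl, D₁, D₂, h, hf1, hf2⟩, hE⟩

theorem image_closure' (he : IsOpenEmbedding e) (D : Set X) :
    e '' closure D = closure (e '' D) ∩ range e := by
  rw [he.isInducing.closure_eq_preimage_closure_image, image_preimage_eq_inter_range]

theorem image_bdIn (he : IsOpenEmbedding e) {U : Set (ℝ × ℝ)} (hU : U ⊆ range e)
    (D : Set X) : e '' bdIn (e ⁻¹' U) D = bdIn U (e '' D) := by
  unfold bdIn
  rw [image_inter he.injective, image_sdiff he.injective, image_closure' he,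
    image_preimage_eq_of_subset hU]
  ext x; simp only [mem_inter_iff, Set.mem_sdiff]
  have := @hU x
  tauto

theorem chain_iff (he : IsOpenEmbedding e) {U : Set (ℝ × ℝ)} (h : Dom (range e) U)
    {D : ℕ → Set X} : IsPEChain (e ⁻¹' U) D ↔ PlaneChain (range e) U fun n => e '' D n := by
  unfold IsPEChain PlaneChain
  simp only [crossSection_iff he h.sub, image_subset_image_iff he.injective]
  refine and_congr_right fun hCS => and_congr Iff.rfl (forall₃_congr fun i j _ => ?_)
  rw [← image_eq_empty (f := e), image_inter he.injective, image_closure' he, image_closure' he,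
    image_bdIn he h.sub, image_bdIn he h.sub,
    inter_eq_self_of_subset_left (h.sec (hCS i)).bd_sub,
    inter_eq_self_of_subset_left (h.sec (hCS j)).bd_sub]

theorem divides_image (he : IsOpenEmbedding e) {C D : ℕ → Set X} :
    ChainDivides (fun n => e '' C n) (fun n => e '' D n) ↔ ChainDivides C D := by
  simp only [ChainDivides, image_subset_image_iff he.injective]

end Transfer

theorem chainDivides_refl {A : Type*} (C : ℕ → Set A) : ChainDivides C C :=
  fun n => ⟨n, Subset.rfl⟩

theorem chainDivides_trans {A : Type*} {C D E : ℕ → Set A} (h : ChainDivides C D)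
    (h' : ChainDivides D E) : ChainDivides C E := fun n => by
  obtain ⟨m, hm⟩ := h' n
  obtain ⟨k, hk⟩ := h m
  exact ⟨k, hk.trans hm⟩

theorem exists_image_chain {X : Type*} {e : X → ℝ × ℝ} {U : Set (ℝ × ℝ)}
    {D : ℕ → Set (ℝ × ℝ)} (h : Dom (range e) U) (hD : PlaneChain (range e) U D) :
    ∃ C : ℕ → Set X, D = fun n => e '' C n :=
  ⟨fun n => e ⁻¹' D n, funext fun n =>
    (image_preimage_eq_of_subset ((h.sec (hD.1 n)).sub.trans h.sub)).symm⟩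

section Rep

variable {X : Type} [TopologicalSpace X] {e : X → ℝ × ℝ} {U : Set (ℝ × ℝ)}

theorem primeEnd_eq_iff {W : Set X} {C C' : PrimeChain W} :
    (Quot.mk _ C : PrimeEnd W) = Quot.mk _ C' ↔
      ChainDivides C.1 C'.1 ∧ ChainDivides C'.1 C.1 := by
  refine Quot.eq.trans (Equivalence.eqvGen_iff ⟨?_, ?_, ?_⟩)
  · exact fun C => ⟨chainDivides_refl _, chainDivides_refl _⟩
  · exact fun h => ⟨h.2, h.1⟩
  · exact fun h h' => ⟨chainDivides_trans h.1 h'.1, chainDivides_trans h'.2 h.2⟩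

/-- The sequence `D` of subsets of the plane represents the prime end `p`. -/
def Rep (e : X → ℝ × ℝ) (U : Set (ℝ × ℝ)) (p : PrimeEnd (e ⁻¹' U)) (D : ℕ → Set (ℝ × ℝ)) : Prop :=
  ∃ C : PrimeChain (e ⁻¹' U), Quot.mk _ C = p ∧ D = fun n => e '' C.1 n

theorem exists_rep (p : PrimeEnd (e ⁻¹' U)) : ∃ D, Rep e U p D := by
  obtain ⟨C, rfl⟩ := Quot.exists_rep p
  exact ⟨_, C, rfl, rfl⟩

variable {p p' : PrimeEnd (e ⁻¹' U)} {D D' : ℕ → Set (ℝ × ℝ)}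

theorem Rep.chain (he : IsOpenEmbedding e) (h : Dom (range e) U) (hD : Rep e U p D) :
    PlaneChain (range e) U D := by
  obtain ⟨C, -, rfl⟩ := hD
  exact (chain_iff he h).1 C.2.1

theorem Rep.prime (he : IsOpenEmbedding e) (h : Dom (range e) U) (hD : Rep e U p D)
    (hD' : PlaneChain (range e) U D') (hd : ChainDivides D' D) : ChainDivides D D' := by
  obtain ⟨C, -, rfl⟩ := hD
  obtain ⟨C', rfl⟩ := exists_image_chain h hD'
  exact (divides_image he).2 (C.2.2 C' ((chain_iff he h).2 hD') ((divides_image he).1 hd))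

theorem rep_of_prime (he : IsOpenEmbedding e) (h : Dom (range e) U)
    (hD : PlaneChain (range e) U D)
    (hp : ∀ D', PlaneChain (range e) U D' → ChainDivides D' D → ChainDivides D D') :
    ∃ p, Rep e U p D := by
  obtain ⟨C, rfl⟩ := exists_image_chain h hD
  refine ⟨Quot.mk _ ⟨C, (chain_iff he h).2 hD, fun C' hC' hd => ?_⟩, _, rfl, rfl⟩
  exact (divides_image he).1 (hp _ ((chain_iff he h).1 hC') ((divides_image he).2 hd))

theorem rep_of_null (he : IsOpenEmbedding e) (h : Dom (range e) U)
    (hD : PlaneChain (range e) U D) (hn : NullSeq (range e) U D) : ∃ p, Rep e U p D :=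
  rep_of_prime he h hD fun _ hD' hd => h.prime_of_null hD hn hD' hd

theorem Rep.divides (he : IsOpenEmbedding e) (hD : Rep e U p D) (hD' : Rep e U p D') :
    ChainDivides D D' := by
  obtain ⟨C, rfl, rfl⟩ := hD
  obtain ⟨C', hC', rfl⟩ := hD'
  exact (divides_image he).2 (primeEnd_eq_iff.1 hC').2

theorem Rep.unique (he : IsOpenEmbedding e) (h : Dom (range e) U) (hD : Rep e U p D)
    (hD' : Rep e U p' D') (hd : ChainDivides D D') : p = p' := by
  have hd' := hD'.prime he h (hD.chain he h) hd
  obtain ⟨C, rfl, rfl⟩ := hD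
  obtain ⟨C', rfl, rfl⟩ := hD'
  exact primeEnd_eq_iff.2 ⟨(divides_image he).1 hd, (divides_image he).1 hd'⟩

theorem exists_null_rep (he : IsOpenEmbedding e) (h : Dom (range e) U) (p : PrimeEnd (e ⁻¹' U)) :
    ∃ D, Rep e U p D ∧ NullSeq (range e) U D := by
  obtain ⟨C, hC⟩ := exists_rep p
  obtain ⟨D, hD, hDn, hd⟩ := h.refine Subset.rfl (hC.chain he h)
  obtain ⟨p', hp'⟩ := rep_of_null he h hD hDn
  rw [hp'.unique he h hC hd] at hp'
  exact ⟨D, hp', hDn⟩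

theorem rep_unique_of_meets (he : IsOpenEmbedding e) (h : Dom (range e) U) (hD : Rep e U p D)
    (hD' : Rep e U p' D') (hm : ∀ n k, (D n ∩ D' k).Nonempty) : p = p' := by
  obtain ⟨E, hE, hEn⟩ := exists_null_rep he h p
  refine hE.unique he h hD' (h.divides_of_meets Subset.rfl (hE.chain he h) hEn (hD'.chain he h) ?_)
  intro n k
  obtain ⟨m, hm'⟩ := hD.divides he hE n
  exact (hm m k).mono (inter_subset_inter_left _ hm')

theorem primeEndDivides_iff (he : IsOpenEmbedding e) (h : Dom (range e) U) (hD : Rep e U p D)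
    {E : Set X} : PrimeEndDivides p E ↔ ∃ n, D n ⊆ e '' E := by
  constructor
  · rintro ⟨C, hC, N, hN⟩
    have hr : Rep e U p fun n => e '' C.1 n := ⟨C, hC, rfl⟩
    obtain ⟨m, hm⟩ := hD.divides he hr N
    exact ⟨m, hm.trans (image_mono (hN N le_rfl))⟩
  · rintro ⟨n, hn⟩
    have hDc := hD.chain he h
    obtain ⟨C, hC, rfl⟩ := hD
    exact ⟨C, hC, n, fun i hi => (image_subset_image_iff he.injective).1
      ((hDc.2.1 i n hi).trans hn)⟩

/-- The basic neighbourhood defined by a cross-section of the plane domain. -/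
def nbd (e : X → ℝ × ℝ) (U E : Set (ℝ × ℝ)) : Set (PrimeEndComp (e ⁻¹' U)) :=
  peSection (e ⁻¹' U) (e ⁻¹' E)

/-- The points of the plane domain lying in a subset of the prime ends compactification. -/
def trace (e : X → ℝ × ℝ) (U : Set (ℝ × ℝ)) (O : Set (PrimeEndComp (e ⁻¹' U))) : Set (ℝ × ℝ) :=
  e '' {x | ∃ hx : x ∈ e ⁻¹' U, pePt (e ⁻¹' U) ⟨x, hx⟩ ∈ O}

theorem pePt_mem_peOpen {W V : Set X} {x : W} : pePt W x ∈ peOpen W V ↔ (x : X) ∈ V := by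
  constructor
  · rintro ⟨y, hy, hyV⟩
    rwa [Sum.inl.inj hy]
  · exact fun h => ⟨x, rfl, h⟩

theorem peEnd_notMem_peOpen {W V : Set X} {p : PrimeEnd W} : peEnd W p ∉ peOpen W V := by
  rintro ⟨y, hy, -⟩
  exact Sum.inr_ne_inl hy

theorem pePt_mem_peSection {W E : Set X} {x : W} : pePt W x ∈ peSection W E ↔ (x : X) ∈ E := by
  refine ⟨fun h => h.elim pePt_mem_peOpen.1 ?_, fun h => Or.inl (pePt_mem_peOpen.2 h)⟩
  rintro ⟨p, hp, -⟩
  exact absurd hp Sum.inl_ne_inr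

theorem peEnd_mem_peSection {W E : Set X} {p : PrimeEnd W} :
    peEnd W p ∈ peSection W E ↔ PrimeEndDivides p E := by
  refine ⟨fun h => h.elim (fun h => absurd h peEnd_notMem_peOpen) ?_, fun h => Or.inr ⟨p, rfl, h⟩⟩
  rintro ⟨p', hp', h⟩
  rwa [Sum.inr.inj hp']

theorem trace_nbd (h : Dom (range e) U) {E : Set (ℝ × ℝ)} (hE : E ⊆ U) :
    trace e U (nbd e U E) = E := by
  ext y
  constructor
  · rintro ⟨x, ⟨hx, hxE⟩, rfl⟩
    exact pePt_mem_peSection.1 hxE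
  · intro hy
    obtain ⟨x, rfl⟩ := h.sub (hE hy)
    exact ⟨x, ⟨hE hy, pePt_mem_peSection.2 hy⟩, rfl⟩

theorem peEnd_mem_nbd (he : IsOpenEmbedding e) (h : Dom (range e) U) (hD : Rep e U p D)
    {E : Set (ℝ × ℝ)} (hE : E ⊆ U) : peEnd (e ⁻¹' U) p ∈ nbd e U E ↔ ∃ n, D n ⊆ E := by
  rw [nbd, peEnd_mem_peSection, primeEndDivides_iff he h hD,
    image_preimage_eq_of_subset (hE.trans h.sub)]

theorem isOpen_nbd (he : IsOpenEmbedding e) (h : Dom (range e) U) {E : Set (ℝ × ℝ)}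
    (hE : PlaneCS (range e) U E) : IsOpen (nbd e U E) := by
  refine TopologicalSpace.isOpen_generateFrom_of_mem (Or.inr ⟨e ⁻¹' E, ?_, rfl⟩)
  rw [crossSection_iff he h.sub,
    image_preimage_eq_of_subset ((h.sec hE).sub.trans h.sub)]
  exact hE

theorem trace_inter (he : IsOpenEmbedding e) (O O' : Set (PrimeEndComp (e ⁻¹' U))) :
    trace e U (O ∩ O') = trace e U O ∩ trace e U O' := by
  unfold trace
  rw [← image_inter he.injective]
  congr 1
  ext x
  exact ⟨fun ⟨h, h1, h2⟩ => ⟨⟨h, h1⟩, h, h2⟩, fun ⟨⟨h, h1⟩, _, h2⟩ => ⟨h, h1, h2⟩⟩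

theorem trace_mono {O O' : Set (PrimeEndComp (e ⁻¹' U))} (h : O ⊆ O') :
    trace e U O ⊆ trace e U O' := image_mono fun _ ⟨hx, hO⟩ => ⟨hx, h hO⟩

theorem isOpen_trace (he : IsOpenEmbedding e) (h : Dom (range e) U)
    {O : Set (PrimeEndComp (e ⁻¹' U))} (hO : IsOpen O) : IsOpen (trace e U O) := by
  induction hO with
  | basic s hs =>
    rcases hs with ⟨V, hV, hVU, rfl⟩ | ⟨E, hE, rfl⟩
    · have : trace e U (peOpen (e ⁻¹' U) V) = e '' V := by
        unfold trace
        congr 1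
        ext x
        exact ⟨fun ⟨_, hx⟩ => pePt_mem_peOpen.1 hx, fun hx => ⟨hVU hx, pePt_mem_peOpen.2 hx⟩⟩
      rw [this]
      exact he.isOpenMap V hV
    · have hs := h.sec ((crossSection_iff he h.sub).1 hE)
      have := trace_nbd h hs.sub
      rw [nbd, preimage_image_eq _ he.injective] at this
      rw [this]; exact hs.isOpen
  | univ =>
    have : trace e U univ = U := by
      ext y
      constructor
      · rintro ⟨x, ⟨hx, -⟩, rfl⟩; exact hx
      · intro hy
        obtain ⟨x, rfl⟩ := h.sub hy
        exact ⟨x, ⟨hy, trivial⟩, rfl⟩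
    rw [this]; exact h.isOpen
  | inter s t _ _ hs ht => rw [trace_inter he]; exact hs.inter ht
  | sUnion S _ hS =>
    have : trace e U (⋃₀ S) = ⋃ s ∈ S, trace e U s := by
      ext y
      simp only [mem_iUnion]
      constructor
      · rintro ⟨x, ⟨hx, s, hs, hxs⟩, rfl⟩; exact ⟨s, hs, x, ⟨hx, hxs⟩, rfl⟩
      · rintro ⟨s, hs, x, ⟨hx, hxs⟩, rfl⟩; exact ⟨x, ⟨hx, s, hs, hxs⟩, rfl⟩
    rw [this]; exact isOpen_biUnion hS

theorem exists_nbd_subset (he : IsOpenEmbedding e) (h : Dom (range e) U) (hD : Rep e U p D)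
    {O : Set (PrimeEndComp (e ⁻¹' U))} (hO : IsOpen O) (hp : peEnd (e ⁻¹' U) p ∈ O) :
    ∃ m, nbd e U (D m) ⊆ O := by
  have hDc := hD.chain he h
  have hmono : ∀ {E E' : Set X}, E ⊆ E' → peSection (e ⁻¹' U) E ⊆ peSection (e ⁻¹' U) E' := by
    rintro E E' hEE z (⟨x, rfl, hx⟩ | ⟨q, rfl, C, hC, N, hN⟩)
    · exact pePt_mem_peSection.2 (hEE hx)
    · exact peEnd_mem_peSection.2 ⟨C, hC, N, fun i hi => (hN i hi).trans hEE⟩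
  induction hO with
  | basic s hs =>
    rcases hs with ⟨V, hV, hVU, rfl⟩ | ⟨E, hE, rfl⟩
    · exact absurd hp peEnd_notMem_peOpen
    · obtain ⟨n, hn⟩ := (primeEndDivides_iff he h hD).1 (peEnd_mem_peSection.1 hp)
      refine ⟨n, hmono ?_⟩
      exact (preimage_mono hn).trans (preimage_image_eq _ he.injective).subset
  | univ => exact ⟨0, subset_univ _⟩
  | inter s t _ _ hs ht =>
    obtain ⟨m, hm⟩ := hs hp.1
    obtain ⟨k, hk⟩ := ht hp.2
    exact ⟨max m k, subset_inter ((hmono (preimage_mono (hDc.2.1 _ _ (le_max_left m k)))).trans hm)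
      ((hmono (preimage_mono (hDc.2.1 _ _ (le_max_right m k)))).trans hk)⟩
  | sUnion S _ hS =>
    obtain ⟨s, hs, hps⟩ := hp
    obtain ⟨m, hm⟩ := hS s hs hps
    exact ⟨m, hm.trans (subset_sUnion_of_mem hs)⟩

end Rep

section Change

variable {X₁ X₂ : Type} [TopologicalSpace X₁] [TopologicalSpace X₂] {e₁ : X₁ → ℝ × ℝ}
  {e₂ : X₂ → ℝ × ℝ} {U : Set (ℝ × ℝ)}

/-- The prime end `q` relative to the second surface is the image of the prime end `p`. -/
def Rel (p : PrimeEnd (e₁ ⁻¹' U)) (q : PrimeEnd (e₂ ⁻¹' U)) : Prop :=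
  ∃ D C, Rep e₁ U p D ∧ Rep e₂ U q C ∧ ChainDivides D C

variable {p : PrimeEnd (e₁ ⁻¹' U)} {q q' : PrimeEnd (e₂ ⁻¹' U)} {D C : ℕ → Set (ℝ × ℝ)}

theorem Rel.divides (he₁ : IsOpenEmbedding e₁) (he₂ : IsOpenEmbedding e₂) (hr : Rel p q)
    (hD : Rep e₁ U p D) (hC : Rep e₂ U q C) : ChainDivides D C := by
  obtain ⟨D', C', hD', hC', hd⟩ := hr
  exact chainDivides_trans (hD.divides he₁ hD') (chainDivides_trans hd (hC'.divides he₂ hC))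

theorem Rel.unique (he₁ : IsOpenEmbedding e₁) (he₂ : IsOpenEmbedding e₂)
    (h₁ : Dom (range e₁) U) (h₂ : Dom (range e₂) U) (hr : Rel p q) (hr' : Rel p q') : q = q' := by
  obtain ⟨D, hD⟩ := exists_rep p
  obtain ⟨C, hC⟩ := exists_rep q
  obtain ⟨C', hC'⟩ := exists_rep q'
  refine rep_unique_of_meets he₂ h₂ hC hC' fun n k => ?_
  obtain ⟨m, hm⟩ := hr.divides he₁ he₂ hD hC n
  exact ((hD.chain he₁ h₁).meets_of_divides h₁ (hr'.divides he₁ he₂ hD hC') m k).mono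
    (inter_subset_inter_left _ hm)

theorem exists_rel (he₁ : IsOpenEmbedding e₁) (he₂ : IsOpenEmbedding e₂)
    (h₁ : Dom (range e₁) U) (h₂ : Dom (range e₂) U) (hsub : range e₂ ⊆ range e₁)
    (p : PrimeEnd (e₁ ⁻¹' U)) : ∃ q : PrimeEnd (e₂ ⁻¹' U), Rel p q := by
  obtain ⟨D, hD, hDn⟩ := exists_null_rep he₁ h₁ p
  have hDc := hD.chain he₁ h₁
  choose x hx using fun n => (h₁.sec (hDc.1 n)).conn.nonempty
  let 𝓕 : Ultrafilter (ℝ × ℝ) := Ultrafilter.of (map x atTop)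
  have h𝓕 : ∀ n, D n ∈ 𝓕 := fun n =>
    Ultrafilter.of_le (map x atTop) (mem_map.2 (mem_atTop_sets.2
      ⟨n, fun m hm => hDc.2.1 m n hm (hx m)⟩))
  obtain ⟨C, hC, hCn, hC𝓕⟩ := h₂.exists_null (mem_of_superset (h𝓕 0) (h₁.sec (hDc.1 0)).sub)
    (h₁.hlim_of_chain hDc hDn h𝓕)
  obtain ⟨q, hq⟩ := rep_of_null he₂ h₂ hC hCn
  exact ⟨q, D, C, hD, hq, h₁.divides_of_meets hsub hDc hDn hC fun n k =>
    𝓕.nonempty_of_mem (inter_mem (h𝓕 n) (hC𝓕 k))⟩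

theorem exists_rel' (he₁ : IsOpenEmbedding e₁) (he₂ : IsOpenEmbedding e₂)
    (h₁ : Dom (range e₁) U) (h₂ : Dom (range e₂) U) (hsub : range e₂ ⊆ range e₁)
    (q : PrimeEnd (e₂ ⁻¹' U)) : ∃ p : PrimeEnd (e₁ ⁻¹' U), Rel p q := by
  obtain ⟨C, hC⟩ := exists_rep q
  obtain ⟨D, hD, hDn, hd⟩ := h₁.refine hsub (hC.chain he₂ h₂)
  obtain ⟨p, hp⟩ := rep_of_null he₁ h₁ hD hDn
  exact ⟨p, D, C, hp, hC, hd⟩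

theorem exists_end_of_ultrafilter (he₁ : IsOpenEmbedding e₁) (he₂ : IsOpenEmbedding e₂)
    (h₁ : Dom (range e₁) U) (h₂ : Dom (range e₂) U) (hsub : range e₂ ⊆ range e₁)
    (hC : Rep e₂ U q C) {𝓕 : Ultrafilter (ℝ × ℝ)} (h𝓕 : ∀ n, C n ∈ 𝓕) :
    ∃ (d : PrimeEnd (e₁ ⁻¹' U)) (D : _), Rep e₁ U d D ∧ (∀ m, D m ∈ 𝓕) ∧ Rel d q := by
  obtain ⟨C', hC', hCn'⟩ := exists_null_rep he₂ h₂ q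
  have h𝓕' : ∀ n, C' n ∈ 𝓕 := fun n => by
    obtain ⟨m, hm⟩ := hC.divides he₂ hC' n
    exact mem_of_superset (h𝓕 m) hm
  have hCc' := hC'.chain he₂ h₂
  obtain ⟨D, hD, hDn, hD𝓕⟩ := h₁.exists_null (mem_of_superset (h𝓕' 0) (h₂.sec (hCc'.1 0)).sub)
    (h₂.hlim_of_chain hCc' hCn' h𝓕')
  obtain ⟨d, hd⟩ := rep_of_null he₁ h₁ hD hDn
  exact ⟨d, D, hd, hD𝓕, D, C', hd, hC', h₁.divides_of_meets hsub hD hDn hCc' fun n k =>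
    𝓕.nonempty_of_mem (inter_mem (hD𝓕 n) (h𝓕' k))⟩

/-- An ultrafilter converging to the end `d` cannot be finer than the neighbourhood filter of a
set of ends missing an open neighbourhood of `d`. -/
theorem not_trace_mem (he₁ : IsOpenEmbedding e₁) (h₁ : Dom (range e₁) U) {d : PrimeEnd (e₁ ⁻¹' U)}
    (hD : Rep e₁ U d D) {𝓕 : Ultrafilter (ℝ × ℝ)} (h𝓕 : ∀ m, D m ∈ 𝓕)
    {A F : Set (PrimeEndComp (e₁ ⁻¹' U))} (hA : IsOpen A) (hd : peEnd _ d ∈ A)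
    (hF : ∀ z ∈ F, ∃ p, z = peEnd _ p) (hFA : F ∩ A = ∅)
    (hO : ∀ O, IsOpen O → F ⊆ O → trace e₁ U O ∈ 𝓕) : False := by
  have hDc := hD.chain he₁ h₁
  obtain ⟨m, hm⟩ := exists_nbd_subset he₁ h₁ hD hA hd
  let O : Set (PrimeEndComp (e₁ ⁻¹' U)) :=
    ⋃₀ {s | ∃ E, PlaneCS (range e₁) U E ∧ E ∩ D (m + 1) = ∅ ∧ s = nbd e₁ U E}
  have hOo : IsOpen O := by
    apply isOpen_sUnion
    rintro _ ⟨E, hE, -, rfl⟩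
    exact isOpen_nbd he₁ h₁ hE
  have hFO : F ⊆ O := by
    intro z hz
    obtain ⟨p, rfl⟩ := hF z hz
    obtain ⟨P, hP, hPn⟩ := exists_null_rep he₁ h₁ p
    have hPc := hP.chain he₁ h₁
    obtain ⟨k, hk⟩ : ∃ k, P k ∩ D (m + 1) = ∅ := by
      by_contra! hcon
      obtain ⟨n, hn⟩ := h₁.dichotomy hPc hPn (h₁.sec (hDc.1 m)) (h₁.sec (hDc.1 (m + 1)))
        (hDc.2.1 _ _ (Nat.le_succ m)) (hDc.2.2 _ _ (Nat.succ_ne_self m).symm) hcon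
      have : peEnd _ p ∈ F ∩ A :=
        ⟨hz, hm ((peEnd_mem_nbd he₁ h₁ hP (h₁.sec (hDc.1 m)).sub).2 ⟨n, hn⟩)⟩
      rw [hFA] at this
      exact this
    exact ⟨_, ⟨P k, hPc.1 k, hk, rfl⟩,
      (peEnd_mem_nbd he₁ h₁ hP (h₁.sec (hPc.1 k)).sub).2 ⟨k, Subset.rfl⟩⟩
  obtain ⟨y, ⟨x, ⟨hx, s, ⟨E, hE, hED, rfl⟩, hxE⟩, rfl⟩, hyD⟩ :=
    𝓕.nonempty_of_mem (inter_mem (hO O hOo hFO) (h𝓕 (m + 1)))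
  have : e₁ x ∈ E ∩ D (m + 1) := ⟨pePt_mem_peSection.1 hxE, hyD⟩
  rw [hED] at this
  exact this

/-- The ends over `q`. -/
def fiber (e₁ : X₁ → ℝ × ℝ) (q : PrimeEnd (e₂ ⁻¹' U)) : Set (PrimeEndComp (e₁ ⁻¹' U)) :=
  {z | ∃ p : PrimeEnd (e₁ ⁻¹' U), z = peEnd _ p ∧ Rel p q}

theorem fiber_subset_nbd (he₁ : IsOpenEmbedding e₁) (he₂ : IsOpenEmbedding e₂)
    (h₁ : Dom (range e₁) U) (h₂ : Dom (range e₂) U) (hC : Rep e₂ U q C) (n : ℕ) :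
    fiber e₁ q ⊆ nbd e₁ U (C n) := by
  rintro _ ⟨p, rfl, hr⟩
  obtain ⟨D, hD⟩ := exists_rep p
  exact (peEnd_mem_nbd he₁ h₁ hD (h₂.sec ((hC.chain he₂ h₂).1 n)).sub).2
    (hr.divides he₁ he₂ hD hC n)

theorem exists_separation (he₁ : IsOpenEmbedding e₁) (he₂ : IsOpenEmbedding e₂)
    (h₁ : Dom (range e₁) U) (h₂ : Dom (range e₂) U) (hsub : range e₂ ⊆ range e₁)
    {A B : Set (PrimeEndComp (e₁ ⁻¹' U))} (hA : IsOpen A) (hB : IsOpen B)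
    (hAB : fiber e₁ q ⊆ A ∪ B) (hd : fiber e₁ q ∩ (A ∩ B) = ∅) :
    ∃ A' B', IsOpen A' ∧ IsOpen B' ∧ fiber e₁ q ∩ A ⊆ A' ∧ fiber e₁ q ∩ B ⊆ B' ∧
      trace e₁ U A' ∩ trace e₁ U B' = ∅ := by
  set 𝒜 : Filter (e₁ ⁻¹' U) := comap (pePt (e₁ ⁻¹' U)) (𝓝ˢ (fiber e₁ q ∩ A))
  set ℬ : Filter (e₁ ⁻¹' U) := comap (pePt (e₁ ⁻¹' U)) (𝓝ˢ (fiber e₁ q ∩ B))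
  by_cases hdis : Disjoint 𝒜 ℬ
  · obtain ⟨s, ⟨s', hs', hss⟩, t, ⟨t', ht', htt⟩, hst⟩ := Filter.disjoint_iff.1 hdis
    obtain ⟨A', hA', hA1, hA2⟩ := mem_nhdsSet_iff_exists.1 hs'
    obtain ⟨B', hB', hB1, hB2⟩ := mem_nhdsSet_iff_exists.1 ht'
    refine ⟨A', B', hA', hB', hA1, hB1, ?_⟩
    rw [← trace_inter he₁]
    refine eq_empty_of_forall_notMem ?_
    rintro _ ⟨x, ⟨hx, hxA, hxB⟩, rfl⟩
    exact hst.le_bot ⟨hss (hA2 hxA), htt (hB2 hxB)⟩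
  exfalso
  have hne : (𝒜 ⊓ ℬ).NeBot := ⟨fun h => hdis (disjoint_iff.2 h)⟩
  let 𝓖 : Ultrafilter (e₁ ⁻¹' U) := Ultrafilter.of (𝒜 ⊓ ℬ)
  have h𝓖 : (𝓖 : Filter _) ≤ 𝒜 ⊓ ℬ := Ultrafilter.of_le _
  let 𝓕 : Ultrafilter (ℝ × ℝ) := 𝓖.map fun x => e₁ x.1
  have key : ∀ F O, (𝓖 : Filter _) ≤ comap (pePt (e₁ ⁻¹' U)) (𝓝ˢ F) → IsOpen O → F ⊆ O →
      trace e₁ U O ∈ 𝓕 := by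
    intro F O h hO hFO
    refine Ultrafilter.mem_map.2 (mem_of_superset (h (preimage_mem_comap (hO.mem_nhdsSet.2 hFO))) ?_)
    exact fun x hx => ⟨x.1, ⟨x.2, hx⟩, rfl⟩
  obtain ⟨C, hC⟩ := exists_rep q
  have hCc := hC.chain he₂ h₂
  have hC𝓕 : ∀ n, C n ∈ 𝓕 := fun n => by
    have := key _ (nbd e₁ U (C n)) (h𝓖.trans inf_le_left) (isOpen_nbd he₁ h₁ ((hCc.1 n).mono hsub))
      (inter_subset_left.trans (fiber_subset_nbd he₁ he₂ h₁ h₂ hC n))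
    rwa [trace_nbd h₁ (h₂.sec (hCc.1 n)).sub] at this
  obtain ⟨d, D, hD, hD𝓕, hdq⟩ := exists_end_of_ultrafilter he₁ he₂ h₁ h₂ hsub hC hC𝓕
  have hF : ∀ A', ∀ z ∈ fiber e₁ q ∩ A', ∃ p, z = peEnd _ p := by
    rintro A' z ⟨⟨p, hp, -⟩, -⟩
    exact ⟨p, hp⟩
  rcases hAB ⟨d, rfl, hdq⟩ with hdA | hdB
  · exact not_trace_mem he₁ h₁ hD hD𝓕 hA hdA (hF B)
      (by rw [inter_assoc, inter_comm B A, hd]) fun O => key _ O (h𝓖.trans inf_le_right)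
  · exact not_trace_mem he₁ h₁ hD hD𝓕 hB hdB (hF A)
      (by rw [inter_assoc, hd]) fun O => key _ O (h𝓖.trans inf_le_left)

theorem isPreconnected_fiber (he₁ : IsOpenEmbedding e₁) (he₂ : IsOpenEmbedding e₂)
    (h₁ : Dom (range e₁) U) (h₂ : Dom (range e₂) U) (hsub : range e₂ ⊆ range e₁) :
    IsPreconnected (fiber e₁ q) := by
  intro A B hA hB hAB hAne hBne
  by_contra hd
  obtain ⟨A', B', hA', hB', hAA, hBB, htr⟩ := exists_separation he₁ he₂ h₁ h₂ hsub hA hB hAB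
    (not_nonempty_iff_eq_empty.1 hd)
  obtain ⟨C, hC⟩ := exists_rep q
  have hCc := hC.chain he₂ h₂
  have meet : ∀ (A A' : Set (PrimeEndComp (e₁ ⁻¹' U))), IsOpen A' → (fiber e₁ q ∩ A).Nonempty →
      fiber e₁ q ∩ A ⊆ A' → ∀ n, (C n ∩ trace e₁ U A').Nonempty := by
    rintro A A' hA' ⟨_, ⟨p, rfl, hp⟩, hpA⟩ hAA n
    obtain ⟨D, hD⟩ := exists_rep p
    have hDc := hD.chain he₁ h₁
    obtain ⟨m, hm⟩ := exists_nbd_subset he₁ h₁ hD hA' (hAA ⟨⟨p, rfl, hp⟩, hpA⟩)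
    have hm' := trace_mono hm
    rw [trace_nbd h₁ (h₁.sec (hDc.1 m)).sub] at hm'
    rw [inter_comm]
    exact (hDc.meets_of_divides h₁ (hp.divides he₁ he₂ hD hC) m n).mono
      (inter_subset_inter_left _ hm')
  have hpt : ∀ n, ∃ x, x ∈ C n ∧ x ∉ trace e₁ U A' ∪ trace e₁ U B' := by
    intro n
    by_contra! hcon
    obtain ⟨y, -, hy⟩ := (h₂.sec (hCc.1 n)).conn.isPreconnected _ _ (isOpen_trace he₁ h₁ hA')
      (isOpen_trace he₁ h₁ hB') hcon (meet A A' hA' hAne hAA n) (meet B B' hB' hBne hBB n)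
    rw [htr] at hy
    exact hy
  choose x hx hx' using hpt
  let 𝓕 : Ultrafilter (ℝ × ℝ) := Ultrafilter.of (map x atTop)
  have h𝓕 : ∀ n, C n ∈ 𝓕 := fun n =>
    Ultrafilter.of_le (map x atTop) (mem_map.2 (mem_atTop_sets.2
      ⟨n, fun m hm => hCc.2.1 m n hm (hx m)⟩))
  have h𝓕' : (trace e₁ U A' ∪ trace e₁ U B')ᶜ ∈ 𝓕 :=
    Ultrafilter.of_le (map x atTop) (mem_map.2 (Eventually.of_forall hx'))
  obtain ⟨d, D, hD, hD𝓕, hdq⟩ := exists_end_of_ultrafilter he₁ he₂ h₁ h₂ hsub hC h𝓕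
  have fin : ∀ A', IsOpen A' → peEnd _ d ∈ A' → trace e₁ U A' ∈ 𝓕 := by
    intro A' hA' hdA
    obtain ⟨m, hm⟩ := exists_nbd_subset he₁ h₁ hD hA' hdA
    have hm' := trace_mono hm
    rw [trace_nbd h₁ (h₁.sec ((hD.chain he₁ h₁).1 m)).sub] at hm'
    exact mem_of_superset (hD𝓕 m) hm'
  have hmem : trace e₁ U A' ∪ trace e₁ U B' ∈ 𝓕 := by
    rcases hAB ⟨d, rfl, hdq⟩ with hdA | hdB
    · exact mem_of_superset (fin A' hA' (hAA ⟨⟨d, rfl, hdq⟩, hdA⟩)) subset_union_left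
    · exact mem_of_superset (fin B' hB' (hBB ⟨⟨d, rfl, hdq⟩, hdB⟩)) subset_union_right
  obtain ⟨y, hy, hy'⟩ := 𝓕.nonempty_of_mem (inter_mem hmem h𝓕')
  exact hy' hy

/-- The prime ends compactification of a plane domain relative to a surface maps monotonically
onto the one relative to a smaller surface. -/
theorem exists_monotone_map (he₁ : IsOpenEmbedding e₁) (he₂ : IsOpenEmbedding e₂)
    (h₁ : Dom (range e₁) U) (h₂ : Dom (range e₂) U) (hsub : range e₂ ⊆ range e₁) :
    ∃ i : PrimeEndComp (e₁ ⁻¹' U) → PrimeEndComp (e₂ ⁻¹' U), Continuous i ∧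
      Function.Surjective i ∧
      (∀ (x : ↥(e₁ ⁻¹' U)) (x' : ↥(e₂ ⁻¹' U)), e₁ x = e₂ x' → i (pePt _ x) = pePt _ x') ∧
      ∀ z, IsConnected (i ⁻¹' {z}) := by
  choose f hf using exists_rel (U := U) he₁ he₂ h₁ h₂ hsub
  have hback : ∀ x : ↥(e₁ ⁻¹' U), ∃ x' : ↥(e₂ ⁻¹' U), e₁ x = e₂ x' := by
    rintro ⟨x, hx⟩
    obtain ⟨y, hy⟩ := h₂.sub hx
    exact ⟨⟨y, by rw [mem_preimage, hy]; exact hx⟩, hy.symm⟩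
  have hback' : ∀ x' : ↥(e₂ ⁻¹' U), ∃ x : ↥(e₁ ⁻¹' U), e₁ x = e₂ x' := by
    rintro ⟨x, hx⟩
    obtain ⟨y, hy⟩ := h₁.sub hx
    exact ⟨⟨y, by rw [mem_preimage, hy]; exact hx⟩, hy⟩
  choose b hb using hback
  let i : PrimeEndComp (e₁ ⁻¹' U) → PrimeEndComp (e₂ ⁻¹' U) :=
    Sum.elim (fun x => pePt _ (b x)) (fun p => peEnd _ (f p))
  have hi : ∀ (x : ↥(e₁ ⁻¹' U)) (x' : ↥(e₂ ⁻¹' U)), e₁ x = e₂ x' → i (pePt _ x) = pePt _ x' := by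
    intro x x' h
    exact congrArg (pePt _) (Subtype.ext (he₂.injective ((hb x).symm.trans h)))
  have hopen : ∀ V : Set (ℝ × ℝ), IsOpen V → V ⊆ U → IsOpen (peOpen (e₁ ⁻¹' U) (e₁ ⁻¹' V)) :=
    fun V hV hVU => TopologicalSpace.isOpen_generateFrom_of_mem
      (Or.inl ⟨_, hV.preimage he₁.continuous, preimage_mono hVU, rfl⟩)
  refine ⟨i, continuous_generateFrom_iff.2 ?_, ?_, hi, ?_⟩
  · rintro s (⟨V, hV, hVU, rfl⟩ | ⟨E, hE, rfl⟩)
    · have : i ⁻¹' peOpen (e₂ ⁻¹' U) V = peOpen (e₁ ⁻¹' U) (e₁ ⁻¹' (e₂ '' V)) := by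
        ext z
        rcases z with x | p
        · change pePt _ (b x) ∈ peOpen (e₂ ⁻¹' U) V ↔ pePt _ x ∈ _
          rw [pePt_mem_peOpen, pePt_mem_peOpen, mem_preimage, hb, he₂.injective.mem_set_image]
        · exact iff_of_false peEnd_notMem_peOpen peEnd_notMem_peOpen
      rw [this]
      exact hopen _ (he₂.isOpenMap V hV) (image_subset_iff.2 hVU)
    · have hEs := h₂.sec ((crossSection_iff he₂ h₂.sub).1 hE)
      rw [isOpen_iff_forall_mem_open]
      rintro (x | p) hz
      · refine ⟨peOpen (e₁ ⁻¹' U) (e₁ ⁻¹' (e₂ '' E)), ?_, hopen _ hEs.isOpen hEs.sub, ?_⟩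
        · rintro _ ⟨y, rfl, hy⟩
          refine pePt_mem_peSection.2 ?_
          rwa [mem_preimage, hb, he₂.injective.mem_set_image] at hy
        · refine pePt_mem_peOpen.2 ?_
          rw [mem_preimage, hb, he₂.injective.mem_set_image]
          exact pePt_mem_peSection.1 hz
      · change peEnd _ (f p) ∈ peSection _ E at hz
        obtain ⟨C, hC⟩ := exists_rep (f p)
        have hCc := hC.chain he₂ h₂
        rw [peEnd_mem_peSection, primeEndDivides_iff he₂ h₂ hC] at hz
        obtain ⟨N, hN⟩ := hz
        obtain ⟨D, hD⟩ := exists_rep p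
        have hDc := hD.chain he₁ h₁
        obtain ⟨m, hm⟩ := (hf p).divides he₁ he₂ hD hC (N + 1)
        refine ⟨nbd e₁ U (D m), ?_, isOpen_nbd he₁ h₁ (hDc.1 m),
          (peEnd_mem_nbd he₁ h₁ hD (h₁.sec (hDc.1 m)).sub).2 ⟨m, Subset.rfl⟩⟩
        rintro (y | p') hy
        · refine pePt_mem_peSection.2 ((he₂.injective.mem_set_image (s := E)).1 ?_)
          rw [← hb]
          exact hN (hCc.2.1 _ _ (Nat.le_succ N) (hm (pePt_mem_peSection.1 hy)))
        · obtain ⟨D', hD'⟩ := exists_rep p'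
          obtain ⟨k, hk⟩ := (peEnd_mem_nbd he₁ h₁ hD' (h₁.sec (hDc.1 m)).sub).1 hy
          obtain ⟨C', hC', hCn'⟩ := exists_null_rep he₂ h₂ (f p')
          have hd' := (hf p').divides he₁ he₂ hD' hC'
          obtain ⟨n, hn⟩ := h₂.dichotomy (hC'.chain he₂ h₂) hCn' (h₂.sec (hCc.1 N))
            (h₂.sec (hCc.1 (N + 1))) (hCc.2.1 _ _ (Nat.le_succ N))
            (hCc.2.2 _ _ (Nat.succ_ne_self N).symm) fun n => by
              have := (hD'.chain he₁ h₁).meets_of_divides h₁ hd' k n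
              rw [inter_comm]
              exact this.mono (inter_subset_inter_left _ (hk.trans hm))
          exact peEnd_mem_peSection.2 ((primeEndDivides_iff he₂ h₂ hC').2 ⟨n, hn.trans hN⟩)
  · rintro (x' | q)
    · obtain ⟨x, hx⟩ := hback' x'
      exact ⟨pePt _ x, hi x x' hx⟩
    · obtain ⟨p, hp⟩ := exists_rel' he₁ he₂ h₁ h₂ hsub q
      exact ⟨peEnd _ p, congrArg (peEnd _) ((hf p).unique he₁ he₂ h₁ h₂ hp)⟩
  · rintro (x' | q)
    · obtain ⟨x, hx⟩ := hback' x'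
      change IsConnected (i ⁻¹' {pePt _ x'})
      have : i ⁻¹' {pePt _ x'} = {pePt _ x} := by
        refine Subset.antisymm ?_ (singleton_subset_iff.2 (hi x x' hx))
        rintro (y | p) hy
        · have hy' : b y = x' := Sum.inl.inj hy
          refine congrArg (pePt _) (Subtype.ext (he₁.injective ?_))
          rw [hb, hy', hx]
        · exact absurd hy Sum.inr_ne_inl
      rw [this]
      exact isConnected_singleton
    · change IsConnected (i ⁻¹' {peEnd _ q})
      have : i ⁻¹' {peEnd _ q} = fiber e₁ q := by
        refine Subset.antisymm ?_ ?_
        · rintro (y | p) hy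
          · exact absurd hy Sum.inl_ne_inr
          · have hy' : f p = q := Sum.inr.inj hy
            exact ⟨p, rfl, hy' ▸ hf p⟩
        · rintro _ ⟨p, rfl, hp⟩
          exact congrArg (peEnd _) ((hf p).unique he₁ he₂ h₁ h₂ hp)
      rw [this]
      obtain ⟨p, hp⟩ := exists_rel' he₁ he₂ h₁ h₂ hsub q
      exact ⟨⟨_, p, rfl, hp⟩, isPreconnected_fiber he₁ he₂ h₁ h₂ hsub⟩

end Change

end PlanePE

/-- Prime ends under change of ambient surface: the inclusion extends to a
continuous monotone surjection `c_E(U,ℝ²) → c_E(U,S₀)`. -/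
theorem prime_ends_monotone_surjection
    (U : Set (ℝ × ℝ)) (hUopen : IsOpen U) (hUsc : SimplyConnectedSpace ↥U)
    (hUcompl : Set.Nontrivial Uᶜ)
    (S₀ : Set (ℝ × ℝ)) (hS₀open : IsOpen S₀) (hS₀conn : IsConnected S₀)
    (hUS₀ : U ⊆ S₀) (hUne : U ≠ S₀) :
    ∃ i : PrimeEndComp U → PrimeEndComp (Subtype.val ⁻¹' U : Set ↥S₀),
      Continuous i ∧ Function.Surjective i ∧
      (∀ (x : ℝ × ℝ) (hx : x ∈ U) (hx' : x ∈ S₀),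
        i (pePt U ⟨x, hx⟩) = pePt (Subtype.val ⁻¹' U : Set ↥S₀) ⟨⟨x, hx'⟩, hx⟩) ∧
      ∀ z : PrimeEndComp (Subtype.val ⁻¹' U : Set ↥S₀), IsConnected (i ⁻¹' {z}) := by
  have hpre : IsPreconnected U := isPreconnected_iff_preconnectedSpace.2 inferInstance
  have h₁ : PlanePE.Dom (range (id : ℝ × ℝ → ℝ × ℝ)) U := by
    rw [range_id]
    exact ⟨hUopen, hpre, hUsc, isOpen_univ, isPreconnected_univ, subset_univ _, fun h => by
      rw [h, compl_univ] at hUcompl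
      exact not_nontrivial_empty hUcompl⟩
  have h₂ : PlanePE.Dom (range (Subtype.val : S₀ → ℝ × ℝ)) U := by
    rw [Subtype.range_coe]
    exact ⟨hUopen, hpre, hUsc, hS₀open, hS₀conn.isPreconnected, hUS₀, hUne⟩
  obtain ⟨i, hi, his, hix, hic⟩ := PlanePE.exists_monotone_map IsOpenEmbedding.id
    hS₀open.isOpenEmbedding_subtypeVal h₁ h₂ (by rw [range_id]; exact subset_univ _)
  exact ⟨i, hi, his, fun x hx hx' => hix ⟨x, hx⟩ ⟨⟨x, hx'⟩, hx⟩ rfl, hic⟩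

end
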